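/- Let 0 < θ < θ' ≤ π/2 be fixed angles and set r := sqrt((cos θ − cos θ')/(1 − cos θ')). Then M(n,θ) ≤ (1+o(1))·sqrt(π/(6e(1−cos θ')))·[sqrt(2πn)·r·M_Lev(n−2,θ')/(1−r²)^{(n−1)/2}] as n → ∞; equivalently, limsup_{n→∞} M(n,θ)·(1−r²)^{(n−1)/2}/(sqrt(2πn)·r·M_Lev(n−2,θ')) ≤ sqrt(π/(6e(1−cos θ'))). (This is the bound obtained from the function H constructed by averaging Levenshtein's optimal polynomial for M(n−2,θ') over the Stiefel manifold V_2(ℝ^n).) -/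

import Mathlib

open MeasureTheory Filter Real
open scoped RealInnerProductSpace

noncomputable section

/-- Generalized binomial coefficient `C(a, k)` for real `a`. -/
def genBinom (a : ℝ) (k : ℕ) : ℝ := (∏ i ∈ Finset.range k, (a - i)) / (Nat.factorial k : ℝ)

/-- The Jacobi polynomial `p_d^{α,β}`, via the standard explicit formula; it is the degree-`d`
polynomial orthogonal to lower degrees for the weight `(1-t)^α (1+t)^β` on `[-1,1]`,
normalized by `p_d^{α,β}(1) = Γ(d+α+1)/(Γ(α+1)Γ(d+1))`. -/
def jacobiP (α β : ℝ) (d : ℕ) (x : ℝ) : ℝ :=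
  ∑ s ∈ Finset.range (d + 1),
    genBinom ((d : ℝ) + α) (d - s) * genBinom ((d : ℝ) + β) s *
      ((x - 1) / 2) ^ s * ((x + 1) / 2) ^ (d - s)

/-- The largest root `t_{1,d}^{α,β}` of the Jacobi polynomial `p_d^{α,β}`. -/
def maxRoot (α β : ℝ) (d : ℕ) : ℝ := sSup {x : ℝ | jacobiP α β d x = 0}

/-- The degree `d = d(n, θ')` determined by `t_{1,d-1}^{α+1,α+1} < cos θ' ≤ t_{1,d}^{α+1,α+1}`,
where `α = (n-3)/2`. -/
def levD (n : ℕ) (θ' : ℝ) : ℕ :=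
  sInf {d : ℕ | 1 ≤ d ∧
    Real.cos θ' ≤ maxRoot (((n : ℝ) - 3) / 2 + 1) (((n : ℝ) - 3) / 2 + 1) d}

/-- Levenshtein's bound `M_Lev(n, θ')` on the size of `θ'`-spherical codes in `S^{n-1}`. -/
def MLev (n : ℕ) (θ' : ℝ) : ℝ :=
  if maxRoot (((n : ℝ) - 3) / 2 + 1) (((n : ℝ) - 3) / 2) (levD n θ') < Real.cos θ' then
    2 * (Nat.choose (levD n θ' + n - 1) (n - 1) : ℝ)
  else
    (Nat.choose (levD n θ' + n - 1) (n - 1) : ℝ) + (Nat.choose (levD n θ' + n - 2) (n - 1) : ℝ)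

/-- The maximal size `M(n, θ)` of a `θ`-spherical code in `S^{n-1}`. -/
def Mcode (n : ℕ) (θ : ℝ) : ℕ :=
  sSup {N : ℕ | ∃ A : Finset (EuclideanSpace ℝ (Fin n)), A.card = N ∧
    (∀ x ∈ A, ‖x‖ = 1) ∧ ∀ x ∈ A, ∀ y ∈ A, x ≠ y → ⟪x, y⟫ ≤ Real.cos θ}

noncomputable section
namespace SCB
open Polynomial Set

lemma beta01 {a b : ℝ} (ha : 0 < a) (hb : 0 < b) :
    ∫ x in (0:ℝ)..1, x ^ (a - 1) * (1 - x) ^ (b - 1) = Gamma a * Gamma b / Gamma (a + b) := by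
  have h := Complex.betaIntegral_eq_Gamma_mul_div (a : ℂ) (b : ℂ) (by simpa) (by simpa)
  have h2 : Complex.betaIntegral (a : ℂ) (b : ℂ) =
      ((∫ x in (0:ℝ)..1, x ^ (a - 1) * (1 - x) ^ (b - 1) : ℝ) : ℂ) := by
    rw [Complex.betaIntegral, ← intervalIntegral.integral_ofReal]
    apply intervalIntegral.integral_congr
    intro x hx
    rw [Set.uIcc_of_le (by norm_num)] at hx
    simp only
    rw [Complex.ofReal_mul, Complex.ofReal_cpow hx.1, Complex.ofReal_cpow (by linarith [hx.2])]
    push_cast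
    rfl
  rw [h2, ← Complex.ofReal_add, Complex.Gamma_ofReal, Complex.Gamma_ofReal, Complex.Gamma_ofReal]
    at h
  exact_mod_cast h

/-- Jacobi weight. -/
def wt (a b t : ℝ) : ℝ := (1 - t) ^ a * (1 + t) ^ b

lemma wt_int {a b : ℝ} (ha : -1 < a) (hb : -1 < b) :
    ∫ t in (-1:ℝ)..1, wt a b t =
      2 ^ (a + b + 1) * Gamma (a + 1) * Gamma (b + 1) / Gamma (a + b + 2) := by
  have h := beta01 (a := a + 1) (b := b + 1) (by linarith) (by linarith)
  have h2 := intervalIntegral.integral_comp_sub_mul (a := 0) (b := 1) (fun t => wt a b t)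
    (c := 2) (by norm_num) 1
  rw [mul_one, mul_zero, sub_zero, show (1:ℝ) - 2 = -1 by norm_num, smul_eq_mul] at h2
  have h3 : ∫ x in (0:ℝ)..1, wt a b (1 - 2 * x) =
      ∫ x in (0:ℝ)..1, (2:ℝ) ^ (a + b) * (x ^ (a + 1 - 1) * (1 - x) ^ (b + 1 - 1)) := by
    apply intervalIntegral.integral_congr
    intro x hx
    rw [Set.uIcc_of_le (by norm_num)] at hx
    simp only [wt]
    rw [show 1 - (1 - 2 * x) = 2 * x by ring, show 1 + (1 - 2 * x) = 2 * (1 - x) by ring,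
      Real.mul_rpow (by norm_num) hx.1, Real.mul_rpow (by norm_num) (by linarith [hx.2]),
      Real.rpow_add (by norm_num), add_sub_cancel_right, add_sub_cancel_right]
    ring
  rw [h3, intervalIntegral.integral_const_mul, h] at h2
  rw [Real.rpow_add_one (by norm_num), show a + b + 2 = a + 1 + (b + 1) by ring]
  field_simp at h2 ⊢
  linarith

lemma wt_cont {a b : ℝ} (ha : 0 ≤ a) (hb : 0 ≤ b) : Continuous (wt a b) := by
  unfold wt
  exact ((continuous_const.sub continuous_id).rpow_const fun _ => Or.inr ha).mul
    ((continuous_const.add continuous_id).rpow_const fun _ => Or.inr hb)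

lemma wt_pos {a b t : ℝ} (h : t ∈ Ioo (-1:ℝ) 1) : 0 < wt a b t := by
  unfold wt
  exact mul_pos (Real.rpow_pos_of_pos (by linarith [h.2]) _)
    (Real.rpow_pos_of_pos (by linarith [h.1]) _)

/-- Jacobi functional. -/
def L (a b : ℝ) (f : ℝ[X]) : ℝ := ∫ t in (-1:ℝ)..1, f.eval t * wt a b t

lemma L_add {a b : ℝ} (ha : 0 ≤ a) (hb : 0 ≤ b) (f g : ℝ[X]) : L a b (f + g) = L a b f + L a b g := by
  unfold L
  rw [← intervalIntegral.integral_add]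
  · simp [add_mul]
  · exact (f.continuous.mul (wt_cont ha hb)).intervalIntegrable _ _
  · exact (g.continuous.mul (wt_cont ha hb)).intervalIntegrable _ _

lemma L_smul {a b : ℝ} (c : ℝ) (f : ℝ[X]) : L a b (C c * f) = c * L a b f := by
  unfold L
  rw [← intervalIntegral.integral_const_mul]
  simp [mul_assoc]

lemma L_sum {a b : ℝ} (ha : 0 ≤ a) (hb : 0 ≤ b) {ι : Type*} (s : Finset ι) (f : ι → ℝ[X]) :
    L a b (∑ i ∈ s, f i) = ∑ i ∈ s, L a b (f i) := by
  classical
  induction s using Finset.induction_on with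
  | empty => simp [L]
  | insert i s hi ih => rw [Finset.sum_insert hi, Finset.sum_insert hi, L_add ha hb, ih]

/-- sign positivity -/
lemma L_pos {a b : ℝ} (ha : 0 ≤ a) (hb : 0 ≤ b) (f : ℝ[X]) (hf : f ≠ 0)
    (h : ∀ t ∈ Ioo (-1:ℝ) 1, 0 ≤ f.eval t) : 0 < L a b f := by
  unfold L
  obtain ⟨t, ht, hft⟩ : ∃ t ∈ Ioo (-1:ℝ) 1, f.eval t ≠ 0 := by
    by_contra! hc
    apply hf
    apply Polynomial.eq_zero_of_infinite_isRoot
    exact (Ioo_infinite (by norm_num : (-1:ℝ) < 1)).mono fun t ht => hc t ht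
  refine intervalIntegral.integral_pos (by norm_num) ((f.continuous.mul (wt_cont ha hb)).continuousOn)
    ?_ ⟨t, ⟨ht.1.le, ht.2.le⟩, mul_pos (lt_of_le_of_ne (h t ht) hft.symm) (wt_pos ht)⟩
  intro x hx
  rcases eq_or_lt_of_le hx.2 with h1 | h1
  · have h0 : ∀ t ∈ Icc (-1:ℝ) 1, 0 ≤ f.eval t := by
      intro t ht
      have : t ∈ closure (Ioo (-1:ℝ) 1) := by rw [closure_Ioo (by norm_num)]; exact ht
      exact closure_minimal (fun t ht => h t ht) (isClosed_le continuous_const f.continuous) this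
    refine mul_nonneg (h0 x ⟨hx.1.le, hx.2⟩) ?_
    unfold wt
    exact mul_nonneg (Real.rpow_nonneg (by linarith) _) (Real.rpow_nonneg (by linarith [hx.1]) _)
  · exact mul_nonneg (h x ⟨hx.1, h1⟩) (wt_pos ⟨hx.1, h1⟩).le

/-- polynomial version -/
def jp (α β : ℝ) (d : ℕ) : ℝ[X] :=
  ∑ s ∈ Finset.range (d + 1),
    C (genBinom ((d : ℝ) + α) (d - s) * genBinom ((d : ℝ) + β) s) *
      (C (1/2) * (X - 1)) ^ s * (C (1/2) * (X + 1)) ^ (d - s)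

lemma jp_eval (α β : ℝ) (d : ℕ) (x : ℝ) : (jp α β d).eval x = jacobiP α β d x := by
  unfold jp jacobiP
  rw [Polynomial.eval_finsetSum]
  apply Finset.sum_congr rfl
  intro s _
  simp only [eval_mul, eval_C, eval_pow, eval_sub, eval_add, eval_X, eval_one]
  ring

lemma jp_degree_le (α β : ℝ) (d : ℕ) : (jp α β d).natDegree ≤ d := by
  unfold jp
  apply Polynomial.natDegree_sum_le_of_forall_le
  intro s hs
  rw [Finset.mem_range] at hs
  have h1 : (C (1/2:ℝ) * (X - 1)).natDegree ≤ 1 := by compute_degree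
  have h2 : (C (1/2:ℝ) * (X + 1)).natDegree ≤ 1 := by compute_degree
  calc _ ≤ (0 + s * 1) + (d - s) * 1 := by
        refine natDegree_mul_le_of_le (natDegree_mul_le_of_le (natDegree_C _).le ?_) ?_
        · exact natDegree_pow_le_of_le _ h1
        · exact natDegree_pow_le_of_le _ h2
    _ ≤ d := by omega

lemma genBinom_gamma {a : ℝ} {k : ℕ} (h : 0 < a - k + 1) :
    genBinom a k = Gamma (a + 1) / (Gamma (a - k + 1) * (k.factorial : ℝ)) := by
  have : Gamma (a + 1) = Gamma (a - k + 1) * ∏ i ∈ Finset.range k, (a - i) := by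
    induction k with
    | zero => simp
    | succ k ih =>
      push_cast at h
      rw [ih (by linarith), Finset.prod_range_succ, show a - k + 1 = (a - k) + 1 by ring,
        Real.Gamma_add_one (by linarith)]
      push_cast
      rw [show a - (k + 1) + 1 = a - k by ring]
      ring
  rw [genBinom, this]
  have := (Gamma_pos_of_pos h).ne'
  field_simp

lemma alt_sum_poly {d : ℕ} (P : ℝ[X]) (hP : P.natDegree < d) :
    ∑ s ∈ Finset.range (d + 1), (-1:ℝ) ^ s * (d.choose s : ℝ) * P.eval (s:ℝ) = 0 := by
  have h := Polynomial.fwdDiff_iter_eq_zero_of_degree_lt hP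
  have h2 := fwdDiff_iter_eq_sum_shift (1:ℝ) P.eval d 0
  rw [h] at h2
  simp only [Pi.zero_apply, zero_add, nsmul_eq_mul, mul_one, zsmul_eq_mul] at h2
  have h3 : (∑ s ∈ Finset.range (d + 1), (-1:ℝ) ^ s * (d.choose s : ℝ) * P.eval (s:ℝ)) =
    (-1) ^ d * ∑ x ∈ Finset.range (d + 1), (((-1:ℤ) ^ (d - x) * (d.choose x : ℤ) : ℤ) : ℝ) * eval (x:ℝ) P := by
    rw [Finset.mul_sum]
    apply Finset.sum_congr rfl
    intro s hs
    rw [Finset.mem_range] at hs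
    push_cast
    have : (-1:ℝ) ^ d = (-1) ^ s * (-1) ^ (d - s) := by rw [← pow_add]; congr 1; omega
    have h5 : ((-1:ℝ) ^ (d-s)) * (-1) ^ (d - s) = 1 := by rw [← mul_pow]; simp
    rw [this]
    linear_combination (-(-1:ℝ) ^ s * (d.choose s : ℝ) * P.eval (s:ℝ)) * h5
  rw [h3, ← h2, mul_zero]

lemma alt_sum_inv {d : ℕ} {A : ℝ} (hA : 0 < A) :
    ∑ s ∈ Finset.range (d + 1), (-1:ℝ) ^ s * (d.choose s : ℝ) * (1 / (A + s)) =
      d.factorial * Gamma A / Gamma (A + d + 1) := by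
  induction d generalizing A with
  | zero =>
    simp [Real.Gamma_add_one hA.ne']
    have := (Gamma_pos_of_pos hA).ne'
    field_simp
  | succ d ih =>
    have key : ∑ s ∈ Finset.range (d + 1 + 1), (-1:ℝ) ^ s * ((d+1).choose s : ℝ) * (1 / (A + s)) =
       (∑ s ∈ Finset.range (d + 1), (-1:ℝ) ^ s * (d.choose s : ℝ) * (1 / (A + s))) -
       ∑ s ∈ Finset.range (d + 1), (-1:ℝ) ^ s * (d.choose s : ℝ) * (1 / (A + 1 + s)) := by
      rw [Finset.sum_range_succ' _ (d+1)]
      have e1 : ∑ s ∈ Finset.range (d + 1), (-1:ℝ) ^ s * (d.choose s : ℝ) * (1 / (A + s)) =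
         ∑ s ∈ Finset.range (d + 1), (-1:ℝ) ^ (s+1) * (d.choose (s+1) : ℝ) * (1 / (A + (s+1 : ℕ))) + 1 / A := by
        have := Finset.sum_range_succ' (fun s : ℕ => (-1:ℝ) ^ s * (d.choose s : ℝ) * (1 / (A + s))) (d+1)
        rw [Finset.sum_range_succ] at this
        simp at this
        simp [this]
      rw [e1]
      simp only [Nat.choose_succ_succ]
      push_cast
      rw [eq_sub_iff_add_eq, add_right_comm, ← Finset.sum_add_distrib]
      simp
      apply Finset.sum_congr rfl
      intro s _
      rw [show A + 1 + (s:ℝ) = A + (s + 1) by ring]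
      ring
    rw [key, ih hA, ih (by linarith : 0 < A + 1)]
    push_cast
    have hG := Real.Gamma_add_one (s := A + d + 1) (by positivity)
    rw [Nat.factorial_succ, Real.Gamma_add_one hA.ne', show A + 1 + (d:ℝ) + 1 = (A + d + 1) + 1 by ring,
      show A + ((d:ℝ) + 1) + 1 = (A + d + 1) + 1 by ring, hG]
    have := (Gamma_pos_of_pos (by positivity : 0 < A + d + 1)).ne'
    generalize Gamma (A + d + 1) = G at *
    push_cast
    field_simp
    ring

end SCB
end

noncomputable section
namespace SCB
open Polynomial Set

lemma wt_shift {a b t : ℝ} (ha : 0 ≤ a) (hb : 0 ≤ b) (k l : ℕ) (ht : t ∈ Icc (-1:ℝ) 1) :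
    wt (a + k) (b + l) t = wt a b t * (1 - t) ^ k * (1 + t) ^ l := by
  unfold wt
  rw [Real.rpow_add_of_nonneg (by linarith [ht.2]) ha (by positivity),
    Real.rpow_add_of_nonneg (by linarith [ht.1]) hb (by positivity), Real.rpow_natCast,
    Real.rpow_natCast]
  ring

lemma L_congr {a b : ℝ} {f : ℝ[X]} {g : ℝ → ℝ} (h : ∀ t ∈ Icc (-1:ℝ) 1, f.eval t * wt a b t = g t) :
    L a b f = ∫ t in (-1:ℝ)..1, g t := by
  unfold L
  apply intervalIntegral.integral_congr
  intro t ht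
  rw [Set.uIcc_of_le (by norm_num)] at ht
  exact h t ht

lemma moment_term {A β : ℝ} (hA : 1 ≤ A) (hβ : 0 ≤ β) (d j s : ℕ) (hs : s ≤ d) :
    L (A - 1) β (C (genBinom ((d : ℝ) + A) (d - s) * genBinom ((d : ℝ) + β) s) *
      (C (1/2) * (X - 1)) ^ s * (C (1/2) * (X + 1)) ^ (d - s) * (1 - X) ^ j) =
    (2 ^ (A + β + j) * Gamma (d + A + 1) * Gamma (d + β + 1) /
      (d.factorial * Gamma (A + β + j + d + 1))) *
    ((-1:ℝ) ^ s * (d.choose s : ℝ) * (Gamma (A + j + s) / Gamma (A + s + 1))) := by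
  have e : L (A - 1) β (C (genBinom ((d : ℝ) + A) (d - s) * genBinom ((d : ℝ) + β) s) *
      (C (1/2) * (X - 1)) ^ s * (C (1/2) * (X + 1)) ^ (d - s) * (1 - X) ^ j) =
      ∫ t in (-1:ℝ)..1, (genBinom ((d : ℝ) + A) (d - s) * genBinom ((d : ℝ) + β) s *
        ((-1) ^ s * (1/2) ^ d)) * wt (A - 1 + (j + s : ℕ)) (β + (d - s : ℕ)) t := by
    apply L_congr
    intro t ht
    rw [wt_shift (by linarith) hβ _ _ ht]
    simp only [eval_mul, eval_C, eval_pow, eval_sub, eval_add, eval_X, eval_one]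
    have h1 : (1/2:ℝ) ^ d = (1/2) ^ s * (1/2) ^ (d - s) := by rw [← pow_add]; congr 1; omega
    rw [h1, show t - 1 = (-1) * (1 - t) by ring, mul_pow, mul_pow, mul_pow, add_comm t 1, pow_add]
    ring
  have hcast : ((d - s : ℕ) : ℝ) = d - s := by push_cast [Nat.cast_sub hs]; ring
  have hsd : (s : ℝ) ≤ d := by exact_mod_cast hs
  rw [e, intervalIntegral.integral_const_mul, wt_int
    (by push_cast; linarith [(Nat.cast_nonneg j : (0:ℝ) ≤ j), (Nat.cast_nonneg s : (0:ℝ) ≤ s)])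
    (by linarith [(Nat.cast_nonneg (d - s) : (0:ℝ) ≤ (d - s : ℕ))]),
    genBinom_gamma (by rw [hcast]; linarith [(Nat.cast_nonneg s : (0:ℝ) ≤ s)]), genBinom_gamma (by linarith),
    Nat.choose_eq_factorial_div_factorial hs, Nat.cast_div (Nat.factorial_mul_factorial_dvd_factorial hs) (by positivity)]
  push_cast
  rw [hcast]
  have r1 : (2:ℝ) ^ (A - 1 + ((j:ℝ) + s) + (β + (d - s)) + 1) = 2 ^ (A + β + j) * 2 ^ d := by
    rw [← Real.rpow_natCast, ← Real.rpow_add (by norm_num)]; congr 1; ring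
  rw [r1, show A - 1 + ((j:ℝ) + s) + 1 = A + j + s by ring,
    show β + ((d:ℝ) - s) + 1 = d + β - s + 1 by ring,
    show A - 1 + ((j:ℝ) + s) + (β + ((d:ℝ) - s)) + 2 = A + β + j + d + 1 by ring,
    show (d:ℝ) + A - (d - s) + 1 = A + s + 1 by ring]
  have g1 := (Gamma_pos_of_pos (by linarith : 0 < (d:ℝ) + β - s + 1)).ne'
  have g2 := (Gamma_pos_of_pos (by positivity : 0 < A + s + 1)).ne'
  have g3 := (Gamma_pos_of_pos (by positivity : 0 < A + β + j + d + 1)).ne'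
  have : (2:ℝ) ^ d * (1/2) ^ d = 1 := by rw [← mul_pow]; norm_num
  field_simp
  linear_combination this

/-- polynomial product (x+A+1)...(x+A+j) -/
lemma gamma_ratio_poly {A : ℝ} (hA : 1 ≤ A) (j : ℕ) :
    ∃ P : ℝ[X], P.natDegree ≤ j ∧ ∀ s : ℕ, Gamma (A + (j + 1 : ℕ) + s) / Gamma (A + s + 1) = P.eval (s:ℝ) := by
  induction j with
  | zero =>
    refine ⟨1, by simp, fun s => ?_⟩
    have g2 := (Gamma_pos_of_pos (by positivity : 0 < A + s + 1)).ne'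
    rw [show A + ((0 + 1 : ℕ):ℝ) + s = A + s + 1 by push_cast; ring]
    simp [g2]
  | succ j ih =>
    obtain ⟨P, h1, h2⟩ := ih
    refine ⟨P * (X + C (A + (j + 1))), ?_, fun s => ?_⟩
    · refine natDegree_mul_le_of_le h1 ?_
      compute_degree
    · rw [eval_mul, ← h2, show A + ((j + 1 + 1 : ℕ):ℝ) + s = (A + ((j + 1 : ℕ):ℝ) + s) + 1 by push_cast; ring,
        Real.Gamma_add_one (by positivity)]
      simp only [eval_add, eval_X, eval_C]
      push_cast
      ring

/-- value of the reproducing constant -/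
def Ic (A β : ℝ) (d : ℕ) : ℝ := 2 ^ (A + β) * Gamma A * Gamma (d + β + 1) / Gamma (A + β + d + 1)

lemma Ic_pos {A β : ℝ} (hA : 1 ≤ A) (hβ : 0 ≤ β) (d : ℕ) : 0 < Ic A β d := by
  unfold Ic
  have := Gamma_pos_of_pos (by positivity : 0 < A)
  have := Gamma_pos_of_pos (by positivity : 0 < d + β + 1)
  have := Gamma_pos_of_pos (by positivity : 0 < A + β + d + 1)
  positivity

lemma moment {A β : ℝ} (hA : 1 ≤ A) (hβ : 0 ≤ β) {d j : ℕ} (hj : j ≤ d) :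
    L (A - 1) β (jp A β d * (1 - X) ^ j) = if j = 0 then Ic A β d else 0 := by
  have : L (A - 1) β (jp A β d * (1 - X) ^ j) = (2 ^ (A + β + j) * Gamma (d + A + 1) * Gamma (d + β + 1) /
      (d.factorial * Gamma (A + β + j + d + 1))) * ∑ s ∈ Finset.range (d + 1),
    ((-1:ℝ) ^ s * (d.choose s : ℝ) * (Gamma (A + j + s) / Gamma (A + s + 1))) := by
    rw [jp, Finset.sum_mul, L_sum (by linarith) hβ, Finset.mul_sum]
    apply Finset.sum_congr rfl
    intro s hs
    rw [Finset.mem_range] at hs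
    exact moment_term hA hβ d j s (by omega)
  rw [this]
  rcases j with _ | j
  · have h : ∀ s : ℕ, Gamma (A + (0:ℕ) + s) / Gamma (A + s + 1) = 1 / (A + s) := by
      intro s
      have g2 := (Gamma_pos_of_pos (by positivity : 0 < A + s)).ne'
      rw [Real.Gamma_add_one (by positivity)]
      simp only [Nat.cast_zero, add_zero]
      field_simp
    simp only [h]
    rw [alt_sum_inv (by linarith), Ic, if_pos trivial]
    have g1 := (Gamma_pos_of_pos (by positivity : 0 < A + d + 1)).ne'
    rw [show (d:ℝ) + A + 1 = A + d + 1 by ring]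
    simp only [Nat.cast_zero, add_zero]
    field_simp
  · obtain ⟨P, h1, h2⟩ := gamma_ratio_poly hA j
    simp only [h2]
    rw [alt_sum_poly P (by omega)]
    simp

lemma poly_basis_one_sub (d : ℕ) (f : ℝ[X]) (hf : f.natDegree ≤ d) :
    ∃ c : ℕ → ℝ, f = ∑ j ∈ Finset.range (d + 1), C (c j) * (1 - X) ^ j := by
  refine ⟨fun j => (f.comp (1 - X)).coeff j, ?_⟩
  have h1 : (f.comp (1 - X)).natDegree < d + 1 := by
    have : (1 - X : ℝ[X]).natDegree ≤ 1 := by compute_degree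
    have := natDegree_comp_le (p := f) (q := (1 - X : ℝ[X]))
    nlinarith
  have h2 := as_sum_range' _ _ h1
  have h3 : (f.comp (1 - X)).comp (1 - X) = f := by
    rw [comp_assoc]; simp
  conv_lhs => rw [← h3, h2]
  simp [← C_mul_X_pow_eq_monomial]

lemma repro {A β : ℝ} (hA : 1 ≤ A) (hβ : 0 ≤ β) {d : ℕ} {f : ℝ[X]} (hf : f.natDegree ≤ d) :
    L (A - 1) β (jp A β d * f) = Ic A β d * f.eval 1 := by
  obtain ⟨c, hc⟩ := poly_basis_one_sub d f hf
  rw [hc, Finset.mul_sum, L_sum (by linarith) hβ, Polynomial.eval_finsetSum, Finset.mul_sum]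
  apply Finset.sum_congr rfl
  intro j hj
  rw [Finset.mem_range] at hj
  rw [mul_left_comm, L_smul, moment hA hβ (by omega)]
  rcases j with _ | j <;> simp [mul_comm]

lemma L_one_sub {A β : ℝ} (hA : 1 ≤ A) (hβ : 0 ≤ β) (f : ℝ[X]) :
    L A β f = L (A - 1) β (f * (1 - X)) := by
  rw [L, L_congr (g := fun t => f.eval t * wt A β t)]
  intro t ht
  have := wt_shift (a := A - 1) (b := β) (by linarith) hβ 1 0 ht
  simp only [Nat.cast_one, sub_add_cancel, Nat.cast_zero, add_zero, pow_one, pow_zero, mul_one] at this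
  rw [this]
  simp only [eval_mul, eval_sub, eval_one, eval_X]
  ring

lemma orth {A β : ℝ} (hA : 1 ≤ A) (hβ : 0 ≤ β) {d : ℕ} {f : ℝ[X]} (hf : f.natDegree < d) :
    L A β (jp A β d * f) = 0 := by
  rw [L_one_sub hA hβ, mul_assoc, repro hA hβ]
  · simp
  · have : (1 - X : ℝ[X]).natDegree ≤ 1 := by compute_degree
    exact (natDegree_mul_le_of_le le_rfl this).trans hf

lemma jp_one {A β : ℝ} (d : ℕ) : (jp A β d).eval 1 = genBinom (d + A) d := by
  rw [jp_eval, jacobiP, Finset.sum_eq_single 0]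
  · simp [genBinom]
  · intro s _ hs
    simp [hs]
  · simp

lemma jp_one_pos {A β : ℝ} (hA : 1 ≤ A) (d : ℕ) : 0 < (jp A β d).eval 1 := by
  rw [jp_one, genBinom]
  apply div_pos _ (by positivity)
  apply Finset.prod_pos
  intro i hi
  rw [Finset.mem_range] at hi
  have : (i:ℝ) < d := by exact_mod_cast hi
  linarith

lemma jp_ne_zero {A β : ℝ} (hA : 1 ≤ A) (d : ℕ) : jp A β d ≠ 0 := by
  intro h
  have := jp_one_pos (β := β) hA d
  simp [h] at this

lemma L_neg' {a b : ℝ} (ha : 0 ≤ a) (hb : 0 ≤ b) (f : ℝ[X]) (hf : f ≠ 0)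
    (h : ∀ t ∈ Ioo (-1:ℝ) 1, f.eval t ≤ 0) : L a b f < 0 := by
  have := L_pos ha hb (-f) (by simpa) (by simpa using h)
  have h2 := L_smul (a := a) (b := b) (-1) f
  simp only [map_neg, map_one, neg_mul, one_mul] at h2
  linarith

/-- key: no factor of constant sign of positive degree -/
lemma no_const_sign_factor {A β : ℝ} (hA : 1 ≤ A) (hβ : 0 ≤ β) {d : ℕ} {u h : ℝ[X]}
    (hu : jp A β d = u * h) (hdeg : 0 < u.natDegree) :
    ¬ ((∀ t ∈ Ioo (-1:ℝ) 1, 0 ≤ u.eval t) ∨ (∀ t ∈ Ioo (-1:ℝ) 1, u.eval t ≤ 0)) := by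
  have hne := jp_ne_zero (β := β) hA d
  have hu0 : u ≠ 0 := by rintro rfl; simp at hdeg
  have hh0 : h ≠ 0 := by rintro rfl; rw [hu] at hne; simp at hne
  have hd := jp_degree_le A β d
  have h1 : L A β (jp A β d * h) = 0 := by
    apply orth hA hβ
    rw [hu, natDegree_mul hu0 hh0] at hd
    omega
  rw [hu, mul_assoc] at h1
  rintro (hs | hs)
  · have := L_pos (a := A) (b := β) (by linarith) hβ (u * (h * h)) (by simp [hu0, hh0]) (by
      intro t ht
      simp only [eval_mul]
      exact mul_nonneg (hs t ht) (mul_self_nonneg _))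
    linarith
  · have := L_neg' (a := A) (b := β) (by linarith) hβ (u * (h * h)) (by simp [hu0, hh0]) (by
      intro t ht
      simp only [eval_mul]
      exact mul_nonpos_of_nonpos_of_nonneg (hs t ht) (mul_self_nonneg _))
    linarith

lemma jp_splits {A β : ℝ} (hA : 1 ≤ A) (hβ : 0 ≤ β) (d : ℕ) : (jp A β d).Splits := by
  rw [Polynomial.splits_iff_splits]
  right
  intro g hg hdvd
  by_contra hdg
  have hg0 : g ≠ 0 := hg.ne_zero
  have hpos := hg.natDegree_pos
  obtain ⟨h, hh⟩ := hdvd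
  have hnr : ∀ x, g.eval x ≠ 0 := by
    intro x hx
    exact hdg (Polynomial.degree_eq_one_of_irreducible_of_root hg hx)
  apply no_const_sign_factor hA hβ hh hpos
  by_contra! hc
  obtain ⟨⟨x, _, hx⟩, ⟨y, _, hy⟩⟩ := hc
  obtain ⟨z, hz⟩ := mem_range_of_exists_le_of_exists_ge g.continuous ⟨x, hx.le⟩ ⟨y, hy.le⟩
  exact hnr z hz

lemma jp_root_mem {A β : ℝ} (hA : 1 ≤ A) (hβ : 0 ≤ β) {d : ℕ} {x : ℝ} (hx : (jp A β d).IsRoot x) :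
    x ∈ Ioo (-1:ℝ) 1 := by
  obtain ⟨h, hh⟩ := Polynomial.dvd_iff_isRoot.2 hx
  have := no_const_sign_factor hA hβ hh (by simp)
  by_contra hc
  apply this
  simp only [eval_sub, eval_X, eval_C]
  by_cases h1 : x ≤ -1
  · left; intro t ht; linarith [ht.1]
  · right; intro t ht
    have : 1 ≤ x := by
      by_contra h2
      exact hc ⟨not_le.1 h1, not_le.1 h2⟩
    linarith [ht.2]

lemma jp_nodup {A β : ℝ} (hA : 1 ≤ A) (hβ : 0 ≤ β) (d : ℕ) : (jp A β d).roots.Nodup := by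
  rw [Multiset.nodup_iff_count_le_one]
  intro x
  by_contra hc
  rw [count_roots, not_le, Nat.lt_iff_add_one_le, le_rootMultiplicity_iff (jp_ne_zero hA d)] at hc
  obtain ⟨h, hh⟩ := hc
  have := no_const_sign_factor hA hβ hh (by simp)
  apply this
  left
  intro t _
  simp only [eval_pow, eval_sub, eval_X, eval_C]
  exact sq_nonneg _

lemma jp_natDegree {A β : ℝ} (hA : 1 ≤ A) (hβ : 0 ≤ β) (d : ℕ) : (jp A β d).natDegree = d := by
  refine le_antisymm (jp_degree_le A β d) ?_
  by_contra h
  have h1 := orth hA hβ (d := d) (f := jp A β d) (by omega)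
  have := L_pos (a := A) (b := β) (by linarith) hβ (jp A β d * jp A β d) (by simp [jp_ne_zero hA d])
    (fun t _ => by simp only [eval_mul]; exact mul_self_nonneg _)
  linarith

end SCB
end

noncomputable section
namespace SCB
open Polynomial Set

lemma L_zero_of_vanish {A β : ℝ} (hA : 1 ≤ A) (hβ : 0 ≤ β) {d : ℕ} {h : ℝ[X]}
    (hdeg : h.natDegree < 2 * d) (hv : ∀ t, (jp A β d).IsRoot t → h.IsRoot t) : L A β h = 0 := by
  by_cases h0 : h = 0
  · simp [h0, L]
  have hne := jp_ne_zero (β := β) hA d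
  have hdvd : jp A β d ∣ h := by
    apply (jp_splits hA hβ d).dvd_of_roots_le_roots hne
    rw [Multiset.le_iff_subset (jp_nodup hA hβ d)]
    intro t ht
    rw [mem_roots hne] at ht
    exact (mem_roots h0).2 (hv t ht)
  obtain ⟨k, hk⟩ := hdvd
  have hk0 : k ≠ 0 := by rintro rfl; simp at hk; exact h0 hk
  rw [hk]
  apply orth hA hβ
  rw [hk, natDegree_mul hne hk0, jp_natDegree hA hβ] at hdeg
  omega

lemma quad_nonneg {A β : ℝ} (hA : 1 ≤ A) (hβ : 0 ≤ β) {d : ℕ} (hd : 1 ≤ d) {h : ℝ[X]}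
    (hdeg : h.natDegree < 2 * d) (hv : ∀ t, (jp A β d).IsRoot t → 0 ≤ h.eval t) : 0 ≤ L A β h := by
  classical
  have hne := jp_ne_zero (β := β) hA d
  set Z := (jp A β d).roots.toFinset with hZ
  have hmem : ∀ t, t ∈ Z ↔ (jp A β d).IsRoot t := by
    intro t; rw [hZ, Multiset.mem_toFinset, mem_roots hne]
  have hcard : Z.card = d := by
    rw [hZ, Multiset.toFinset_card_of_nodup (jp_nodup hA hβ d),
      ← (jp_splits hA hβ d).natDegree_eq_card_roots, jp_natDegree hA hβ]
  let ℓ : ℝ → ℝ[X] := fun t => Lagrange.basis Z id t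
  have hℓdeg : ∀ t ∈ Z, (ℓ t).natDegree ≤ d - 1 := by
    intro t ht
    have := Lagrange.degree_basis (v := id) (s := Z) (Set.injOn_id _) ht
    rw [hcard] at this
    exact (natDegree_eq_of_degree_eq_some this).le
  have key : L A β (h + ∑ t ∈ Z, C (- h.eval t) * (ℓ t * ℓ t)) = 0 := by
    apply L_zero_of_vanish hA hβ (d := d)
    · refine lt_of_le_of_lt (natDegree_add_le _ _) (max_lt hdeg ?_)
      refine lt_of_le_of_lt (natDegree_sum_le_of_forall_le (n := 2 * (d - 1)) _ _ ?_) (by omega)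
      intro t ht
      refine (natDegree_C_mul_le _ _).trans ?_
      rw [two_mul]
      exact natDegree_mul_le_of_le (hℓdeg t ht) (hℓdeg t ht)
    · intro t ht
      rw [← hmem] at ht
      rw [IsRoot, eval_add, Polynomial.eval_finsetSum, Finset.sum_eq_single t]
      · have : (ℓ t).eval t = 1 := Lagrange.eval_basis_self (v := id) (Set.injOn_id _) ht
        simp [this]
      · intro b hb hbt
        have : (ℓ b).eval t = 0 := Lagrange.eval_basis_of_ne (v := id) hbt ht
        simp [this]
      · intro h; exact absurd ht h
  rw [L_add (by linarith) hβ, L_sum (by linarith) hβ] at key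
  simp only [L_smul] at key
  have h2 : 0 ≤ ∑ t ∈ Z, h.eval t * L A β (ℓ t * ℓ t) := by
    apply Finset.sum_nonneg
    intro t ht
    refine mul_nonneg (hv t ((hmem t).1 ht)) ?_
    have hl : ℓ t ≠ 0 := Lagrange.basis_ne_zero (v := id) (Set.injOn_id _) ht
    exact (L_pos (by linarith) hβ _ (mul_ne_zero hl hl)
      (fun t _ => by simp only [eval_mul]; exact mul_self_nonneg _)).le
  simp only [neg_mul, Finset.sum_neg_distrib] at key
  linarith

lemma root_set {A β : ℝ} (d : ℕ) :
    {x : ℝ | jacobiP A β d x = 0} = {x | (jp A β d).IsRoot x} := by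
  ext x; simp [IsRoot, jp_eval]

lemma maxRoot_isGreatest {A β : ℝ} (hA : 1 ≤ A) (hβ : 0 ≤ β) {d : ℕ} (hd : 1 ≤ d) :
    IsGreatest {x | (jp A β d).IsRoot x} (maxRoot A β d) := by
  have hne := jp_ne_zero (β := β) hA d
  rw [maxRoot, root_set]
  have hfin : {x | (jp A β d).IsRoot x}.Finite := by
    apply ((jp A β d).roots.toFinset.finite_toSet).subset
    intro x hx
    simp only [Finset.mem_coe, Multiset.mem_toFinset]
    exact (mem_roots hne).2 hx
  have hnon : {x | (jp A β d).IsRoot x}.Nonempty := by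
    have h1 := (jp_splits hA hβ d).natDegree_eq_card_roots
    rw [jp_natDegree hA hβ] at h1
    obtain ⟨x, hx⟩ := Multiset.card_pos_iff_exists_mem.1 (by omega : 0 < Multiset.card (jp A β d).roots)
    exact ⟨x, (mem_roots hne).1 hx⟩
  exact ⟨hnon.csSup_mem hfin, fun x hx => le_csSup hfin.bddAbove hx⟩

lemma maxRoot_mem {A β : ℝ} (hA : 1 ≤ A) (hβ : 0 ≤ β) {d : ℕ} (hd : 1 ≤ d) :
    maxRoot A β d ∈ Ioo (-1:ℝ) 1 := jp_root_mem hA hβ (maxRoot_isGreatest hA hβ hd).1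

lemma jp_pos_of_gt {A β : ℝ} (hA : 1 ≤ A) (hβ : 0 ≤ β) {d : ℕ} (hd : 1 ≤ d) {x : ℝ}
    (hx : maxRoot A β d < x) : 0 < (jp A β d).eval x := by
  have hg := maxRoot_isGreatest hA hβ hd
  have hm := maxRoot_mem hA hβ hd
  by_contra hc
  rw [not_lt] at hc
  have h1 := jp_one_pos (β := β) hA d
  have := isPreconnected_Ioi.intermediate_value (s := Ioi (maxRoot A β d)) (a := x) (b := 1) hx
    hm.2 (jp A β d).continuous.continuousOn ⟨hc, h1.le⟩
  obtain ⟨z, hz, hz0⟩ := this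
  exact absurd (hg.2 hz0) (not_le.2 hz)

/-- quotient by the largest root -/
def qq (A β : ℝ) (d : ℕ) : ℝ[X] := jp A β d /ₘ (X - C (maxRoot A β d))

lemma qq_mul {A β : ℝ} (hA : 1 ≤ A) (hβ : 0 ≤ β) {d : ℕ} (hd : 1 ≤ d) :
    jp A β d = (X - C (maxRoot A β d)) * qq A β d :=
  (mul_divByMonic_eq_iff_isRoot.2 (maxRoot_isGreatest hA hβ hd).1).symm

lemma qq_natDegree {A β : ℝ} (hA : 1 ≤ A) (hβ : 0 ≤ β) (d : ℕ) :
    (qq A β d).natDegree = d - 1 := by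
  rw [qq, natDegree_divByMonic _ (monic_X_sub_C _), jp_natDegree hA hβ, natDegree_X_sub_C]

lemma maxRoot_mono {A β : ℝ} (hA : 1 ≤ A) (hβ : 0 ≤ β) {i d : ℕ} (hi : 1 ≤ i) (hid : i < d) :
    maxRoot A β i ≤ maxRoot A β d := by
  by_contra! hc
  have hd : 1 ≤ d := by omega
  have hg := maxRoot_isGreatest hA hβ hd
  set s := maxRoot A β d
  set si := maxRoot A β i with hsi
  set f := qq A β i
  have hfd : f.natDegree = i - 1 := qq_natDegree hA hβ i
  have hf := qq_mul hA hβ hi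
  have hf0 : f ≠ 0 := by
    intro h; have := jp_ne_zero (β := β) hA i
    rw [hf] at this; simp [f] at h; simp [h] at this
  have h1 : 0 ≤ L A β ((C s - X) * (f * f)) := by
    apply quad_nonneg hA hβ hd
    · have : (C s - X).natDegree ≤ 1 := by compute_degree
      refine lt_of_le_of_lt (natDegree_mul_le_of_le this (natDegree_mul_le_of_le hfd.le hfd.le)) (by omega)
    · intro t ht
      simp only [eval_mul, eval_sub, eval_C, eval_X]
      exact mul_nonneg (by linarith [hg.2 ht]) (mul_self_nonneg _)
  have h2 : L A β (jp A β i * f) = 0 := orth hA hβ (by omega)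
  have h3 : 0 < L A β (f * f) := L_pos (by linarith) hβ _ (mul_ne_zero hf0 hf0)
    (fun t _ => by simp only [eval_mul]; exact mul_self_nonneg _)
  have e : (C s - X) * (f * f) + jp A β i * f = C (s - si) * (f * f) := by
    rw [hf]; simp only [C_sub]; ring
  have h4 := congrArg (L A β) e
  rw [L_add (by linarith) hβ, h2, L_smul] at h4
  nlinarith

lemma jp_zero (A β : ℝ) : jp A β 0 = 1 := by
  simp [jp, genBinom]

lemma jp_nonneg_at {A β : ℝ} (hA : 1 ≤ A) (hβ : 0 ≤ β) {i d : ℕ} (hid : i < d) :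
    0 ≤ (jp A β i).eval (maxRoot A β d) := by
  rcases Nat.eq_zero_or_pos i with rfl | hi
  · simp [jp_zero]
  rcases eq_or_lt_of_le (maxRoot_mono hA hβ hi hid) with h | h
  · rw [← h]; exact (maxRoot_isGreatest hA hβ hi).1.ge
  · exact (jp_pos_of_gt hA hβ hi h).le

lemma jp_basis {A β : ℝ} (hA : 1 ≤ A) (hβ : 0 ≤ β) (d : ℕ) (f : ℝ[X]) (hf : f.degree < d) :
    ∃ c : ℕ → ℝ, f = ∑ i ∈ Finset.range d, C (c i) * jp A β i := by
  induction d generalizing f with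
  | zero => exact ⟨0, by simpa using hf⟩
  | succ d ih =>
    have hlead : (jp A β d).coeff d ≠ 0 := by
      have := jp_natDegree hA hβ d
      have h2 := leadingCoeff_ne_zero.2 (jp_ne_zero (β := β) hA d)
      rwa [leadingCoeff, this] at h2
    obtain ⟨c, hc⟩ := ih (f - C (f.coeff d / (jp A β d).coeff d) * jp A β d) (by
      rw [degree_lt_iff_coeff_zero] at hf ⊢
      intro m hm
      rcases eq_or_lt_of_le hm with rfl | hm
      · simp; field_simp; ring
      · have h1 : (jp A β d).coeff m = 0 := coeff_eq_zero_of_natDegree_lt (by rw [jp_natDegree hA hβ]; exact hm)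
        simp [h1, hf m hm])
    refine ⟨fun i => if i = d then f.coeff d / (jp A β d).coeff d else c i, ?_⟩
    rw [Finset.sum_range_succ]
    simp only [if_true]
    rw [← sub_eq_iff_eq_add, hc]
    apply Finset.sum_congr rfl
    intro i hi
    rw [Finset.mem_range] at hi
    rw [if_neg (by omega)]

lemma qq_at_pos {A β : ℝ} (hA : 1 ≤ A) (hβ : 0 ≤ β) {d : ℕ} (hd : 1 ≤ d) {x : ℝ} (hx : maxRoot A β d ≤ x) :
    0 < (qq A β d).eval x := by
  have hf := qq_mul hA hβ hd
  have hgt : ∀ x, maxRoot A β d < x → 0 < (qq A β d).eval x := by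
    intro x hx
    have := jp_pos_of_gt hA hβ hd hx
    rw [hf, eval_mul] at this
    simp only [eval_sub, eval_X, eval_C] at this
    exact pos_of_mul_pos_right this (by linarith)
  rcases eq_or_lt_of_le hx with rfl | hx
  · refine lt_of_le_of_ne ?_ ?_
    · have hcl : maxRoot A β d ∈ closure (Ioi (maxRoot A β d)) := by
        rw [closure_Ioi]; exact self_mem_Ici
      exact closure_minimal (fun t ht => (hgt t ht).le)
        (isClosed_le continuous_const (qq A β d).continuous) hcl
    · intro h0
      obtain ⟨k, hk⟩ := dvd_iff_isRoot.2 (h0.symm : (qq A β d).IsRoot _)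
      rw [hk, ← mul_assoc] at hf
      refine no_const_sign_factor hA hβ hf ?_ (Or.inl ?_)
      · rw [natDegree_mul (X_sub_C_ne_zero _) (X_sub_C_ne_zero _)]; simp
      · intro t _
        simp only [eval_mul]
        exact mul_self_nonneg _
  · exact hgt x hx

lemma qq_expand {A β : ℝ} (hA : 1 ≤ A) (hβ : 0 ≤ β) {d : ℕ} (hd : 1 ≤ d) :
    ∃ c : ℕ → ℝ, (∀ i < d, 0 ≤ c i) ∧ qq A β d = ∑ i ∈ Finset.range d, C (c i) * jp A β i := by
  have hq := qq_mul hA hβ hd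
  have hq0 : qq A β d ≠ 0 := by
    intro h; have := qq_at_pos hA hβ hd (le_refl _); rw [h] at this; simp at this
  have hA0 : 0 ≤ A := by linarith
  have hdeg : (qq A β d).degree < d := by
    rw [degree_eq_natDegree hq0, qq_natDegree hA hβ]
    exact_mod_cast (by omega : d - 1 < d)
  obtain ⟨c, hc⟩ := jp_basis hA hβ d _ hdeg
  refine ⟨c, ?_, hc⟩
  have hrep : ∀ k : ℝ[X], k.natDegree ≤ d → L A β (qq A β d * k) = k.eval (maxRoot A β d) * L A β (qq A β d) := by
    intro k hk
    have h1 : k = (X - C (maxRoot A β d)) * (k /ₘ (X - C (maxRoot A β d))) + C (k.eval (maxRoot A β d)) := by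
      have := modByMonic_add_div k (X - C (maxRoot A β d))
      rw [modByMonic_X_sub_C_eq_C_eval] at this
      rw [add_comm]; exact this.symm
    have h2 : L A β (jp A β d * (k /ₘ (X - C (maxRoot A β d)))) = 0 := by
      apply orth hA hβ
      rw [natDegree_divByMonic _ (monic_X_sub_C _), natDegree_X_sub_C]
      omega
    have h3 : qq A β d * k = jp A β d * (k /ₘ (X - C (maxRoot A β d))) +
        C (k.eval (maxRoot A β d)) * qq A β d := by
      conv_lhs => rw [h1]
      conv_rhs => rw [hq]
      ring
    rw [h3, L_add hA0 hβ, h2, L_smul, zero_add]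
  have hκ : 0 < L A β (qq A β d) := by
    have h1 := hrep (qq A β d) (by rw [qq_natDegree hA hβ]; omega)
    have h2 : 0 < L A β (qq A β d * qq A β d) := L_pos hA0 hβ _ (mul_ne_zero hq0 hq0)
      (fun t _ => by simp only [eval_mul]; exact mul_self_nonneg _)
    rw [h1] at h2
    exact pos_of_mul_pos_right h2 (qq_at_pos hA hβ hd le_rfl).le
  intro i hi
  have h1 := hrep (jp A β i) (by rw [jp_natDegree hA hβ]; omega)
  have h2 : L A β (qq A β d * jp A β i) = c i * L A β (jp A β i * jp A β i) := by
    rw [hc, Finset.sum_mul, L_sum hA0 hβ, Finset.sum_eq_single i]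
    · rw [mul_assoc, L_smul]
    · intro j hj hji
      rw [mul_assoc, L_smul]
      rcases lt_or_gt_of_ne hji with h | h
      · rw [mul_comm (jp A β j), orth hA hβ (by rw [jp_natDegree hA hβ]; exact h), mul_zero]
      · rw [orth hA hβ (by rw [jp_natDegree hA hβ]; exact h), mul_zero]
    · intro h; exact absurd (Finset.mem_range.2 hi) h
  have h3 : 0 < L A β (jp A β i * jp A β i) := L_pos hA0 hβ _
    (mul_ne_zero (jp_ne_zero hA i) (jp_ne_zero hA i))
      (fun t _ => by simp only [eval_mul]; exact mul_self_nonneg _)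
  rw [h2] at h1
  have h4 : 0 ≤ c i * L A β (jp A β i * jp A β i) := by
    rw [h1]; exact mul_nonneg (jp_nonneg_at hA hβ hi) hκ.le
  exact nonneg_of_mul_nonneg_left h4 h3

/-- product form of the quotient -/
lemma qq_prod {A β : ℝ} (hA : 1 ≤ A) (hβ : 0 ≤ β) {d : ℕ} (hd : 1 ≤ d) :
    ∃ (c : ℝ) (T : Multiset ℝ), c ≠ 0 ∧ (∀ t ∈ T, t < maxRoot A β d) ∧
      qq A β d = C c * (T.map (fun t => X - C t)).prod := by
  have hq := qq_mul hA hβ hd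
  have hne := jp_ne_zero (β := β) hA d
  have hq0 : qq A β d ≠ 0 := by
    intro h; have := qq_at_pos hA hβ hd (le_refl _); rw [h] at this; simp at this
  have hs : (qq A β d).Splits := (jp_splits hA hβ d).of_dvd hne ⟨_, by rw [mul_comm]; exact hq⟩
  refine ⟨(qq A β d).leadingCoeff, (qq A β d).roots, leadingCoeff_ne_zero.2 hq0, ?_, hs.eq_prod_roots⟩
  intro t ht
  rw [mem_roots hq0] at ht
  by_contra! hc
  have := qq_at_pos hA hβ hd hc
  rw [ht.eq_zero] at this
  exact lt_irrefl _ this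

lemma jp_parity (A : ℝ) (d : ℕ) : (jp A A d).comp (-X) = C ((-1) ^ d) * jp A A d := by
  apply Polynomial.funext
  intro x
  simp only [eval_comp, eval_neg, eval_X, eval_mul, eval_C, jp_eval, jacobiP]
  rw [← Finset.sum_range_reflect, Finset.mul_sum]
  apply Finset.sum_congr rfl
  intro s hs
  rw [Finset.mem_range] at hs
  have h1 : d + 1 - 1 - s = d - s := by omega
  have h2 : d - (d - s) = s := by omega
  have h3 : (-1:ℝ) ^ d = (-1) ^ s * (-1) ^ (d - s) := by rw [← pow_add]; congr 1; omega
  rw [h1, h2, h3, show (-x - 1) / 2 = (-1) * ((x + 1) / 2) by ring,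
    show (-x + 1) / 2 = (-1) * ((x - 1) / 2) by ring, mul_pow, mul_pow]
  ring

/-! ODE -/

lemma ibp {a b : ℝ} (ha : 0 ≤ a) (hb : 0 ≤ b) (g : ℝ[X]) :
    L a b ((1 - X ^ 2) * derivative g + (C (b - a) - C (a + b + 2) * X) * g) = 0 := by
  have h := intervalIntegral.integral_eq_sub_of_hasDerivAt_of_le (a := -1) (b := 1) (by norm_num)
    (f := fun t => g.eval t * wt (a + 1) (b + 1) t)
    (f' := fun t => ((1 - X ^ 2) * derivative g + (C (b - a) - C (a + b + 2) * X) * g).eval t * wt a b t)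
    ((g.continuous.mul (wt_cont (by linarith) (by linarith))).continuousOn) ?_
    (((Polynomial.continuous _).mul (wt_cont ha hb)).intervalIntegrable _ _)
  · rw [L, h]
    have h1 : wt (a + 1) (b + 1) 1 = 0 := by
      simp [wt, Real.zero_rpow (by linarith : a + 1 ≠ 0)]
    have h2 : wt (a + 1) (b + 1) (-1) = 0 := by
      simp [wt, Real.zero_rpow (by linarith : b + 1 ≠ 0)]
    simp [h1, h2]
  · intro t ht
    have h1 : 0 < 1 - t := by linarith [ht.2]
    have h2 : 0 < 1 + t := by linarith [ht.1]
    have d1 : HasDerivAt (fun t : ℝ => (1 - t) ^ (a + 1)) (-1 * (a + 1) * (1 - t) ^ (a + 1 - 1)) t :=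
      HasDerivAt.rpow_const (by simpa using (hasDerivAt_id t).const_sub 1) (Or.inl h1.ne')
    have d2 : HasDerivAt (fun t : ℝ => (1 + t) ^ (b + 1)) (1 * (b + 1) * (1 + t) ^ (b + 1 - 1)) t :=
      HasDerivAt.rpow_const (by simpa using (hasDerivAt_id t).const_add 1) (Or.inl h2.ne')
    have := (g.hasDerivAt t).mul (d1.mul d2)
    refine HasDerivAt.congr_deriv this ?_
    simp only [wt, add_sub_cancel_right, Pi.mul_apply]
    rw [Real.rpow_add_one h1.ne', Real.rpow_add_one h2.ne']
    simp only [eval_mul, eval_sub, eval_one, eval_X, eval_pow, eval_add, eval_C]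
    ring

/-- Jacobi operator -/
def Dop (a b : ℝ) (f : ℝ[X]) : ℝ[X] :=
  (1 - X ^ 2) * derivative (derivative f) + (C (b - a) - C (a + b + 2) * X) * derivative f

lemma Dop_symm {a b : ℝ} (ha : 0 ≤ a) (hb : 0 ≤ b) (f k : ℝ[X]) :
    L a b (Dop a b f * k) = L a b (f * Dop a b k) := by
  have h1 := ibp ha hb (derivative f * k)
  have h2 := ibp ha hb (derivative k * f)
  have e : Dop a b f * k = f * Dop a b k + (((1 - X ^ 2) * derivative (derivative f * k) +
      (C (b - a) - C (a + b + 2) * X) * (derivative f * k)) +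
     C (-1) * ((1 - X ^ 2) * derivative (derivative k * f) +
      (C (b - a) - C (a + b + 2) * X) * (derivative k * f))) := by
    simp only [Dop, derivative_mul, map_neg, map_one]
    ring
  rw [e, L_add ha hb, L_add ha hb, L_smul, h1, h2]
  ring

lemma Dop_natDegree (a b : ℝ) (f : ℝ[X]) (d : ℕ) (hf : f.natDegree ≤ d) : (Dop a b f).natDegree ≤ d := by
  unfold Dop
  have hD1 : (derivative f).natDegree ≤ d - 1 := (natDegree_derivative_le f).trans (by omega)
  have hD2 : (derivative (derivative f)).natDegree ≤ d - 2 := (natDegree_derivative_le _).trans (by omega)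
  rcases Nat.lt_or_ge d 1 with h | h
  · have : f.natDegree = 0 := by omega
    rw [natDegree_eq_zero] at this
    obtain ⟨c, rfl⟩ := this
    simp
  rcases Nat.lt_or_ge d 2 with h' | h'
  · have : derivative (derivative f) = 0 := by
      have := iterate_derivative_eq_zero (p := f) (x := 2) (by omega)
      simpa using this
    rw [this, mul_zero, zero_add]
    have h1 : (C (b - a) - C (a + b + 2) * X : ℝ[X]).natDegree ≤ 1 := by compute_degree
    exact (natDegree_mul_le_of_le h1 hD1).trans (by omega)
  · have h1 : (C (b - a) - C (a + b + 2) * X : ℝ[X]).natDegree ≤ 1 := by compute_degree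
    have h2 : (1 - X ^ 2 : ℝ[X]).natDegree ≤ 2 := by compute_degree
    exact natDegree_add_le_of_degree_le ((natDegree_mul_le_of_le h2 hD2).trans (by omega))
      ((natDegree_mul_le_of_le h1 hD1).trans (by omega))

lemma Dop_coeff (a b : ℝ) (f : ℝ[X]) (d : ℕ) (hf : f.natDegree ≤ d) :
    (Dop a b f).coeff d = - (d * (d + a + b + 1)) * f.coeff d := by
  have hz : f.coeff (d + 1) = 0 := coeff_eq_zero_of_natDegree_lt (by omega)
  have hz2 : f.coeff (d + 2) = 0 := coeff_eq_zero_of_natDegree_lt (by omega)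
  unfold Dop
  rcases d with _ | _ | d
  · simp [sub_mul, coeff_derivative, mul_coeff_zero, hz, hz2] at *
  · simp only [sub_mul, one_mul, mul_assoc, coeff_add, coeff_sub, coeff_C_mul, coeff_X_mul,
      coeff_derivative, hz, hz2]
    have : (X ^ 2 * derivative (derivative f)).coeff (0 + 1) = 0 := by
      rw [coeff_X_pow_mul']; simp
    rw [this]
    push_cast
    simp at hz hz2
    simp [hz, hz2]
    ring
  · simp only [sub_mul, one_mul, mul_assoc, coeff_add, coeff_sub, coeff_C_mul, coeff_X_mul,
      coeff_X_pow_mul, coeff_derivative]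
    rw [show d + 1 + 1 + 1 + 1 = d + 1 + 1 + 2 by ring, hz, hz2]
    push_cast
    ring

lemma jp_ode {A β : ℝ} (hA : 1 ≤ A) (hβ : 0 ≤ β) (d : ℕ) :
    Dop A β (jp A β d) + C (d * (d + A + β + 1)) * jp A β d = 0 := by
  have hA0 : 0 ≤ A := by linarith
  set E := Dop A β (jp A β d) + C (d * (d + A + β + 1)) * jp A β d with hE
  by_contra h0
  have hEd : E.natDegree ≤ d := natDegree_add_le_of_degree_le (Dop_natDegree _ _ _ _ (jp_degree_le _ _ _))
    ((natDegree_C_mul_le _ _).trans (jp_degree_le _ _ _))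
  have hEc : E.coeff d = 0 := by
    rw [hE, coeff_add, Dop_coeff _ _ _ _ (jp_degree_le _ _ _), coeff_C_mul]; ring
  have hEd2 : E.natDegree < d := by
    refine lt_of_le_of_ne hEd fun h => ?_
    rw [← h] at hEc
    exact h0 (leadingCoeff_eq_zero.1 hEc)
  have h1 : L A β (E * E) = 0 := by
    have : E * E = Dop A β (jp A β d) * E + C (d * (d + A + β + 1)) * (jp A β d * E) := by
      conv_lhs => lhs; rw [hE]
      ring
    rw [this, L_add hA0 hβ, L_smul, Dop_symm hA0 hβ, orth hA hβ hEd2,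
      orth hA hβ (lt_of_le_of_lt (Dop_natDegree _ _ _ _ le_rfl) hEd2)]
    simp
  have := L_pos hA0 hβ (E * E) (mul_ne_zero h0 h0)
      (fun t _ => by simp only [eval_mul]; exact mul_self_nonneg _)
  linarith

end SCB
end

noncomputable section
namespace SCB
open Polynomial Set

/-- discriminant -/
def Dd (A β : ℝ) (d : ℕ) (t : ℝ) : ℝ :=
  4 * (d * (d + A + β + 1)) * (1 - t ^ 2) - ((β - A) - (A + β + 2) * t) ^ 2

lemma sturm {A β : ℝ} (hA : 1 ≤ A) (hβ : 0 ≤ β) (hβA : β ≤ A) {d : ℕ} {p q k : ℝ}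
    (hp : 0 ≤ p) (hpq : p < q) (hq : q < 1) (hk : 0 < k)
    (hy : ∀ t ∈ Icc p q, 0 < (jp A β d).eval t)
    (hD : ∀ t ∈ Icc p q, 4 * k ^ 2 ≤ Dd A β d t) : k * (q - p) ≤ π := by
  set y := jp A β d
  set Cd : ℝ := d * (d + A + β + 1) with hCd
  let B : ℝ → ℝ := fun t => (β - A) - (A + β + 2) * t
  let v : ℝ → ℝ := fun t => (derivative y).eval t / y.eval t + B t / (2 * (1 - t ^ 2))
  let v' : ℝ → ℝ := fun t => ((derivative (derivative y)).eval t * y.eval t -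
    (derivative y).eval t * (derivative y).eval t) / (y.eval t) ^ 2 +
    (-(A + β + 2) * (2 * (1 - t ^ 2)) - B t * (2 * (-(2 * t)))) / (2 * (1 - t ^ 2)) ^ 2
  have hv : ∀ t ∈ Icc p q, HasDerivAt v (v' t) t := by
    intro t ht
    have h1 : 0 < 1 - t ^ 2 := by nlinarith [ht.1, ht.2]
    have d1 := (derivative y).hasDerivAt t
    have d2 := y.hasDerivAt t
    have dB : HasDerivAt B (-(A + β + 2)) t := by
      have := ((hasDerivAt_id t).const_mul (A + β + 2)).const_sub (β - A)
      simpa [B] using this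
    have dA : HasDerivAt (fun t : ℝ => 2 * (1 - t ^ 2)) (2 * (-(2 * t))) t := by
      have := (((hasDerivAt_pow 2 t)).const_sub 1).const_mul 2
      simpa using this
    exact (d1.div d2 (hy t ht).ne').add (dB.div dA (by positivity))
  have hv' : ∀ t ∈ Icc p q, v' t ≤ - ((v t) ^ 2 + k ^ 2) := by
    intro t ht
    have h0 : 0 ≤ t := hp.trans ht.1
    have h1 : 0 < 1 - t ^ 2 := by nlinarith [ht.1, ht.2]
    have hyt := hy t ht
    have ode := congrArg (fun f => f.eval t) (jp_ode hA hβ d)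
    simp only [Dop, eval_add, eval_mul, eval_sub, eval_one, eval_pow, eval_X, eval_C, eval_zero] at ode
    have hDt := hD t ht
    have e : v' t + (v t) ^ 2 = - ((Dd A β d t + 2 * (A + β + 2) * (1 - t ^ 2) + 4 * t * (-(B t))) /
        (4 * (1 - t ^ 2) ^ 2)) := by
      have h2 : (derivative (derivative y)).eval t = -(B t * (derivative y).eval t + Cd * y.eval t) / (1 - t ^ 2) := by
        field_simp
        linarith
      simp only [v', v, Dd, h2]
      simp only [B]
      rw [← hCd]
      field_simp
      ring
    have hB : 0 ≤ -(B t) := by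
      simp only [B]
      have : 0 ≤ (A + β + 2) * t := by positivity
      linarith
    have h3 : k ^ 2 ≤ (Dd A β d t + 2 * (A + β + 2) * (1 - t ^ 2) + 4 * t * (-(B t))) /
        (4 * (1 - t ^ 2) ^ 2) := by
      rw [le_div_iff₀ (by positivity)]
      have h4 : (1 - t ^ 2) ^ 2 ≤ 1 := by nlinarith [sq_nonneg t]
      have h5 : 0 ≤ 2 * (A + β + 2) * (1 - t ^ 2) := by positivity
      have h6 : 0 ≤ 4 * t * (-(B t)) := by positivity
      nlinarith [sq_nonneg k]
    linarith
  let F : ℝ → ℝ := fun t => Real.arctan (v t / k) + k * t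
  have hF : ∀ t ∈ Icc p q, HasDerivAt F (1 / (1 + (v t / k) ^ 2) * (v' t / k) + k) t := by
    intro t ht
    have h1 := ((hv t ht).div_const k).arctan
    have h2 : HasDerivAt (fun t => k * t) k t := by simpa using (hasDerivAt_id t).const_mul k
    exact h1.add h2
  have hanti : AntitoneOn F (Icc p q) := by
    apply antitoneOn_of_deriv_nonpos (convex_Icc p q)
    · exact fun t ht => (hF t ht).continuousAt.continuousWithinAt
    · intro t ht
      rw [interior_Icc] at ht
      exact (hF t (Ioo_subset_Icc_self ht)).differentiableAt.differentiableWithinAt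
    · intro t ht
      rw [interior_Icc] at ht
      have ht' := Ioo_subset_Icc_self ht
      rw [(hF t ht').deriv]
      have h1 := hv' t ht'
      have : 1 / (1 + (v t / k) ^ 2) * (v' t / k) + k = k * (v' t + (k ^ 2 + v t ^ 2)) / (k ^ 2 + v t ^ 2) := by
        field_simp
      rw [this]
      apply div_nonpos_of_nonpos_of_nonneg
      · apply mul_nonpos_of_nonneg_of_nonpos hk.le; linarith
      · positivity
  have := hanti (left_mem_Icc.2 hpq.le) (right_mem_Icc.2 hpq.le) hpq.le
  simp only [F] at this
  have a1 := Real.arctan_lt_pi_div_two (v p / k)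
  have a2 := Real.neg_pi_div_two_lt_arctan (v q / k)
  linarith

/-- the defining set of levD is nonempty -/
lemma exists_large_root {A c0 : ℝ} (hA : 1 ≤ A) (h0 : 0 ≤ c0) (h1 : c0 < 1) :
    ∃ d : ℕ, 1 ≤ d ∧ c0 ≤ maxRoot A A d := by
  set q := (1 + c0) / 2 with hq
  have hq1 : q < 1 := by linarith
  have hpq : c0 < q := by linarith
  set k := 2 * π / (q - c0) with hk
  have hk0 : 0 < k := div_pos (by positivity) (by linarith)
  have hq2 : 0 < 1 - q ^ 2 := by nlinarith
  obtain ⟨d, hd⟩ := exists_nat_gt ((4 * k ^ 2 + (2 * A + 2) ^ 2) / (4 * (1 - q ^ 2)))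
  have hd0 : 1 ≤ d := by
    have : (0:ℝ) < d := lt_of_le_of_lt (by positivity) hd
    exact_mod_cast this
  refine ⟨d, hd0, ?_⟩
  by_contra! hc
  have := sturm hA (by linarith : 0 ≤ A) le_rfl h0 hpq hq1 hk0
    (fun t ht => jp_pos_of_gt hA (by linarith) hd0 (lt_of_lt_of_le hc ht.1)) (by
      intro t ht
      rw [div_lt_iff₀ (by positivity)] at hd
      have hd1 : (1:ℝ) ≤ d := by exact_mod_cast hd0
      have ht0 : 0 ≤ t := h0.trans ht.1
      have e1 : (1 - q ^ 2) ≤ 1 - t ^ 2 := by nlinarith [ht.2]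
      have e2 : (d:ℝ) ≤ d * (d + A + A + 1) := by nlinarith
      have e3 : d * (4 * (1 - q ^ 2)) ≤ 4 * (d * (d + A + A + 1)) * (1 - t ^ 2) := by
        have := mul_le_mul e2 e1 hq2.le (by positivity)
        linarith
      have e4 : ((A - A) - (A + A + 2) * t) ^ 2 ≤ (2 * A + 2) ^ 2 := by
        have : t ^ 2 ≤ 1 := by nlinarith [ht.2]
        nlinarith [sq_nonneg (2 * A + 2)]
      unfold Dd
      linarith)
  rw [hk, div_mul_cancel₀ _ (by linarith)] at this
  linarith [Real.pi_pos]

/-- uniform bound on the discriminant at the largest root -/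
lemma Dd_bound {c1 η : ℝ} (h0 : 0 ≤ c1) (h1 : c1 < 1) (hη : 0 < η) (hη1 : η ≤ 1) :
    ∃ M : ℝ, ∀ A : ℝ, M ≤ A → 1 ≤ A → ∀ e : ℝ, 0 ≤ e → e ≤ 1 → ∀ d : ℕ, 1 ≤ d →
      0 ≤ maxRoot A (A - 1 + e) d → maxRoot A (A - 1 + e) d ≤ c1 →
      Dd A (A - 1 + e) d (maxRoot A (A - 1 + e) d) ≤ η * (2 * A + 1) ^ 2 := by
  set g := 1 - c1 ^ 2 with hg
  have hg0 : 0 < g := by nlinarith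
  have hg1 : g ≤ 1 := by nlinarith
  set c := η * g / 100 with hc
  have hc0 : 0 < c := by positivity
  have hc1 : c ≤ 1 / 100 := by
    have : η * g ≤ 1 := by nlinarith
    linarith
  refine ⟨π * 4 / (c * Real.sqrt (η / 8)), ?_⟩
  intro A hAM hA e he0 he1 d hd hs0 hs1
  set s := maxRoot A (A - 1 + e) d with hs
  by_contra! hcon
  set m := 2 * A + 1 with hm
  have hβ : 0 ≤ A - 1 + e := by linarith
  have hc2 : c ≤ (1 - c1) / 50 := by
    have : g ≤ 2 * (1 - c1) := by nlinarith
    have : η * g ≤ 2 * (1 - c1) := by nlinarith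
    linarith
  have hm3 : 3 ≤ m := by linarith
  have hk0 : 0 < m * Real.sqrt (η / 8) := by positivity
  have hst := sturm hA hβ (by linarith) (d := d) (p := s + c / 2) (q := s + c) (k := m * Real.sqrt (η / 8))
    (by linarith) (by linarith) (by linarith) hk0
    (fun t ht => jp_pos_of_gt hA hβ hd (by rw [← hs]; linarith [ht.1])) (by
      intro t ht
      rw [mul_pow, Real.sq_sqrt (by positivity)]
      have ht0 : 0 ≤ t := by linarith [ht.1]
      have hts : t - s ≤ c := by linarith [ht.2]
      have hts0 : 0 ≤ t - s := by linarith [ht.1]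
      have ht1 : t ≤ 1 := by linarith [ht.2]
      unfold Dd at hcon ⊢
      set Cd : ℝ := d * (d + A + (A - 1 + e) + 1) with hCd
      have hCd0 : 0 ≤ Cd := by positivity
      have r1 : (A - 1 + e - A) - (A + (A - 1 + e) + 2) * s = -((1 - e) + (m + e) * s) := by rw [hm]; ring
      have r2 : (A - 1 + e - A) - (A + (A - 1 + e) + 2) * t = -((1 - e) + (m + e) * t) := by rw [hm]; ring
      rw [r1] at hcon
      rw [r2]
      rw [neg_sq] at *
      set b := (1 - e) + (m + e) * s with hb
      have hb0 : 0 ≤ b := by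
        have : 0 ≤ (m + e) * s := by positivity
        linarith
      have hb1 : b ≤ 2 * m := by
        have : (m + e) * s ≤ (m + e) * 1 := by gcongr; linarith
        linarith
      have hbt : (1 - e) + (m + e) * t = b + (m + e) * (t - s) := by rw [hb]; ring
      rw [hbt]
      have hx1 : (m + e) * (t - s) ≤ 2 * m * c := by
        apply mul_le_mul (by linarith) hts hts0 (by linarith)
      have hx0 : 0 ≤ (m + e) * (t - s) := by positivity
      set x := (m + e) * (t - s)
      have f1 : (b + x) ^ 2 ≤ b ^ 2 + 12 * m ^ 2 * c := by
        have : (b + x) ^ 2 = b ^ 2 + x * (2 * b + x) := by ring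
        rw [this]
        have : x * (2 * b + x) ≤ (2 * m * c) * (4 * m + 2 * m) := by
          apply mul_le_mul hx1 _ (by positivity) (by positivity)
          have : 2 * m * c ≤ 2 * m * 1 := by gcongr; linarith
          linarith
        have e2 : (2 * m * c) * (4 * m + 2 * m) = 12 * m ^ 2 * c := by ring
        linarith
      have hgs : g ≤ 1 - s ^ 2 := by
        have : s ^ 2 ≤ c1 ^ 2 := by gcongr
        linarith
      have f2 : (1 - η / 50) * (1 - s ^ 2) ≤ 1 - t ^ 2 := by
        have : 1 - t ^ 2 = (1 - s ^ 2) - (t - s) * (t + s) := by ring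
        have h3 : (t - s) * (t + s) ≤ c * 2 := mul_le_mul hts (by linarith) (by linarith) hc0.le
        have h4 : c * 2 = η / 50 * g := by rw [hc]; ring
        have h5 : η / 50 * g ≤ η / 50 * (1 - s ^ 2) := by gcongr
        linarith
      have f3 : (1 - η / 50) * (4 * Cd * (1 - s ^ 2)) ≤ 4 * Cd * (1 - t ^ 2) := by
        have := mul_le_mul_of_nonneg_left f2 (by positivity : 0 ≤ 4 * Cd)
        linarith
      have f4 : (1 - η / 50) * (b ^ 2 + η * m ^ 2) ≤ (1 - η / 50) * (4 * Cd * (1 - s ^ 2)) := by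
        apply mul_le_mul_of_nonneg_left (by linarith) (by linarith)
      have f5 : b ^ 2 ≤ 4 * m ^ 2 := by
        have : b ^ 2 ≤ (2 * m) ^ 2 := by gcongr
        linarith
      have f6 : c ≤ η / 100 := by
        rw [hc]
        have : η * g ≤ η * 1 := by gcongr
        linarith
      have f7 : 12 * m ^ 2 * c ≤ 12 * m ^ 2 * (η / 100) := by gcongr
      have f8 : η / 50 * b ^ 2 ≤ η / 50 * (4 * m ^ 2) := by gcongr
      have f9 : η / 50 * (η * m ^ 2) ≤ 1 / 50 * (η * m ^ 2) := by gcongr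
      have f10 : 0 ≤ η * m ^ 2 := by positivity
      linarith)
  rw [div_le_iff₀ (by positivity)] at hAM
  have : m * Real.sqrt (η / 8) * (s + c - (s + c / 2)) = (m / 2) * (c * Real.sqrt (η / 8)) := by ring
  rw [this] at hst
  have h5 : 0 < c * Real.sqrt (η / 8) := by positivity
  nlinarith [Real.pi_pos]

lemma prod_derivs (T : Multiset ℝ) (s : ℝ) (hT : ∀ t ∈ T, t ≠ s) :
    (derivative (T.map (fun t => X - C t)).prod).eval s =
      ((T.map (fun t => X - C t)).prod).eval s * (T.map (fun t => 1 / (s - t))).sum ∧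
    (derivative (derivative (T.map (fun t => X - C t)).prod)).eval s =
      ((T.map (fun t => X - C t)).prod).eval s * ((T.map (fun t => 1 / (s - t))).sum ^ 2 -
        (T.map (fun t => (1 / (s - t)) ^ 2)).sum) := by
  induction T using Multiset.induction_on with
  | empty => simp
  | cons a T ih =>
    obtain ⟨i1, i2⟩ := ih (fun t ht => hT t (Multiset.mem_cons_of_mem ht))
    have ha : s - a ≠ 0 := sub_ne_zero.2 (hT a (Multiset.mem_cons_self a T)).symm
    simp only [Multiset.map_cons, Multiset.prod_cons, Multiset.sum_cons, derivative_mul, derivative_sub,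
      derivative_X, derivative_C, sub_zero, one_mul, derivative_add, eval_add, eval_mul, eval_sub,
      eval_X, eval_C, i1, i2]
    constructor
    · field_simp
    · field_simp
      ring

/-- the root sums at the largest root -/
lemma root_sums {A β : ℝ} (hA : 1 ≤ A) (hβ : 0 ≤ β) {d : ℕ} (hd : 1 ≤ d) (hs0 : 0 ≤ maxRoot A β d)
    (hβA : β ≤ A) :
    ∃ (c : ℝ) (T : Multiset ℝ), c ≠ 0 ∧ (∀ t ∈ T, t < maxRoot A β d) ∧
      qq A β d = C c * (T.map (fun t => X - C t)).prod ∧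
      (T.map (fun t => 1 / (maxRoot A β d - t))).sum =
        - ((β - A) - (A + β + 2) * maxRoot A β d) / (2 * (1 - maxRoot A β d ^ 2)) ∧
      (T.map (fun t => (1 / (maxRoot A β d - t)) ^ 2)).sum ≤
        Dd A β d (maxRoot A β d) / (12 * (1 - maxRoot A β d ^ 2) ^ 2) := by
  obtain ⟨c, T, hc, hT, hq⟩ := qq_prod hA hβ hd
  refine ⟨c, T, hc, hT, hq, ?_⟩
  have hm := maxRoot_mem hA hβ hd
  have hjq := qq_mul hA hβ hd
  have hqpos := qq_at_pos hA hβ hd le_rfl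
  obtain ⟨i1, i2⟩ := prod_derivs T (maxRoot A β d) (fun t ht => (hT t ht).ne)
  set s := maxRoot A β d
  set P := (T.map (fun t => X - C t)).prod
  set S1 := (T.map (fun t => 1 / (s - t))).sum
  set S2 := (T.map (fun t => (1 / (s - t)) ^ 2)).sum
  have hA0 : 0 < 1 - s ^ 2 := by nlinarith [hm.1, hm.2]
  have hP : P.eval s ≠ 0 := by
    intro h; rw [hq, eval_mul, h] at hqpos; simp at hqpos
  have ode := jp_ode hA hβ d
  rw [hjq, hq] at ode
  have o1 := congrArg (fun f => (derivative f).eval s) ode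
  have o0 := congrArg (fun f => f.eval s) ode
  simp only [Dop, derivative_mul, derivative_sub, derivative_X, derivative_C, sub_zero, one_mul, zero_mul,
    zero_add, derivative_add, derivative_one, derivative_pow, eval_add, eval_mul, eval_sub, eval_one, eval_pow,
    eval_X, eval_C, eval_zero, sub_self, zero_sub, mul_one, mul_zero, add_zero, i1, i2,
    derivative_zero, eval_neg, Nat.cast_ofNat, eval_ofNat, Nat.add_one_sub_one, pow_one] at o0 o1
  set Cd : ℝ := d * (d + A + β + 1) with hCd
  have k0 : 2 * (1 - s ^ 2) * S1 + ((β - A) - (A + β + 2) * s) = 0 := by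
    have : c * P.eval s * (2 * (1 - s ^ 2) * S1 + ((β - A) - (A + β + 2) * s)) = 0 := by
      linear_combination o0
    rcases mul_eq_zero.1 this with h | h
    · rcases mul_eq_zero.1 h with h | h
      · exact absurd h hc
      · exact absurd h hP
    · exact h
  have k1 : 3 * (1 - s ^ 2) * (S1 ^ 2 - S2) + 2 * (-(2 * s) + ((β - A) - (A + β + 2) * s)) * S1 +
      (-(A + β + 2) + Cd) = 0 := by
    have : c * P.eval s * (3 * (1 - s ^ 2) * (S1 ^ 2 - S2) + 2 * (-(2 * s) + ((β - A) - (A + β + 2) * s)) * S1 +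
      (-(A + β + 2) + Cd)) = 0 := by
      linear_combination o1
    rcases mul_eq_zero.1 this with h | h
    · rcases mul_eq_zero.1 h with h | h
      · exact absurd h hc
      · exact absurd h hP
    · exact h
  set B := (β - A) - (A + β + 2) * s with hB
  have hB0 : B ≤ 0 := by
    have : 0 ≤ (A + β + 2) * s := by positivity
    linarith
  have hS1 : S1 = -B / (2 * (1 - s ^ 2)) := by
    field_simp; linarith
  refine ⟨hS1, ?_⟩
  have hS2 : S2 = (Dd A β d s + 8 * s * B - 4 * (1 - s ^ 2) * (A + β + 2)) / (12 * (1 - s ^ 2) ^ 2) := by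
    have h3 : 3 * (1 - s ^ 2) * S2 = 3 * (1 - s ^ 2) * S1 ^ 2 + 2 * (-(2 * s) + B) * S1 +
      (-(A + β + 2) + Cd) := by linarith
    rw [hS1] at h3
    rw [Dd, ← hCd, ← hB]
    field_simp at h3 ⊢
    linear_combination h3
  rw [hS2]
  apply div_le_div_of_nonneg_right _ (by positivity)
  have : 0 ≤ 4 * (1 - s ^ 2) * (A + β + 2) := by positivity
  have : 8 * s * B ≤ 0 := mul_nonpos_of_nonneg_of_nonpos (by positivity) hB0
  linarith

end SCB
end

noncomputable section
namespace SCB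
open Polynomial Set

lemma exp_le_one_add {x : ℝ} (hx : |x| ≤ 1 / 2) : exp (x - 2 * x ^ 2) ≤ 1 + x := by
  rw [abs_le] at hx
  have h1 : 0 < 1 + x := by linarith
  rw [← Real.le_log_iff_exp_le h1]
  refine le_trans ?_ (Real.one_sub_inv_le_log_of_pos h1)
  have : 1 - (1 + x)⁻¹ = x - x ^ 2 / (1 + x) := by field_simp; ring
  rw [this]
  have : x ^ 2 / (1 + x) ≤ 2 * x ^ 2 := by
    rw [div_le_iff₀ h1]; nlinarith [sq_nonneg x]
  linarith

lemma prod_bounds (T : Multiset ℝ) (hT : ∀ x ∈ T, |x| ≤ 1 / 2) :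
    exp (T.sum - 2 * (T.map (fun x => x ^ 2)).sum) ≤ (T.map (fun x => 1 + x)).prod ∧
    (T.map (fun x => 1 + x)).prod ≤ exp T.sum := by
  induction T using Multiset.induction_on with
  | empty => simp
  | cons a T ih =>
    obtain ⟨i1, i2⟩ := ih (fun t ht => hT t (Multiset.mem_cons_of_mem ht))
    have ha := hT a (Multiset.mem_cons_self a T)
    have ha2 := abs_le.1 ha
    simp only [Multiset.map_cons, Multiset.prod_cons, Multiset.sum_cons]
    constructor
    · rw [show a + T.sum - 2 * (a ^ 2 + (T.map (fun x => x ^ 2)).sum) =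
        (a - 2 * a ^ 2) + (T.sum - 2 * (T.map (fun x => x ^ 2)).sum) by ring, Real.exp_add]
      exact mul_le_mul (exp_le_one_add ha) i1 (Real.exp_pos _).le (by linarith)
    · rw [Real.exp_add]
      refine mul_le_mul (by linarith [Real.add_one_le_exp a]) i2 ?_ (Real.exp_pos _).le
      exact le_trans (Real.exp_pos _).le i1

lemma rpow_bounds {x a : ℝ} (hx : |x| ≤ 1 / 2) (ha : 0 ≤ a) :
    exp (a * (x - 2 * x ^ 2)) ≤ (1 + x) ^ a ∧ (1 + x) ^ a ≤ exp (a * x) := by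
  have h2 := abs_le.1 hx
  constructor
  · rw [mul_comm, Real.exp_mul]
    exact Real.rpow_le_rpow (Real.exp_pos _).le (exp_le_one_add hx) ha
  · rw [mul_comm, Real.exp_mul]
    exact Real.rpow_le_rpow (by linarith) (by linarith [Real.add_one_le_exp x]) ha

lemma eval_shift {s τ : ℝ} (c : ℝ) (T : Multiset ℝ) (hT : ∀ t ∈ T, t < s) :
    (C c * (T.map (fun t => X - C t)).prod).eval τ = (C c * (T.map (fun t => X - C t)).prod).eval s *
      (T.map ((fun x => 1 + x) ∘ fun t => (τ - s) * (1 / (s - t)))).prod := by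
  rw [eval_mul, eval_mul, mul_assoc, eval_C, eval_C]
  congr 1
  rw [eval_multiset_prod, eval_multiset_prod, Multiset.map_map, Multiset.map_map,
    ← Multiset.prod_map_mul]
  apply congrArg
  apply Multiset.map_congr rfl
  intro t ht
  have : s - t ≠ 0 := by have := hT t ht; linarith [this]
  simp only [Function.comp_apply, eval_sub, eval_X, eval_C]
  field_simp
  ring

lemma ab_div {δ k g a : ℝ} (hδ : |δ| ≤ k) (hg : 0 < g) (ha : g ≤ a) : |δ / a| ≤ k / g := by
  have : 0 < a := hg.trans_le ha
  have h0 := abs_nonneg δ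
  rw [abs_div, abs_of_pos this]
  gcongr
  linarith

lemma wsmall {K A g s ρ δ : ℝ} (hK : 0 < K) (hρ1 : ρ ≤ 1 / 4) (hg0 : 0 < g) (hg1 : g ≤ 1)
    (hs0 : 0 ≤ s) (hs1 : s < 1) (hgs : g ≤ 1 - s ^ 2) (hKA : K / A ≤ g * ρ / 4) (hτ : |δ| ≤ K / A) :
    |-δ / (1 - s)| ≤ 1 / 2 ∧ |δ / (1 + s)| ≤ 1 / 2 := by
  have h1s' : g / 2 ≤ 1 - s := by nlinarith
  have h1 := ab_div (δ := -δ) (k := K / A) (by rwa [abs_neg]) (by linarith) h1s'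
  have h2 := ab_div hτ one_pos (by linarith : 1 ≤ 1 + s)
  have h3 : g * ρ ≤ g * (1 / 4) := by gcongr
  constructor
  · refine h1.trans ?_
    rw [div_le_iff₀ (by linarith)]
    linarith
  · rw [div_one] at h2
    linarith

set_option maxHeartbeats 1000000 in
lemma wcore {K A e g s ρ δ S1 S2 PP : ℝ} (hK : 0 < K) (hρ0 : 0 < ρ) (hρ1 : ρ ≤ 1 / 4) (hg0 : 0 < g) (hg1 : g ≤ 1)
    (he0 : 0 ≤ e) (he1 : e ≤ 1) (hA1 : 1 ≤ A)
    (hs0 : 0 ≤ s) (hs1 : s < 1) (hgs : g ≤ 1 - s ^ 2) (hKA : K / A ≤ g * ρ / 4)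
    (hKA2 : 10 * K ^ 2 / (A * g ^ 2) ≤ ρ / 2) (hτ : |δ| ≤ K / A) (hX2' : δ ^ 2 * S2 ≤ ρ / 8)
    (hS1 : S1 = -(A - 1 + e - A - (A + (A - 1 + e) + 2) * s) / (2 * (1 - s ^ 2)))
    (hX20 : 0 ≤ δ ^ 2 * S2)
    (p1 : exp (δ * S1 - 2 * (δ ^ 2 * S2)) ≤ PP) (p2 : PP ≤ exp (δ * S1)) :
    PP ^ 2 * ((1 + -δ / (1 - s)) ^ (A - 1) * (1 + δ / (1 + s)) ^ (A - 1 + e)) ≤ 1 + 4 * ρ ∧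
    1 - 4 * ρ ≤ PP ^ 2 * ((1 + -δ / (1 - s)) ^ (A - 1) * (1 + δ / (1 + s)) ^ (A - 1 + e)) := by
  obtain ⟨hy2, hz2⟩ := wsmall hK hρ1 hg0 hg1 hs0 hs1 hgs hKA hτ
  have hA0 : 0 < A := by linarith
  have hβ : 0 ≤ A - 1 + e := by linarith
  have hgs0 : 0 < 1 - s ^ 2 := by linarith
  have h1s : 0 < 1 - s := by linarith [hs1]
  have h1s' : g / 2 ≤ 1 - s := by nlinarith
  have h1ps : 1 ≤ 1 + s := by linarith
  generalize hy : -δ / (1 - s) = y at *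
  generalize hz : δ / (1 + s) = z at *
  have hya : |y| ≤ 2 * (K / A) / g := by
    have := ab_div (δ := -δ) (k := K / A) (by rwa [abs_neg]) (by linarith) h1s'
    rw [← hy]; refine this.trans (le_of_eq ?_); field_simp
  have hza : |z| ≤ K / A := by
    have := ab_div hτ one_pos h1ps
    rw [← hz]; simpa using this
  have hgρ : g * ρ ≤ ρ := by nlinarith
  obtain ⟨y1, y2⟩ := rpow_bounds hy2 (by linarith : 0 ≤ A - 1)
  obtain ⟨z1, z2⟩ := rpow_bounds hz2 hβ
  generalize hr' : PP ^ 2 * ((1 + y) ^ (A - 1) * (1 + z) ^ (A - 1 + e)) = ratio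
  have hr := hr'.symm
  obtain ⟨U, hU⟩ : ∃ U, U = 2 * (δ * S1) + ((A - 1) * y + (A - 1 + e) * z) := ⟨_, rfl⟩
  obtain ⟨V, hV⟩ : ∃ V, V = 4 * (δ ^ 2 * S2) + (A - 1) * (2 * y ^ 2) + (A - 1 + e) * (2 * z ^ 2) := ⟨_, rfl⟩
  have hPP0 : 0 < PP := lt_of_lt_of_le (Real.exp_pos _) p1
  have r2 : ratio ≤ exp U := by
    rw [hU, Real.exp_add, Real.exp_add, two_mul, Real.exp_add, ← sq]
    rw [hr]
    apply mul_le_mul (by gcongr) _ (mul_nonneg ((Real.exp_pos _).le.trans y1) ((Real.exp_pos _).le.trans z1)) (by positivity)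
    exact mul_le_mul y2 z2 ((Real.exp_pos _).le.trans z1) (Real.exp_pos _).le
  have r1 : exp (U - V) ≤ ratio := by
    have : U - V = ((δ * S1 - 2 * (δ ^ 2 * S2)) + (δ * S1 - 2 * (δ ^ 2 * S2))) +
      ((A - 1) * (y - 2 * y ^ 2) + (A - 1 + e) * (z - 2 * z ^ 2)) := by rw [hU, hV]; ring
    rw [this, Real.exp_add, Real.exp_add, Real.exp_add, ← sq, hr]
    apply mul_le_mul (by gcongr) _ (by positivity) (by positivity)
    exact mul_le_mul y1 z1 (Real.exp_pos _).le ((Real.exp_pos _).le.trans y1)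
  have hUeq : U = δ * (1 + 3 * s) / (1 - s ^ 2) := by
    have : 1 - s ≠ 0 := h1s.ne'
    have : 1 + s ≠ 0 := by linarith
    have e1 : 1 - s ^ 2 = (1 - s) * (1 + s) := by ring
    rw [hU, hS1, ← hy, ← hz, e1]
    field_simp
    ring
  have hUb : |U| ≤ ρ := by
    rw [hUeq, abs_div, abs_mul, abs_of_pos hgs0, abs_of_pos (by linarith : 0 < 1 + 3 * s),
      div_le_iff₀ hgs0]
    calc |δ| * (1 + 3 * s) ≤ (K / A) * 4 := by
          apply mul_le_mul hτ (by linarith [hs1]) (by linarith) (by positivity)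
      _ ≤ ρ * g := by linarith
      _ ≤ ρ * (1 - s ^ 2) := by gcongr
  have hVb : V ≤ ρ := by
    have v1 : (A - 1) * (2 * y ^ 2) ≤ A * (2 * (2 * (K / A) / g) ^ 2) := by
      have : y ^ 2 ≤ (2 * (K / A) / g) ^ 2 := by rw [← sq_abs]; gcongr
      apply mul_le_mul (by linarith) (by linarith) (by positivity) hA0.le
    have v2 : (A - 1 + e) * (2 * z ^ 2) ≤ A * (2 * ((K / A) / g) ^ 2) := by
      have h3 : K / A ≤ (K / A) / g := by
        rw [le_div_iff₀ hg0]
        have : 0 ≤ K / A := by positivity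
        nlinarith
      have : z ^ 2 ≤ ((K / A) / g) ^ 2 := by rw [← sq_abs]; gcongr; linarith
      apply mul_le_mul (by linarith) (by linarith) (by positivity) hA0.le
    have v3 : A * (2 * (2 * (K / A) / g) ^ 2) + A * (2 * ((K / A) / g) ^ 2) = 10 * K ^ 2 / (A * g ^ 2) := by
      field_simp; norm_num
    rw [hV]
    linarith
  have hV0 : 0 ≤ V := by
    have : 0 ≤ A - 1 := by linarith
    rw [hV]; positivity
  have hb := abs_le.1 hUb
  have q1 : ratio ≤ 1 + 4 * ρ := by
    refine r2.trans ?_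
    have := Real.abs_exp_sub_one_le (x := U) (by linarith)
    have := (abs_le.1 this).2
    linarith
  have q2 : 1 - 4 * ρ ≤ ratio := by
    refine le_trans ?_ r1
    have := Real.add_one_le_exp (U - V)
    linarith
  exact ⟨q1, q2⟩

/-- local weight -/
def WW (A e : ℝ) (d : ℕ) (τ : ℝ) : ℝ := (qq A (A - 1 + e) d).eval τ ^ 2 * wt (A - 1) (A - 1 + e) τ

set_option maxHeartbeats 2000000 in
lemma lemmaW {c1 K ε0 : ℝ} (h0 : 0 ≤ c1) (h1 : c1 < 1) (hK : 0 < K) (hε : 0 < ε0) :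
    ∃ M : ℝ, 1 ≤ M ∧ ∀ A : ℝ, M ≤ A → ∀ e : ℝ, 0 ≤ e → e ≤ 1 → ∀ d : ℕ, 1 ≤ d →
      0 ≤ maxRoot A (A - 1 + e) d → maxRoot A (A - 1 + e) d ≤ c1 →
      0 < WW A e d (maxRoot A (A - 1 + e) d) ∧
      ∀ τ, |τ - maxRoot A (A - 1 + e) d| ≤ K / A →
        |WW A e d τ - WW A e d (maxRoot A (A - 1 + e) d)| ≤ ε0 * WW A e d (maxRoot A (A - 1 + e) d) := by
  set ρ := min ε0 1 / 4 with hρ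
  have hρ0 : 0 < ρ := by positivity
  have hρ1 : ρ ≤ 1 / 4 := by rw [hρ]; linarith [min_le_right ε0 1]
  have hρε : 4 * ρ ≤ ε0 := by rw [hρ]; linarith [min_le_left ε0 1]
  set g := 1 - c1 ^ 2 with hg
  have hg0 : 0 < g := by nlinarith
  have hg1 : g ≤ 1 := by nlinarith
  set η := min 1 (ρ * g ^ 2 / (6 * K ^ 2)) with hη
  have hη0 : 0 < η := by positivity
  have hηK : 3 * K ^ 2 * η / g ^ 2 ≤ ρ / 2 := by
    have : η ≤ ρ * g ^ 2 / (6 * K ^ 2) := min_le_right _ _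
    rw [div_le_iff₀ (by positivity)]
    rw [le_div_iff₀ (by positivity)] at this
    linarith
  obtain ⟨M0, hM0⟩ := Dd_bound h0 h1 hη0 (min_le_left _ _)
  refine ⟨max M0 (max 1 (max (4 * K / (g * ρ)) (20 * K ^ 2 / (g ^ 2 * ρ)))), by simp, ?_⟩
  intro A hA e he0 he1 d hd hs0 hs1
  simp only [max_le_iff] at hA
  obtain ⟨hAM, hA1, hA2, hA3⟩ := hA
  have hβ : 0 ≤ A - 1 + e := by linarith
  have hDd := hM0 A hAM hA1 e he0 he1 d hd hs0 hs1
  obtain ⟨c, T, hc, hT, hq, hS1, hS2⟩ := root_sums hA1 hβ hd hs0 (by linarith)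
  have hqpos := qq_at_pos hA1 hβ hd le_rfl
  have hsm := maxRoot_mem hA1 hβ hd
  unfold WW
  set s := maxRoot A (A - 1 + e) d with hs
  set q := qq A (A - 1 + e) d
  have hwpos : 0 < wt (A - 1) (A - 1 + e) s := wt_pos hsm
  refine ⟨by positivity, ?_⟩
  intro τ hτ
  set δ := τ - s with hδ
  have hA0 : 0 < A := by linarith
  have hgs : g ≤ 1 - s ^ 2 := by
    have : s ^ 2 ≤ c1 ^ 2 := by gcongr
    linarith
  have hgs0 : 0 < 1 - s ^ 2 := by linarith
  have hKA : K / A ≤ g * ρ / 4 := by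
    rw [div_le_iff₀ (by positivity)] at hA2
    rw [div_le_iff₀ hA0]
    linarith
  have hKA2 : 10 * K ^ 2 / (A * g ^ 2) ≤ ρ / 2 := by
    rw [div_le_iff₀ (by positivity)] at hA3
    rw [div_le_iff₀ (by positivity)]
    linarith
  have hδ2 : δ ^ 2 ≤ (K / A) ^ 2 := by
    rw [← sq_abs]
    gcongr
  set S1 := (T.map (fun t => 1 / (s - t))).sum
  set S2 := (T.map (fun t => (1 / (s - t)) ^ 2)).sum
  set x : Multiset ℝ := T.map (fun t => δ * (1 / (s - t))) with hx
  have hx1 : x.sum = δ * S1 := by rw [hx, Multiset.sum_map_mul_left]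
  have hx2 : (x.map (fun x => x ^ 2)).sum = δ ^ 2 * S2 := by
    rw [hx, Multiset.map_map, ← Multiset.sum_map_mul_left]
    simp only [Function.comp_apply, mul_pow]
  have hX2 : δ ^ 2 * S2 ≤ 3 * K ^ 2 * η / (4 * g ^ 2) := by
    have i1 : S2 ≤ η * (3 * A) ^ 2 / (12 * g ^ 2) := by
      refine hS2.trans ?_
      have : η * (2 * A + 1) ^ 2 ≤ η * (3 * A) ^ 2 := by gcongr; linarith
      refine (div_le_div_of_nonneg_right (hDd.trans this) (by positivity)).trans ?_
      gcongr
    calc δ ^ 2 * S2 ≤ δ ^ 2 * (η * (3 * A) ^ 2 / (12 * g ^ 2)) := by gcongr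
      _ ≤ (K / A) ^ 2 * (η * (3 * A) ^ 2 / (12 * g ^ 2)) := by gcongr
      _ = 3 * K ^ 2 * η / (4 * g ^ 2) := by field_simp; norm_num
  have hX2' : δ ^ 2 * S2 ≤ ρ / 8 := by
    have : 3 * K ^ 2 * η / (4 * g ^ 2) = (3 * K ^ 2 * η / g ^ 2) / 4 := by field_simp
    linarith
  have hxs : ∀ y ∈ x, |y| ≤ 1 / 2 := by
    intro y hy
    apply abs_le_of_sq_le_sq _ (by norm_num)
    have hle : y ^ 2 ≤ (x.map (fun x => x ^ 2)).sum := by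
      apply Multiset.single_le_sum
      · intro z hz
        rw [Multiset.mem_map] at hz
        obtain ⟨w, _, rfl⟩ := hz
        positivity
      · exact Multiset.mem_map_of_mem _ hy
    rw [hx2] at hle
    linarith
  obtain ⟨p1, p2⟩ := prod_bounds x hxs
  rw [hx1] at p1 p2
  rw [hx2] at p1
  set PP := (x.map (fun x => 1 + x)).prod with hPP
  have hqτ : q.eval τ = q.eval s * PP := by
    rw [hq, hPP, hx, Multiset.map_map]; exact eval_shift c T hT
  have hX20 : 0 ≤ δ ^ 2 * S2 := by
    rw [← hx2]
    apply Multiset.sum_nonneg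
    intro z hz
    rw [Multiset.mem_map] at hz
    obtain ⟨w, _, rfl⟩ := hz
    positivity
  obtain ⟨q1, q2⟩ := wcore hK hρ0 hρ1 hg0 hg1 he0 he1 hA1 hs0 hsm.2 hgs hKA hKA2 hτ hX2' hS1 hX20 p1 p2
  have hwτ : wt (A - 1) (A - 1 + e) τ = wt (A - 1) (A - 1 + e) s * ((1 + -δ / (1 - s)) ^ (A - 1) * (1 + δ / (1 + s)) ^ (A - 1 + e)) := by
    obtain ⟨m1, m2⟩ := wsmall hK hρ1 hg0 hg1 hs0 hsm.2 hgs hKA hτ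
    have h1s : 0 < 1 - s := by linarith [hsm.2]
    have h1s' : 0 < 1 + s := by linarith [hsm.2]
    have k1 : 1 - τ = (1 - s) * (1 + -δ / (1 - s)) := by rw [hδ]; field_simp; ring
    have k2 : 1 + τ = (1 + s) * (1 + δ / (1 + s)) := by rw [hδ]; field_simp; ring
    unfold wt
    rw [k1, k2, Real.mul_rpow h1s.le (by linarith [(abs_le.1 m1).1]),
      Real.mul_rpow (by linarith) (by linarith [(abs_le.1 m2).1])]
    ring
  rw [hqτ, hwτ]
  have hw : 0 ≤ q.eval s ^ 2 * wt (A - 1) (A - 1 + e) s := by positivity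
  rw [show (q.eval s * PP) ^ 2 * (wt (A - 1) (A - 1 + e) s * ((1 + -δ / (1 - s)) ^ (A - 1) * (1 + δ / (1 + s)) ^ (A - 1 + e))) -
    q.eval s ^ 2 * wt (A - 1) (A - 1 + e) s = (q.eval s ^ 2 * wt (A - 1) (A - 1 + e) s) *
    (PP ^ 2 * ((1 + -δ / (1 - s)) ^ (A - 1) * (1 + δ / (1 + s)) ^ (A - 1 + e)) - 1) by ring, abs_mul, abs_of_nonneg hw, mul_comm]
  apply mul_le_mul_of_nonneg_right _ hw
  rw [abs_le]
  constructor <;> linarith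

end SCB
end

noncomputable section
namespace SCB
open Set

abbrev EE (n : ℕ) := EuclideanSpace ℝ (Fin n)

/-- surface measure -/
def sig (n : ℕ) : Measure (EE n) := ((volume : Measure (EE n)).toSphere).map Subtype.val

instance (n : ℕ) : IsFiniteMeasure (sig n) := by unfold sig; infer_instance

lemma lint_sig {n : ℕ} {f : EE n → ENNReal} (hf : Measurable f) :
    ∫⁻ z, f z ∂sig n = ∫⁻ z, f z.1 ∂(volume : Measure (EE n)).toSphere := by
  rw [sig, lintegral_map hf measurable_subtype_coe]

lemma sig_ae (n : ℕ) : ∀ᵐ z ∂sig n, ‖z‖ = 1 := by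
  rw [sig, ae_map_iff measurable_subtype_coe.aemeasurable (measurableSet_eq_fun (by fun_prop) (by fun_prop))]
  filter_upwards with z
  exact norm_eq_of_mem_sphere z

lemma polar {n : ℕ} (hn : 1 ≤ n) {f : EE n → ENNReal} (hf : Measurable f) :
    ∫⁻ x, f x = ∫⁻ z, (∫⁻ ρ in Ioi (0:ℝ), ENNReal.ofReal (ρ ^ (n - 1)) * f (ρ • z)) ∂sig n := by
  have : Nonempty (Fin n) := ⟨⟨0, hn⟩⟩
  have hmp := (volume : Measure (EE n)).measurePreserving_homeomorphUnitSphereProd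
  have h1 : ∫⁻ x, f x = ∫⁻ x : ({0}ᶜ : Set (EE n)), f x ∂(volume : Measure (EE n)).comap Subtype.val := by
    rw [lintegral_subtype_comap (measurableSet_singleton _).compl, restrict_compl_singleton]
  have h2 : ∫⁻ x : ({0}ᶜ : Set (EE n)), f x ∂(volume : Measure (EE n)).comap Subtype.val =
      ∫⁻ p, f (p.2.1 • p.1.1) ∂((volume : Measure (EE n)).toSphere.prod (Measure.volumeIoiPow (n - 1))) := by
    have e : Module.finrank ℝ (EE n) = n := by simp
    rw [e] at hmp
    rw [← hmp.lintegral_comp_emb (Homeomorph.measurableEmbedding _)]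
    congr 1
    ext x
    have := (homeomorphUnitSphereProd (EE n)).symm_apply_apply x
    have h3 := congrArg Subtype.val this
    rw [homeomorphUnitSphereProd_symm_apply_coe] at h3
    rw [h3]
  rw [h1, h2, lintegral_prod _ (by fun_prop), lint_sig]
  · congr 1
    ext z
    rw [Measure.volumeIoiPow, lintegral_withDensity_eq_lintegral_mul _ (by fun_prop) (by fun_prop)]
    rw [← lintegral_subtype_comap measurableSet_Ioi]
    rfl
  · have : Measurable (fun p : EE n × ℝ => ENNReal.ofReal (p.2 ^ (n - 1)) * f (p.2 • p.1)) := by fun_prop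
    exact this.lintegral_prod_right'

/-- prepend a coordinate -/
def consE {n : ℕ} (u : ℝ) (ζ : EE n) : EE (n + 1) := WithLp.toLp 2 (Fin.cons u ζ : Fin (n + 1) → ℝ)

lemma consE_inner {n : ℕ} (u u' : ℝ) (ζ ζ' : EE n) : ⟪consE u ζ, consE u' ζ'⟫ = u * u' + ⟪ζ, ζ'⟫ := by
  simp [consE, PiLp.inner_apply, Fin.sum_univ_succ]
  ring

lemma consE_norm_sq {n : ℕ} (u : ℝ) (ζ : EE n) : ‖consE u ζ‖ ^ 2 = u ^ 2 + ‖ζ‖ ^ 2 := by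
  rw [← real_inner_self_eq_norm_sq, ← real_inner_self_eq_norm_sq, consE_inner]; ring

lemma consE_smul {n : ℕ} (c u : ℝ) (ζ : EE n) : consE (c * u) (c • ζ) = c • consE u ζ := by
  ext i
  refine Fin.cases ?_ ?_ i <;> simp [consE]

lemma consE_cont {n : ℕ} : Continuous (fun p : ℝ × EE n => consE p.1 p.2) := by
  unfold consE
  apply (PiLp.continuous_toLp 2 _).comp
  apply continuous_pi
  intro i
  refine Fin.cases ?_ ?_ i
  · simpa using continuous_fst
  · intro j; simp; fun_prop

lemma consE_mp (n : ℕ) : MeasurePreserving (fun p : ℝ × EE n => consE p.1 p.2)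
    ((volume : Measure ℝ).prod volume) volume := by
  have h1 := (volume_preserving_piFinSuccAbove (fun _ : Fin (n + 1) => ℝ) 0).symm
  have h2 := PiLp.volume_preserving_toLp (Fin (n + 1))
  have h3 := PiLp.volume_preserving_ofLp (Fin n)
  have h4 := h2.comp (h1.comp ((MeasurePreserving.id (volume : Measure ℝ)).prod h3))
  have h5 : (fun p : ℝ × EE n => consE p.1 p.2) =
      WithLp.toLp 2 ∘ ⇑(MeasurableEquiv.piFinSuccAbove (fun _ => ℝ) 0).symm ∘ Prod.map id WithLp.ofLp := by
    funext p
    simp [consE, Fin.insertNthEquiv, MeasurableEquiv.piFinSuccAbove]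
  rw [h5]
  exact h4

lemma gauss_radial {n : ℕ} {f : EE (n + 1) → ENNReal} (hf : Measurable f) :
    ∫⁻ x : EE (n + 1), f (‖x‖⁻¹ • x) * ENNReal.ofReal (exp (-‖x‖)) =
      (∫⁻ X, f X ∂sig (n + 1)) * ∫⁻ ρ in Ioi (0:ℝ), ENNReal.ofReal (ρ ^ n) * ENNReal.ofReal (exp (-ρ)) := by
  rw [polar (by omega) (by fun_prop), ← lintegral_mul_const _ hf]
  apply lintegral_congr_ae
  filter_upwards [sig_ae (n + 1)] with z hz
  rw [← lintegral_const_mul _ (by fun_prop)]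
  apply setLIntegral_congr_fun measurableSet_Ioi
  intro ρ hρ
  have hρ' : (0:ℝ) < ρ := hρ
  simp only [norm_smul, hz, mul_one, Real.norm_eq_abs, abs_of_pos hρ', smul_smul, inv_mul_cancel₀ hρ'.ne', one_smul,
    Nat.add_sub_cancel]
  ring

lemma radial_const (n : ℕ) : (∫⁻ ρ in Ioi (0:ℝ), ENNReal.ofReal (ρ ^ n) * ENNReal.ofReal (exp (-ρ))) ≠ 0 ∧
    (∫⁻ ρ in Ioi (0:ℝ), ENNReal.ofReal (ρ ^ n) * ENNReal.ofReal (exp (-ρ))) ≠ ⊤ := by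
  have h : (∫⁻ ρ in Ioi (0:ℝ), ENNReal.ofReal (ρ ^ n) * ENNReal.ofReal (exp (-ρ))) =
      ENNReal.ofReal (Real.Gamma (n + 1)) := by
    rw [Real.Gamma_eq_integral (by positivity), ofReal_integral_eq_lintegral_ofReal]
    · apply setLIntegral_congr_fun measurableSet_Ioi
      intro ρ hρ
      have hρ' : (0:ℝ) < ρ := hρ
      simp only
      rw [← ENNReal.ofReal_mul (by positivity), mul_comm]
      simp
    · exact Real.GammaIntegral_convergent (by positivity)
    · filter_upwards [ae_restrict_mem measurableSet_Ioi] with ρ hρ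
      have hρ' : (0:ℝ) < ρ := hρ
      simp only [Pi.zero_apply]
      positivity
  rw [h]
  refine ⟨?_, ENNReal.ofReal_ne_top⟩
  have := Real.Gamma_pos_of_pos (show (0:ℝ) < n + 1 by positivity)
  simpa using this

lemma consE_meas {n : ℕ} {X : Type*} [MeasurableSpace X] {a : X → ℝ} {b : X → EE n} (ha : Measurable a) (hb : Measurable b) :
    Measurable (fun x => consE (a x) (b x)) := consE_cont.measurable.comp (ha.prodMk hb)

lemma slice_angle {n : ℕ} (hn : 1 ≤ n) {f : EE (n + 1) → ENNReal} (hf : Measurable f) :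
    ∫⁻ X, f X ∂sig (n + 1) = ∫⁻ ζ, (∫⁻ φ in Ioo 0 π, ENNReal.ofReal (sin φ ^ (n - 1)) *
      f (consE (cos φ) (sin φ • ζ))) ∂sig n := by
  obtain ⟨c0, c1⟩ := radial_const n
  rw [← ENNReal.mul_left_inj c0 c1, ← gauss_radial hf]
  have hm : Measurable (fun p : ℝ × EE n => consE p.1 p.2) := consE_cont.measurable
  rw [← (consE_mp n).lintegral_comp (by fun_prop), lintegral_prod _ (by fun_prop)]
  have hm3 : Measurable (fun p : (ℝ × EE n) × ℝ => consE p.1.1 (p.2 • p.1.2)) := by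
    have : Continuous (fun p : (ℝ × EE n) × ℝ => (p.1.1, p.2 • p.1.2)) := by fun_prop
    exact (consE_cont.comp this).measurable
  have step1 : ∀ x : ℝ, ∫⁻ y : EE n, f (‖consE x y‖⁻¹ • consE x y) * ENNReal.ofReal (exp (-‖consE x y‖)) =
      ∫⁻ ζ, (∫⁻ ρ in Ioi (0:ℝ), ENNReal.ofReal (ρ ^ (n - 1)) *
        (f (‖consE x (ρ • ζ)‖⁻¹ • consE x (ρ • ζ)) * ENNReal.ofReal (exp (-‖consE x (ρ • ζ)‖)))) ∂sig n := by
    intro x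
    have hm2 : Measurable (fun y : EE n => consE x y) := consE_meas measurable_const measurable_id
    exact polar hn (by fun_prop)
  simp_rw [step1]
  rw [lintegral_lintegral_swap]
  swap
  · have : Measurable (fun p : (ℝ × EE n) × ℝ => ENNReal.ofReal (p.2 ^ (n - 1)) *
        (f (‖consE p.1.1 (p.2 • p.1.2)‖⁻¹ • consE p.1.1 (p.2 • p.1.2)) * ENNReal.ofReal (exp (-‖consE p.1.1 (p.2 • p.1.2)‖)))) := by fun_prop
    exact this.lintegral_prod_right'.aemeasurable
  have hm5 : Measurable (fun p : EE n × ℝ => consE (cos p.2) (sin p.2 • p.1)) :=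
    consE_meas (by fun_prop) (by fun_prop)
  rw [← lintegral_mul_const]
  swap
  · have : Measurable (fun p : EE n × ℝ => ENNReal.ofReal (sin p.2 ^ (n - 1)) *
      f (consE (cos p.2) (sin p.2 • p.1))) := by fun_prop
    exact this.lintegral_prod_right'
  apply lintegral_congr_ae
  filter_upwards [sig_ae n] with ζ hζ
  have hm4 : Measurable (fun p : ℝ × ℝ => consE p.1 (p.2 • ζ)) := consE_meas (by fun_prop) (by fun_prop)
  have hm6 : Measurable (fun p : ℝ => consE (cos p) (sin p • ζ)) := consE_meas (by fun_prop) (by fun_prop)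
  set k : ℝ × ℝ → ENNReal := fun p => (Ioi (0:ℝ)).indicator (fun ρ => ENNReal.ofReal (ρ ^ (n - 1)) *
        (f (‖consE p.1 (ρ • ζ)‖⁻¹ • consE p.1 (ρ • ζ)) * ENNReal.ofReal (exp (-‖consE p.1 (ρ • ζ)‖)))) p.2 with hk
  have hkm : Measurable k := by
    have : k = (Prod.snd ⁻¹' (Ioi (0:ℝ))).indicator (fun p => ENNReal.ofReal (p.2 ^ (n - 1)) *
        (f (‖consE p.1 (p.2 • ζ)‖⁻¹ • consE p.1 (p.2 • ζ)) * ENNReal.ofReal (exp (-‖consE p.1 (p.2 • ζ)‖)))) := by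
      ext p
      simp only [hk, Set.indicator, mem_preimage]
    rw [this]
    exact Measurable.indicator (by fun_prop) (measurable_snd measurableSet_Ioi)
  have step2 : ∫⁻ x : ℝ, (∫⁻ ρ in Ioi (0:ℝ), ENNReal.ofReal (ρ ^ (n - 1)) *
        (f (‖consE x (ρ • ζ)‖⁻¹ • consE x (ρ • ζ)) * ENNReal.ofReal (exp (-‖consE x (ρ • ζ)‖)))) = ∫⁻ p, k p := by
    rw [Measure.volume_eq_prod, lintegral_prod _ hkm.aemeasurable]
    congr 1
    ext x
    rw [← lintegral_indicator measurableSet_Ioi]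
  rw [step2, ← lintegral_comp_polarCoord_symm]
  have ht : polarCoord.target = Ioi (0:ℝ) ×ˢ Ioo (-π) π := rfl
  rw [ht, Measure.volume_eq_prod, ← Measure.prod_restrict, lintegral_prod_symm' _ ?hmm]
  case hmm =>
    have hc : Measurable (fun p : ℝ × ℝ => polarCoord.symm p) := by
      simp only [polarCoord_symm_apply]; fun_prop
    fun_prop
  have hkey : ∀ φ ∈ Ioo (-π) π, (∫⁻ R in Ioi (0:ℝ), ENNReal.ofReal R • k (polarCoord.symm (R, φ))) =
      (Ioo 0 π).indicator (fun φ => (ENNReal.ofReal (sin φ ^ (n - 1)) * f (consE (cos φ) (sin φ • ζ))) *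
        ∫⁻ ρ in Ioi (0:ℝ), ENNReal.ofReal (ρ ^ n) * ENNReal.ofReal (exp (-ρ))) φ := by
    intro φ hφ
    by_cases h0 : 0 < φ
    · rw [indicator_of_mem (show φ ∈ Ioo 0 π from ⟨h0, hφ.2⟩), ← lintegral_const_mul _ (by fun_prop)]
      apply setLIntegral_congr_fun measurableSet_Ioi
      intro R hR
      have hR' : (0:ℝ) < R := hR
      have hsin : 0 < sin φ := sin_pos_of_pos_of_lt_pi h0 hφ.2
      have hpos : (0:ℝ) < R * sin φ := by positivity
      have hno : ‖consE (cos φ) (sin φ • ζ)‖ = 1 := by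
        rw [← sq_eq_sq₀ (norm_nonneg _) (by norm_num), consE_norm_sq, norm_smul, hζ, mul_one, Real.norm_eq_abs, sq_abs]
        linarith [sin_sq_add_cos_sq φ]
      have e1 : consE (R * cos φ) ((R * sin φ) • ζ) = R • consE (cos φ) (sin φ • ζ) := by rw [mul_smul, consE_smul]
      simp only [hk, polarCoord_symm_apply, indicator_of_mem (mem_Ioi.2 hpos), e1, norm_smul, hno,
        mul_one, Real.norm_eq_abs, abs_of_pos hR', smul_smul, inv_mul_cancel₀ hR'.ne', one_smul, smul_eq_mul]
      obtain ⟨j, rfl⟩ : ∃ j, n = j + 1 := ⟨n - 1, by omega⟩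
      simp only [Nat.add_sub_cancel, mul_pow, pow_succ]
      rw [ENNReal.ofReal_mul (by positivity), ENNReal.ofReal_mul (by positivity)]
      ring
    · rw [indicator_of_notMem (by simp [h0])]
      rw [← lintegral_zero]
      apply setLIntegral_congr_fun measurableSet_Ioi
      intro R hR
      have hR' : (0:ℝ) < R := hR
      have hsin : sin φ ≤ 0 := sin_nonpos_of_nonpos_of_neg_pi_le (by linarith) hφ.1.le
      have : R * sin φ ∉ Ioi (0:ℝ) := by
        simp only [mem_Ioi, not_lt]; exact mul_nonpos_of_nonneg_of_nonpos hR'.le hsin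
      simp only [hk, polarCoord_symm_apply, indicator_of_notMem this, smul_zero]
  rw [setLIntegral_congr_fun measurableSet_Ioo hkey, lintegral_indicator measurableSet_Ioo,
    Measure.restrict_restrict measurableSet_Ioo, lintegral_mul_const _ (by fun_prop)]
  have : Ioo 0 π ∩ Ioo (-π) π = Ioo 0 π := by
    apply inter_eq_left.2
    exact Ioo_subset_Ioo_left (by linarith [pi_pos])
  rw [this]

lemma slice {n : ℕ} (hn : 1 ≤ n) {f : EE (n + 1) → ENNReal} (hf : Measurable f) :
    ∫⁻ X, f X ∂sig (n + 1) = ∫⁻ ζ, (∫⁻ u in Ioo (-1:ℝ) 1, ENNReal.ofReal ((1 - u ^ 2) ^ (((n:ℝ) - 2) / 2)) *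
      f (consE u (√(1 - u ^ 2) • ζ))) ∂sig n := by
  rw [slice_angle hn hf]
  congr 1
  ext ζ
  have him : cos '' Ioo 0 π = Ioo (-1) 1 := by
    ext y
    constructor
    · rintro ⟨x, hx, rfl⟩
      have h1 := cos_lt_cos_of_nonneg_of_le_pi le_rfl hx.2.le hx.1
      have h2 := cos_lt_cos_of_nonneg_of_le_pi hx.1.le le_rfl hx.2
      rw [cos_zero] at h1; rw [cos_pi] at h2
      exact ⟨h2, h1⟩
    · rintro ⟨h1, h2⟩
      refine ⟨arccos y, ⟨arccos_pos.2 h2, ?_⟩, cos_arccos h1.le h2.le⟩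
      rcases lt_or_eq_of_le (arccos_le_pi y) with h | h
      · exact h
      · rw [arccos_eq_pi] at h; linarith
  rw [← him, lintegral_image_eq_lintegral_abs_deriv_mul measurableSet_Ioo
    (fun x _ => (hasDerivAt_cos x).hasDerivWithinAt) (injOn_cos.mono Ioo_subset_Icc_self)]
  apply setLIntegral_congr_fun measurableSet_Ioo
  intro φ hφ
  have hsin : 0 < sin φ := sin_pos_of_pos_of_lt_pi hφ.1 hφ.2
  have h1 : 1 - cos φ ^ 2 = sin φ ^ 2 := by linarith [sin_sq_add_cos_sq φ]
  simp only
  rw [h1, sqrt_sq hsin.le, abs_neg, abs_of_pos hsin, ← mul_assoc, ← ENNReal.ofReal_mul hsin.le]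
  congr 2
  have h3 : ∀ y : ℝ, sin φ * sin φ ^ y = sin φ ^ (1 + y) := by
    intro y; rw [Real.rpow_add hsin, Real.rpow_one]
  rw [← Real.rpow_natCast (sin φ) 2, ← Real.rpow_mul hsin.le, h3, ← Real.rpow_natCast]
  congr 1
  push_cast [Nat.cast_sub hn]
  ring

end SCB
end

noncomputable section
namespace SCB
open Set

/-- weighted measure on the interval -/
def wm (n : ℕ) : Measure ℝ :=
  (volume.restrict (Ioo (-1:ℝ) 1)).withDensity (fun u => ENNReal.ofReal ((1 - u ^ 2) ^ (((n:ℝ) - 2) / 2)))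

lemma wm_fin {n : ℕ} (hn : 2 ≤ n) : IsFiniteMeasure (wm n) := by
  constructor
  rw [wm, withDensity_apply _ MeasurableSet.univ, Measure.restrict_univ]
  calc ∫⁻ u in Ioo (-1:ℝ) 1, ENNReal.ofReal ((1 - u ^ 2) ^ (((n:ℝ) - 2) / 2)) ≤ ∫⁻ u in Ioo (-1:ℝ) 1, 1 := by
        apply setLIntegral_mono measurable_const
        intro u hu
        rw [ENNReal.ofReal_le_one]
        have hn' : (2:ℝ) ≤ n := by exact_mod_cast hn
        apply Real.rpow_le_one <;> nlinarith [hu.1, hu.2]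
    _ < ⊤ := by simp

lemma wm_ae (n : ℕ) : ∀ᵐ u ∂wm n, u ∈ Ioo (-1:ℝ) 1 := by
  apply (withDensity_absolutelyContinuous _ _).ae_le
  exact ae_restrict_mem measurableSet_Ioo

lemma wm_integral (n : ℕ) (g : ℝ → ℝ) :
    ∫ u, g u ∂wm n = ∫ u in Ioo (-1:ℝ) 1, (1 - u ^ 2) ^ (((n:ℝ) - 2) / 2) * g u := by
  rw [wm, integral_withDensity_eq_integral_toReal_smul (by fun_prop) (by simp)]
  apply setIntegral_congr_fun measurableSet_Ioo
  intro u hu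
  simp only [smul_eq_mul]
  rw [ENNReal.toReal_ofReal]
  apply Real.rpow_nonneg
  nlinarith [hu.1, hu.2]

/-- the slicing map -/
def TT (n : ℕ) (p : ℝ × EE n) : EE (n + 1) := consE p.1 (√(1 - p.1 ^ 2) • p.2)

lemma TT_cont (n : ℕ) : Continuous (TT n) := by
  have : Continuous (fun p : ℝ × EE n => (p.1, √(1 - p.1 ^ 2) • p.2)) := by fun_prop
  exact consE_cont.comp this

lemma slice_map {n : ℕ} (hn : 2 ≤ n) : sig (n + 1) = ((wm n).prod (sig n)).map (TT n) := by
  have := wm_fin hn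
  apply Measure.ext_of_lintegral
  intro f hf
  have hT := (TT_cont n).measurable
  rw [lintegral_map hf hT, lintegral_prod_symm' _ (by fun_prop), slice (by omega) hf]
  congr 1
  ext ζ
  rw [wm, lintegral_withDensity_eq_lintegral_mul _ (by fun_prop)]
  · rfl
  · exact (hf.comp hT).comp (measurable_id.prodMk measurable_const)

lemma slice_int {n : ℕ} (hn : 2 ≤ n) {f : EE (n + 1) → ℝ} (hf : Continuous f) :
    ∫ X, f X ∂sig (n + 1) = ∫ u, (∫ ζ, f (TT n (u, ζ)) ∂sig n) ∂wm n := by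
  have := wm_fin hn
  rw [slice_map hn, integral_map (TT_cont n).measurable.aemeasurable hf.aestronglyMeasurable, integral_prod]
  have hc : IsCompact (Metric.closedBall (0 : EE (n + 1)) 1) := isCompact_closedBall 0 1
  obtain ⟨C, hC⟩ := hc.exists_bound_of_continuousOn hf.continuousOn
  apply Integrable.of_bound (hf.comp (TT_cont n)).aestronglyMeasurable C
  have h1 : ∀ᵐ p ∂(wm n).prod (sig n), ‖TT n p‖ = 1 := by
    have := sig_ae (n + 1)
    rw [slice_map hn, ae_map_iff (TT_cont n).measurable.aemeasurable (measurableSet_eq_fun (by fun_prop) (by fun_prop))] at this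
    exact this
  filter_upwards [h1] with p hp
  apply hC
  simp [hp]

lemma sig_integrable {n : ℕ} {f : EE n → ℝ} (hf : Continuous f) : Integrable f (sig n) := by
  have hc : IsCompact (Metric.closedBall (0 : EE n) 1) := isCompact_closedBall 0 1
  obtain ⟨C, hC⟩ := hc.exists_bound_of_continuousOn hf.continuousOn
  apply Integrable.of_bound hf.aestronglyMeasurable C
  filter_upwards [sig_ae n] with p hp
  apply hC
  simp [hp]

lemma sig_inv {n : ℕ} (L : EE (n + 1) ≃ₗᵢ[ℝ] EE (n + 1)) : (sig (n + 1)).map L = sig (n + 1) := by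
  apply Measure.ext_of_lintegral
  intro f hf
  have hL : Measurable L := L.continuous.measurable
  rw [lintegral_map hf hL]
  obtain ⟨c0, c1⟩ := radial_const n
  rw [← ENNReal.mul_left_inj c0 c1, ← gauss_radial hf, ← gauss_radial (f := fun x => f (L x)) (by fun_prop)]
  have := (L.measurePreserving).lintegral_comp (f := fun x => f (‖x‖⁻¹ • x) * ENNReal.ofReal (exp (-‖x‖))) (by fun_prop)
  rw [← this]
  simp

lemma sig_inv_int {n : ℕ} (L : EE (n + 1) ≃ₗᵢ[ℝ] EE (n + 1)) (f : EE (n + 1) → ℝ) :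
    ∫ x, f (L x) ∂sig (n + 1) = ∫ x, f x ∂sig (n + 1) := by
  conv_rhs => rw [← sig_inv L]
  have := integral_map_equiv (μ := sig (n + 1)) L.toMeasurableEquiv f
  exact this.symm

/-- total mass -/
def om (n : ℕ) : ℝ := (sig n).real univ

lemma om_eq {n : ℕ} (hn : 1 ≤ n) : om n = n * (√π ^ n / Real.Gamma (n / 2 + 1)) := by
  have : Nonempty (Fin n) := ⟨⟨0, hn⟩⟩
  have h := (volume : Measure (EE n)).toSphere_real_apply_univ
  rw [om, sig, measureReal_def, Measure.map_apply measurable_subtype_coe MeasurableSet.univ, preimage_univ, ← measureReal_def, h]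
  rw [measureReal_def, EuclideanSpace.volume_ball]
  have : 0 < Real.Gamma ((n:ℝ) / 2 + 1) := Real.Gamma_pos_of_pos (by positivity)
  simp
  left; positivity

lemma om_pos {n : ℕ} (hn : 1 ≤ n) : 0 < om n := by
  have : 0 < Real.Gamma ((n:ℝ) / 2 + 1) := Real.Gamma_pos_of_pos (by positivity)
  rw [om_eq hn]; positivity

lemma om_add_two {m : ℕ} (hm : 1 ≤ m) : om (m + 2) = 2 * π / m * om m := by
  rw [om_eq hm, om_eq (by omega)]
  have h2 : (0:ℝ) < m := by positivity
  have : 0 < Real.Gamma ((m:ℝ) / 2 + 1) := Real.Gamma_pos_of_pos (by positivity)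
  have h1 : Real.Gamma (((m + 2 : ℕ) : ℝ) / 2 + 1) = ((m:ℝ) / 2 + 1) * Real.Gamma ((m:ℝ) / 2 + 1) := by
    rw [← Real.Gamma_add_one (by positivity)]; congr 1; push_cast; ring
  rw [h1, pow_add, Real.sq_sqrt pi_pos.le]
  push_cast
  field_simp

lemma om_const {n : ℕ} (c : ℝ) : ∫ _, c ∂sig n = om n * c := by
  simp [om]

end SCB
end

noncomputable section
namespace SCB
open Set

lemma trans_pair {n : ℕ} {x y x' y' : EE n} (hx : ‖x‖ = 1) (hy : ‖y‖ = 1) (hx' : ‖x'‖ = 1) (hy' : ‖y'‖ = 1)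
    (h : ⟪x, y⟫ = ⟪x', y'⟫) : ∃ L : EE n ≃ₗᵢ[ℝ] EE n, L x = x' ∧ L y = y' := by
  set L1 : EE n ≃ₗᵢ[ℝ] EE n := (ℝ ∙ (x - x'))ᗮ.reflection with hL1
  have h1 : L1 x = x' := Submodule.reflection_sub (by rw [hx, hx'])
  have hn : ‖L1 y‖ = ‖y'‖ := by rw [L1.norm_map, hy, hy']
  set L2 : EE n ≃ₗᵢ[ℝ] EE n := (ℝ ∙ (L1 y - y'))ᗮ.reflection with hL2
  have h2 : L2 (L1 y) = y' := Submodule.reflection_sub hn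
  have h3 : L2 x' = x' := by
    apply Submodule.reflection_mem_subspace_eq_self
    rw [Submodule.mem_orthogonal_singleton_iff_inner_left, inner_sub_right, ← h, ← h1, L1.inner_map_map]
    simp
  exact ⟨L1.trans L2, by simp [h1, h3], by simp [h2]⟩

lemma trans_one {n : ℕ} {x x' : EE n} (hx : ‖x‖ = 1) (hx' : ‖x'‖ = 1) : ∃ L : EE n ≃ₗᵢ[ℝ] EE n, L x = x' := by
  obtain ⟨L, h, _⟩ := trans_pair hx hx hx' hx' (by rw [real_inner_self_eq_norm_sq, real_inner_self_eq_norm_sq, hx, hx'])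
  exact ⟨L, h⟩

lemma exists_consE {n : ℕ} (x : EE (n + 1)) : ∃ t η, x = consE t η := by
  refine ⟨x 0, WithLp.toLp 2 (fun i => x i.succ), ?_⟩
  ext i
  refine Fin.cases ?_ ?_ i <;> simp [consE]

/-- first basis vector -/
def e0 (n : ℕ) : EE (n + 1) := consE 1 0

lemma e0_norm (n : ℕ) : ‖e0 n‖ = 1 := by
  rw [← sq_eq_sq₀ (norm_nonneg _) (by norm_num), e0, consE_norm_sq]; simp

lemma zonal {n : ℕ} (hn : 2 ≤ n) {g : ℝ → ℝ} (hg : Continuous g) {x : EE (n + 1)} (hx : ‖x‖ = 1) :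
    ∫ z, g ⟪x, z⟫ ∂sig (n + 1) = om n * ∫ u, g u ∂wm n := by
  obtain ⟨L, hL⟩ := trans_one hx (e0_norm n)
  have h1 : ∫ z, g ⟪x, z⟫ ∂sig (n + 1) = ∫ z, g ⟪e0 n, z⟫ ∂sig (n + 1) := by
    symm
    rw [← sig_inv_int L]
    congr 1; ext z
    rw [← hL, L.inner_map_map]
  rw [h1, slice_int hn (by fun_prop), ← integral_const_mul]
  congr 1; ext u
  simp only [e0, TT, consE_inner, one_mul, inner_zero_left, add_zero]
  rw [om_const]

lemma om_succ {n : ℕ} (hn : 2 ≤ n) : om (n + 1) = om n * ∫ _, (1:ℝ) ∂wm n := by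
  have := zonal hn (g := fun _ => 1) continuous_const (e0_norm n)
  rw [← this, om_const]; simp

lemma wm_integrable {n : ℕ} (hn : 2 ≤ n) {g : ℝ → ℝ} (hg : Continuous g) : Integrable g (wm n) := by
  have := wm_fin hn
  obtain ⟨C, hC⟩ := (isCompact_Icc (a := (-1:ℝ)) (b := 1)).exists_bound_of_continuousOn hg.continuousOn
  apply Integrable.of_bound hg.aestronglyMeasurable C
  filter_upwards [wm_ae n] with u hu
  exact hC u (Ioo_subset_Icc_self hu)

lemma conv_pow {n : ℕ} (hn : 2 ≤ n) {Q : ℝ → ℝ} (hQ : Continuous Q) {l : ℕ} {c : ℝ}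
    (h : ∀ k, 2 * k ≤ l → ∫ u, Q u * (u ^ (l - 2 * k) * (1 - u ^ 2) ^ k) ∂wm n = if k = 0 then c else 0)
    {x : EE (n + 1)} (hx : ‖x‖ = 1) (y : EE (n + 1)) :
    ∫ z, Q ⟪x, z⟫ * ⟪y, z⟫ ^ l ∂sig (n + 1) = om n * c * ⟪x, y⟫ ^ l := by
  obtain ⟨L, hL⟩ := trans_one hx (e0_norm n)
  obtain ⟨t, η, hy⟩ := exists_consE (L y)
  have ht : ⟪x, y⟫ = t := by rw [← L.inner_map_map, hL, hy, e0, consE_inner]; simp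
  have h1 : ∫ z, Q ⟪x, z⟫ * ⟪y, z⟫ ^ l ∂sig (n + 1) = ∫ z, Q ⟪e0 n, z⟫ * ⟪consE t η, z⟫ ^ l ∂sig (n + 1) := by
    symm
    rw [← sig_inv_int L]
    congr 1; ext z
    rw [← hL, ← hy, L.inner_map_map, L.inner_map_map]
  obtain ⟨n', rfl⟩ : ∃ n', n = n' + 1 := ⟨n - 1, by omega⟩
  set M : ℕ → ℝ := fun j => ∫ ζ, ⟪η, ζ⟫ ^ j ∂sig (n' + 1) with hM
  have hM0 : M 0 = om (n' + 1) := by simp [hM, om]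
  have hModd : ∀ k, M (2 * k + 1) = 0 := by
    intro k
    have := sig_inv_int (LinearIsometryEquiv.neg ℝ : EE (n' + 1) ≃ₗᵢ[ℝ] EE (n' + 1)) (fun ζ => ⟪η, ζ⟫ ^ (2 * k + 1))
    simp only [LinearIsometryEquiv.coe_neg, inner_neg_right, Odd.neg_pow ⟨k, rfl⟩] at this
    rw [integral_neg] at this
    simp only [hM]
    linarith
  rw [h1, slice_int hn (by fun_prop)]
  have h2 : ∀ u ∈ Ioo (-1:ℝ) 1, ∫ ζ, Q ⟪e0 (n' + 1), TT (n' + 1) (u, ζ)⟫ * ⟪consE t η, TT (n' + 1) (u, ζ)⟫ ^ l ∂sig (n' + 1) =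
      ∑ j ∈ Finset.range (l + 1), (l.choose j * t ^ (l - j) * M j) * (Q u * (u ^ (l - j) * √(1 - u ^ 2) ^ j)) := by
    intro u hu
    simp only [e0, TT, consE_inner, one_mul, inner_zero_left, add_zero, inner_smul_right, mul_zero, hM]
    simp_rw [add_comm (t * u), add_pow, Finset.mul_sum]
    rw [integral_finsetSum]
    · apply Finset.sum_congr rfl
      intro j _
      rw [show (l.choose j * t ^ (l - j) * ∫ ζ, ⟪η, ζ⟫ ^ j ∂sig (n' + 1)) * (Q u * (u ^ (l - j) * √(1 - u ^ 2) ^ j)) =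
        (l.choose j * t ^ (l - j) * (Q u * (u ^ (l - j) * √(1 - u ^ 2) ^ j))) * ∫ ζ, ⟪η, ζ⟫ ^ j ∂sig (n' + 1) by ring,
        ← integral_const_mul]
      congr 1; ext ζ
      rw [mul_pow, mul_pow]; ring
    · intro j _
      exact sig_integrable (by fun_prop)
  rw [integral_congr_ae ((wm_ae (n' + 1)).mono h2), integral_finsetSum]
  swap
  · intro j _; exact wm_integrable hn (by fun_prop)
  rw [Finset.sum_eq_single 0]
  · have := h 0 (by omega)
    simp only [mul_zero, Nat.sub_zero, pow_zero, mul_one, if_true] at this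
    simp only [Nat.sub_zero, pow_zero, mul_one, hM0, Nat.choose_zero_right, Nat.cast_one, one_mul]
    rw [integral_const_mul, this, ht]; ring
  · intro j hj hj0
    rw [integral_const_mul]
    rcases Nat.even_or_odd' j with ⟨k, rfl | rfl⟩
    · have h3 := h k (by simp at hj; omega)
      rw [if_neg (by omega)] at h3
      have : ∀ u ∈ Ioo (-1:ℝ) 1, Q u * (u ^ (l - 2 * k) * √(1 - u ^ 2) ^ (2 * k)) = Q u * (u ^ (l - 2 * k) * (1 - u ^ 2) ^ k) := by
        intro u hu
        rw [pow_mul, Real.sq_sqrt]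
        nlinarith [hu.1, hu.2]
      rw [integral_congr_ae ((wm_ae (n' + 1)).mono this), h3, mul_zero]
    · rw [hModd]; ring
  · simp

open Polynomial in
lemma wm_L {n : ℕ} (f : ℝ[X]) : ∫ u, f.eval u ∂wm n = L ((n:ℝ) / 2 - 1) ((n:ℝ) / 2 - 1) f := by
  rw [wm_integral, L, intervalIntegral.integral_of_le (by norm_num), integral_Ioc_eq_integral_Ioo]
  apply setIntegral_congr_fun measurableSet_Ioo
  intro u hu
  simp only [wt]
  rw [← Real.mul_rpow (by linarith [hu.2]) (by linarith [hu.1]), mul_comm]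
  rw [show (1 - u) * (1 + u) = 1 - u ^ 2 by ring, show (n:ℝ) / 2 - 1 = ((n:ℝ) - 2) / 2 by ring]

end SCB
end

noncomputable section
namespace SCB
open Set Polynomial

lemma L_odd {a : ℝ} {f : ℝ[X]} (hf : f.comp (-X) = -f) : L a a f = 0 := by
  have h : L a a f = - L a a f := by
    unfold L
    have h0 := intervalIntegral.integral_comp_neg (a := -1) (b := 1) (fun t => f.eval t * wt a a t)
    rw [neg_neg] at h0
    conv_lhs => rw [← h0]
    rw [← intervalIntegral.integral_neg]
    congr 1; ext t
    have h1 : f.eval (-t) = - f.eval t := by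
      have := congrArg (eval t) hf
      simpa using this
    have h2 : wt a a (-t) = wt a a t := by unfold wt; rw [mul_comm]; congr 2 <;> ring
    rw [h1, h2]; ring
  linarith

/-- the polynomial `X^(l-2k) (1-X²)^k` -/
def mon (l k : ℕ) : ℝ[X] := X ^ (l - 2 * k) * (1 - X ^ 2) ^ k

lemma mon_deg {l k : ℕ} (h : 2 * k ≤ l) : (mon l k).natDegree ≤ l := by
  unfold mon
  have h1 : ((1 - X ^ 2 : ℝ[X]) ^ k).natDegree ≤ k * 2 := by
    refine natDegree_pow_le_of_le k ?_
    compute_degree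
  refine (natDegree_mul_le_of_le (natDegree_X_pow_le _) h1).trans ?_
  omega

lemma mon_parity {l k : ℕ} (h : 2 * k ≤ l) : (mon l k).comp (-X) = C ((-1) ^ l) * mon l k := by
  have : l = l - 2 * k + 2 * k := by omega
  have h2 : (-1:ℝ) ^ l = (-1) ^ (l - 2 * k) := by
    conv_lhs => rw [this, pow_add, pow_mul]
    simp
  unfold mon
  rw [h2]
  simp
  ring

variable {n : ℕ}

lemma conv_hyp0 (hn : 2 ≤ n) (i : ℕ) {l k : ℕ} (hl : l ≤ i) (hk : 2 * k ≤ l) :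
    ∫ u, (jp ((n:ℝ) / 2) ((n:ℝ) / 2 - 1) i).eval u * (u ^ (l - 2 * k) * (1 - u ^ 2) ^ k) ∂wm n =
      if k = 0 then Ic ((n:ℝ) / 2) ((n:ℝ) / 2 - 1) i else 0 := by
  have hn' : (2:ℝ) ≤ n := by exact_mod_cast hn
  have h1 := repro (A := (n:ℝ) / 2) (β := (n:ℝ) / 2 - 1) (by linarith) (by linarith) (d := i) (f := mon l k) ((mon_deg hk).trans hl)
  rw [← wm_L] at h1
  have h2 : (mon l k).eval 1 = if k = 0 then 1 else 0 := by
    split_ifs with h <;> simp [mon, h]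
  rw [h2] at h1
  simp only [eval_mul, mon, eval_pow, eval_X, eval_sub, eval_one] at h1
  rw [h1]; split_ifs <;> simp

lemma conv_hyp1 (hn : 2 ≤ n) (i : ℕ) {l k : ℕ} (hl : l ≤ i) (hp : (-1:ℝ) ^ l = (-1) ^ i) (hk : 2 * k ≤ l) :
    ∫ u, (jp ((n:ℝ) / 2) ((n:ℝ) / 2) i).eval u * (u ^ (l - 2 * k) * (1 - u ^ 2) ^ k) ∂wm n =
      if k = 0 then Ic ((n:ℝ) / 2) ((n:ℝ) / 2) i else 0 := by
  have hn' : (2:ℝ) ≤ n := by exact_mod_cast hn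
  have h1 := repro (A := (n:ℝ) / 2) (β := (n:ℝ) / 2) (by linarith) (by linarith) (d := i) (f := mon l k) ((mon_deg hk).trans hl)
  have h2 : (mon l k).eval 1 = if k = 0 then 1 else 0 := by
    split_ifs with h <;> simp [mon, h]
  rw [h2] at h1
  set Q := jp ((n:ℝ) / 2) ((n:ℝ) / 2) i with hQ
  have h3 : L ((n:ℝ) / 2 - 1) ((n:ℝ) / 2) (Q * mon l k) =
      L ((n:ℝ) / 2 - 1) ((n:ℝ) / 2 - 1) (Q * mon l k) + L ((n:ℝ) / 2 - 1) ((n:ℝ) / 2 - 1) (X * (Q * mon l k)) := by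
    rw [← L_add (by linarith) (by linarith)]
    apply L_congr
    intro t ht
    have := wt_shift (a := (n:ℝ) / 2 - 1) (b := (n:ℝ) / 2 - 1) (by linarith) (by linarith) 0 1 ht
    simp only [Nat.cast_zero, add_zero, Nat.cast_one, sub_add_cancel, pow_zero, pow_one, one_mul] at this
    rw [this]
    simp only [eval_add, eval_mul, eval_X]
    ring
  have h4 : L ((n:ℝ) / 2 - 1) ((n:ℝ) / 2 - 1) (X * (Q * mon l k)) = 0 := by
    apply L_odd
    rw [mul_comp, mul_comp, mon_parity hk, hQ, jp_parity, hp, X_comp]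
    have : C ((-1:ℝ) ^ i) * C ((-1:ℝ) ^ i) = 1 := by
      rw [← C_mul, ← mul_pow]; simp
    linear_combination (-X * jp ((n:ℝ) / 2) ((n:ℝ) / 2) i * mon l k) * this
  rw [h3, h4, add_zero, ← wm_L] at h1
  simp only [eval_mul, mon, eval_pow, eval_X, eval_sub, eval_one] at h1
  rw [h1]; split_ifs <;> simp

end SCB
end

noncomputable section
namespace SCB
open Set Polynomial

/-- positive definite kernels on the unit sphere -/
def PD (n : ℕ) (g : ℝ → ℝ) : Prop :=
  ∀ (ι : Type) [Fintype ι] (x : ι → EE n), (∀ i, ‖x i‖ = 1) → ∀ w : ι → ℝ,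
    0 ≤ ∑ i, ∑ j, w i * w j * g ⟪x i, x j⟫

lemma PD.mat {n : ℕ} {g : ℝ → ℝ} (hg : PD n g) (ι : Type) [Fintype ι] (x : ι → EE n) (hx : ∀ i, ‖x i‖ = 1) :
    (Matrix.of fun i j => g ⟪x i, x j⟫).PosSemidef := by
  refine Matrix.PosSemidef.of_dotProduct_mulVec_nonneg ?_ fun w => ?_
  · ext i j; simp [real_inner_comm]
  · refine (hg ι x hx w).trans_eq ?_
    simp only [dotProduct, Matrix.mulVec, Finset.mul_sum, Matrix.of_apply]
    refine Finset.sum_congr rfl fun i _ => Finset.sum_congr rfl fun j _ => ?_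
    simp; ring

lemma PD.mul {n : ℕ} {g h : ℝ → ℝ} (hg : PD n g) (hh : PD n h) : PD n (fun t => g t * h t) := by
  intro ι _ x hx w
  have := ((hg.mat ι x hx).hadamard (hh.mat ι x hx)).dotProduct_mulVec_nonneg w
  refine this.trans_eq ?_
  simp only [dotProduct, Matrix.mulVec, Finset.mul_sum, Matrix.of_apply, Matrix.hadamard_apply]
  refine Finset.sum_congr rfl fun i _ => Finset.sum_congr rfl fun j _ => ?_
  simp; ring

lemma PD.sum {n d : ℕ} {g : ℕ → ℝ → ℝ} {c : ℕ → ℝ} (hc : ∀ i < d, 0 ≤ c i) (hg : ∀ i < d, PD n (g i)) :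
    PD n (fun t => ∑ i ∈ Finset.range d, c i * g i t) := by
  intro ι _ x hx w
  have h : ∑ i, ∑ j, w i * w j * ∑ k ∈ Finset.range d, c k * g k ⟪x i, x j⟫ =
      ∑ k ∈ Finset.range d, c k * ∑ i, ∑ j, w i * w j * g k ⟪x i, x j⟫ := by
    simp only [Finset.mul_sum]
    symm
    rw [Finset.sum_comm]
    refine Finset.sum_congr rfl fun i _ => ?_
    rw [Finset.sum_comm]
    refine Finset.sum_congr rfl fun j _ => Finset.sum_congr rfl fun k _ => ?_
    ring
  rw [h]
  refine Finset.sum_nonneg fun k hk => mul_nonneg (hc k (Finset.mem_range.1 hk)) (hg k (Finset.mem_range.1 hk) ι x hx w)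

lemma PD_one_add (n : ℕ) : PD n (fun t => 1 + t) := by
  intro ι _ x hx w
  have h : ∑ i, ∑ j, w i * w j * (1 + ⟪x i, x j⟫) = (∑ i, w i) ^ 2 + ⟪∑ i, w i • x i, ∑ i, w i • x i⟫ := by
    rw [sq, Finset.sum_mul_sum, sum_inner, ← Finset.sum_add_distrib]
    refine Finset.sum_congr rfl fun i _ => ?_
    rw [inner_sum, ← Finset.sum_add_distrib]
    refine Finset.sum_congr rfl fun j _ => ?_
    rw [real_inner_smul_left, real_inner_smul_right]; ring
  rw [h]
  exact add_nonneg (sq_nonneg _) real_inner_self_nonneg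

lemma PD_one (n : ℕ) : PD n (fun _ => 1) := by
  intro ι _ x hx w
  have h : ∑ i, ∑ j, w i * w j * 1 = (∑ i, w i) ^ 2 := by
    rw [sq, Finset.sum_mul_sum]; simp
  rw [h]
  exact sq_nonneg _

variable {n : ℕ}

/-- the Jacobi polynomials in use -/
abbrev jn (n e i : ℕ) : ℝ[X] := jp ((n:ℝ) / 2) ((n:ℝ) / 2 - 1 + e) i

lemma conv_jn (hn : 2 ≤ n) {e : ℕ} (he : e = 0 ∨ e = 1) (i : ℕ) {x : EE (n + 1)} (hx : ‖x‖ = 1) (y : EE (n + 1)) :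
    ∫ z, (jn n e i).eval ⟪x, z⟫ * (jn n e i).eval ⟪y, z⟫ ∂sig (n + 1) =
      om n * Ic ((n:ℝ) / 2) ((n:ℝ) / 2 - 1 + e) i * (jn n e i).eval ⟪x, y⟫ := by
  have hdeg : (jn n e i).natDegree < i + 1 := Nat.lt_succ_of_le (jp_degree_le _ _ _)
  have key : ∀ l, l ≤ i → ∫ z, (jn n e i).eval ⟪x, z⟫ * ((jn n e i).coeff l * ⟪y, z⟫ ^ l) ∂sig (n + 1) =
      om n * Ic ((n:ℝ) / 2) ((n:ℝ) / 2 - 1 + e) i * ((jn n e i).coeff l * ⟪x, y⟫ ^ l) := by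
    intro l hl
    by_cases hc : (jn n e i).coeff l = 0
    · simp [hc]
    have hconv : ∫ z, (jn n e i).eval ⟪x, z⟫ * ⟪y, z⟫ ^ l ∂sig (n + 1) =
        om n * Ic ((n:ℝ) / 2) ((n:ℝ) / 2 - 1 + e) i * ⟪x, y⟫ ^ l := by
      refine conv_pow hn (Q := fun u => (jn n e i).eval u) (by fun_prop) ?_ hx y
      rcases he with rfl | rfl
      · intro k hk
        have := conv_hyp0 hn i hl hk
        simpa [jn] using this
      · intro k hk
        have hp : (-1:ℝ) ^ l = (-1) ^ i := by
          have h1 := congrArg (fun p => coeff p l) (jp_parity ((n:ℝ) / 2) i)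
          simp only [coeff_C_mul] at h1
          have h2 : (jp ((n:ℝ) / 2) ((n:ℝ) / 2) i).coeff l ≠ 0 := by simpa [jn] using hc
          rw [show (-X : ℝ[X]) = C (-1) * X by simp, comp_C_mul_X_coeff, mul_comm] at h1
          exact mul_right_cancel₀ h2 h1
        have := conv_hyp1 hn i hl hp hk
        simpa [jn] using this
    calc _ = ∫ z, (jn n e i).coeff l * ((jn n e i).eval ⟪x, z⟫ * ⟪y, z⟫ ^ l) ∂sig (n + 1) := by
          congr 1; ext z; ring
      _ = _ := by rw [integral_const_mul, hconv]; ring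
  have hev : ∀ t, (jn n e i).eval t = ∑ l ∈ Finset.range (i + 1), (jn n e i).coeff l * t ^ l :=
    fun t => eval_eq_sum_range' hdeg t
  calc _ = ∫ z, ∑ l ∈ Finset.range (i + 1), (jn n e i).eval ⟪x, z⟫ * ((jn n e i).coeff l * ⟪y, z⟫ ^ l) ∂sig (n + 1) := by
        congr 1; ext z
        rw [← Finset.mul_sum, ← hev]
    _ = ∑ l ∈ Finset.range (i + 1), ∫ z, (jn n e i).eval ⟪x, z⟫ * ((jn n e i).coeff l * ⟪y, z⟫ ^ l) ∂sig (n + 1) := by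
        apply integral_finsetSum
        intro l _
        apply sig_integrable
        fun_prop
    _ = _ := by
        rw [hev ⟪x, y⟫, Finset.mul_sum]
        exact Finset.sum_congr rfl fun l hl => key l (by rw [Finset.mem_range] at hl; omega)

lemma PD_jn (hn : 2 ≤ n) {e : ℕ} (he : e = 0 ∨ e = 1) (i : ℕ) : PD (n + 1) (fun t => (jn n e i).eval t) := by
  intro ι _ x hx w
  have hn' : (2:ℝ) ≤ n := by exact_mod_cast hn
  have hI : 0 < om n * Ic ((n:ℝ) / 2) ((n:ℝ) / 2 - 1 + e) i :=
    mul_pos (om_pos (by omega)) (Ic_pos (by linarith) (by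
      have : (0:ℝ) ≤ e := Nat.cast_nonneg e
      linarith) i)
  have h : om n * Ic ((n:ℝ) / 2) ((n:ℝ) / 2 - 1 + e) i * ∑ i', ∑ j, w i' * w j * (jn n e i).eval ⟪x i', x j⟫ =
      ∫ z, (∑ i', w i' * (jn n e i).eval ⟪x i', z⟫) ^ 2 ∂sig (n + 1) := by
    calc _ = ∑ i', ∑ j, ∫ z, w i' * w j * ((jn n e i).eval ⟪x i', z⟫ * (jn n e i).eval ⟪x j, z⟫) ∂sig (n + 1) := by
          rw [Finset.mul_sum]
          refine Finset.sum_congr rfl fun a _ => ?_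
          rw [Finset.mul_sum]
          refine Finset.sum_congr rfl fun b _ => ?_
          rw [integral_const_mul, conv_jn hn he i (hx a)]; ring
      _ = ∫ z, ∑ i', ∑ j, w i' * w j * ((jn n e i).eval ⟪x i', z⟫ * (jn n e i).eval ⟪x j, z⟫) ∂sig (n + 1) := by
          rw [integral_finsetSum]
          · refine Finset.sum_congr rfl fun a _ => ?_
            rw [integral_finsetSum]
            intro b _
            apply sig_integrable; fun_prop
          · intro a _
            apply sig_integrable; fun_prop
      _ = _ := by
          congr 1; ext z
          rw [sq, Finset.sum_mul_sum]
          refine Finset.sum_congr rfl fun a _ => Finset.sum_congr rfl fun b _ => ?_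
          ring
  have h2 : 0 ≤ ∫ z, (∑ i', w i' * (jn n e i).eval ⟪x i', z⟫) ^ 2 ∂sig (n + 1) :=
    integral_nonneg fun z => sq_nonneg _
  rw [← h] at h2
  exact nonneg_of_mul_nonneg_right h2 hI

/-- abstract lower bound -/
lemma lower_abs (hn : 2 ≤ n) {Q g : ℝ → ℝ} (hQ : Continuous Q) (hg : Continuous g) (hPD : PD (n + 1) g) {I a b ε w0 : ℝ}
    (hconv : ∀ x y : EE (n + 1), ‖x‖ = 1 → ‖y‖ = 1 → ∫ z, Q ⟪x, z⟫ * Q ⟪y, z⟫ ∂sig (n + 1) = om n * I * Q ⟪x, y⟫)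
    (ha : ∫ u, Q u * (g u + ε * g (-u)) ∂wm n = a) (hb : (1 + ε ^ 2) * g 1 + 2 * ε * g (-1) = b)
    (hw : ∫ _, (1:ℝ) ∂wm n = w0) (lam : ℝ)
    (ι : Type) [Fintype ι] (x : ι → EE (n + 1)) (hx : ∀ i, ‖x i‖ = 1) (w : ι → ℝ) :
    0 ≤ I * (∑ i, ∑ j, w i * w j * (Q ⟪x i, x j⟫ * g ⟪x i, x j⟫)) - 2 * lam * (∑ i, w i) * a + lam ^ 2 * b * w0 := by
  have hpt : ∀ z : EE (n + 1), ‖z‖ = 1 →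
      0 ≤ (∑ i, ∑ j, w i * w j * g ⟪x i, x j⟫ * (Q ⟪x i, z⟫ * Q ⟪x j, z⟫))
        - (∑ i, 2 * lam * w i * (Q ⟪x i, z⟫ * (g ⟪x i, z⟫ + ε * g (-⟪x i, z⟫)))) + lam ^ 2 * b := by
    intro z hz
    have h := hPD (ι ⊕ Bool) (Sum.elim x (fun t => if t then z else -z)) (by
      rintro (i | t)
      · exact hx i
      · cases t <;> simp [hz]) (Sum.elim (fun i => w i * Q ⟪x i, z⟫) (fun t => if t then -lam else -ε * lam))
    simp only [Fintype.sum_sum_type, Fintype.univ_bool, Finset.sum_add_distrib] at h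
    simp only [Sum.elim_inl, Sum.elim_inr, Finset.mem_singleton, Bool.true_eq_false, not_false_eq_true, Finset.sum_insert, Finset.sum_singleton, if_true, Bool.false_eq_true, if_false, inner_neg_left, inner_neg_right, neg_neg, real_inner_self_eq_norm_sq, hz] at h
    refine h.trans_eq ?_
    simp only [one_pow]
    rw [← hb]
    have e1 : ∀ i, ⟪z, x i⟫ = ⟪x i, z⟫ := fun i => real_inner_comm _ _
    simp only [e1]
    have e2 : ∑ i, ∑ j, w i * Q ⟪x i, z⟫ * (w j * Q ⟪x j, z⟫) * g ⟪x i, x j⟫ =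
      ∑ i, ∑ j, w i * w j * g ⟪x i, x j⟫ * (Q ⟪x i, z⟫ * Q ⟪x j, z⟫) :=
      Finset.sum_congr rfl fun a _ => Finset.sum_congr rfl fun b _ => by ring
    have e3 : ∑ i, 2 * lam * w i * (Q ⟪x i, z⟫ * (g ⟪x i, z⟫ + ε * g (-⟪x i, z⟫))) =
      -(∑ i, w i * Q ⟪x i, z⟫ * -lam * g ⟪x i, z⟫ + ∑ i, w i * Q ⟪x i, z⟫ * (-ε * lam) * g (-⟪x i, z⟫)
       + (∑ i, -lam * (w i * Q ⟪x i, z⟫) * g ⟪x i, z⟫ + ∑ i, -ε * lam * (w i * Q ⟪x i, z⟫) * g (-⟪x i, z⟫))) := by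
      rw [← Finset.sum_add_distrib, ← Finset.sum_add_distrib, ← Finset.sum_add_distrib, ← Finset.sum_neg_distrib]
      exact Finset.sum_congr rfl fun a _ => by ring
    rw [e2, e3]
    simp only [Finset.sum_add_distrib]
    ring
  have hInt0 : 0 ≤ ∫ z, ((∑ i, ∑ j, w i * w j * g ⟪x i, x j⟫ * (Q ⟪x i, z⟫ * Q ⟪x j, z⟫))
        - (∑ i, 2 * lam * w i * (Q ⟪x i, z⟫ * (g ⟪x i, z⟫ + ε * g (-⟪x i, z⟫)))) + lam ^ 2 * b) ∂sig (n + 1) := by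
    apply integral_nonneg_of_ae
    filter_upwards [sig_ae (n + 1)] with z hz using hpt z hz
  have c1 : Continuous fun z : EE (n + 1) => (∑ i, ∑ j, w i * w j * g ⟪x i, x j⟫ * (Q ⟪x i, z⟫ * Q ⟪x j, z⟫)) := by fun_prop
  have c2 : Continuous fun z : EE (n + 1) => (∑ i, 2 * lam * w i * (Q ⟪x i, z⟫ * (g ⟪x i, z⟫ + ε * g (-⟪x i, z⟫)))) := by fun_prop
  have hInt0 := hInt0.trans_eq (integral_add ((sig_integrable c1).sub (sig_integrable c2)) (sig_integrable continuous_const))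
  have hs := integral_sub (sig_integrable c1) (sig_integrable c2)
  try simp only [Pi.sub_apply] at hInt0 hs
  rw [hs, om_const, om_succ hn, hw] at hInt0
  have i1 : ∫ z, (∑ i, ∑ j, w i * w j * g ⟪x i, x j⟫ * (Q ⟪x i, z⟫ * Q ⟪x j, z⟫)) ∂sig (n + 1) =
      om n * (I * (∑ i, ∑ j, w i * w j * (Q ⟪x i, x j⟫ * g ⟪x i, x j⟫))) := by
    rw [integral_finsetSum _ (fun a _ => sig_integrable (by fun_prop)), ← mul_assoc, Finset.mul_sum]
    refine Finset.sum_congr rfl fun a _ => ?_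
    rw [integral_finsetSum _ (fun a _ => sig_integrable (by fun_prop)), Finset.mul_sum]
    refine Finset.sum_congr rfl fun b _ => ?_
    rw [integral_const_mul, hconv _ _ (hx a) (hx b)]; ring
  have i2 : ∫ z, (∑ i, 2 * lam * w i * (Q ⟪x i, z⟫ * (g ⟪x i, z⟫ + ε * g (-⟪x i, z⟫)))) ∂sig (n + 1) =
      om n * (2 * lam * (∑ i, w i) * a) := by
    rw [integral_finsetSum _ (fun a _ => sig_integrable (by fun_prop)), Finset.mul_sum, Finset.sum_mul, Finset.mul_sum]
    refine Finset.sum_congr rfl fun b _ => ?_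
    rw [integral_const_mul, zonal hn (g := fun u => Q u * (g u + ε * g (-u))) (by fun_prop) (hx b), ha]; ring
  rw [i1, i2] at hInt0
  have : 0 ≤ om n * (I * (∑ i, ∑ j, w i * w j * (Q ⟪x i, x j⟫ * g ⟪x i, x j⟫)) - 2 * lam * (∑ i, w i) * a + lam ^ 2 * b * w0) := by
    refine hInt0.trans_eq ?_; ring
  exact nonneg_of_mul_nonneg_right this (om_pos (by omega))

/-- Levenshtein's polynomial -/
def gg (n e d : ℕ) (t : ℝ) : ℝ :=
  (1 + t) ^ e * (t - maxRoot ((n:ℝ) / 2) ((n:ℝ) / 2 - 1 + e) d) * (qq ((n:ℝ) / 2) ((n:ℝ) / 2 - 1 + e) d).eval t ^ 2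

lemma gg_cont (n e d : ℕ) : Continuous (gg n e d) := by unfold gg; fun_prop

lemma gg_eq (hn : 2 ≤ n) {e d : ℕ} (hd : 1 ≤ d) (t : ℝ) :
    gg n e d t = (jn n e d).eval t * ((1 + t) ^ e * (qq ((n:ℝ) / 2) ((n:ℝ) / 2 - 1 + e) d).eval t) := by
  have hn' : (2:ℝ) ≤ n := by exact_mod_cast hn
  have he : (0:ℝ) ≤ e := Nat.cast_nonneg e
  have := qq_mul (A := (n:ℝ) / 2) (β := (n:ℝ) / 2 - 1 + e) (by linarith) (by linarith) hd
  have h := congrArg (eval t) this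
  simp only [eval_mul, eval_sub, eval_X, eval_C] at h
  rw [gg, jn, h]; ring

lemma key_lower (hn : 2 ≤ n) {e : ℕ} (he : e = 0 ∨ e = 1) {d : ℕ} (hd : 1 ≤ d)
    (ι : Type) [Fintype ι] (x : ι → EE (n + 1)) (hx : ∀ i, ‖x i‖ = 1) (w : ι → ℝ) :
    Ic ((n:ℝ) / 2) ((n:ℝ) / 2 - 1 + e) d * (qq ((n:ℝ) / 2) ((n:ℝ) / 2 - 1 + e) d).eval 1 * (∑ i, w i) ^ 2 ≤
      (∫ _, (1:ℝ) ∂wm n) * ∑ i, ∑ j, w i * w j * gg n e d ⟪x i, x j⟫ := by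
  have hn' : (2:ℝ) ≤ n := by exact_mod_cast hn
  have he0 : (0:ℝ) ≤ e := Nat.cast_nonneg e
  have hA : (1:ℝ) ≤ (n:ℝ) / 2 := by linarith
  have hβ : (0:ℝ) ≤ (n:ℝ) / 2 - 1 + e := by linarith
  have hw0 : 0 < ∫ _, (1:ℝ) ∂wm n := by
    have h1 := om_succ hn
    have h2 := om_pos (n := n) (by omega)
    have h3 := om_pos (n := n + 1) (by omega)
    rw [h1] at h3
    exact pos_of_mul_pos_right h3 h2.le
  have hI := Ic_pos hA hβ d
  have hq1 := qq_at_pos hA hβ hd (maxRoot_mem hA hβ hd).2.le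
  have hqd : (qq ((n:ℝ) / 2) ((n:ℝ) / 2 - 1 + e) d).natDegree ≤ d := by
    rw [qq_natDegree hA hβ]; omega
  obtain ⟨c, hc, hqe⟩ := qq_expand hA hβ hd
  have hPq : PD (n + 1) (fun t => (qq ((n:ℝ) / 2) ((n:ℝ) / 2 - 1 + e) d).eval t) := by
    rw [hqe]
    simp only [eval_finsetSum, eval_mul, eval_C]
    exact PD.sum hc fun i _ => PD_jn hn he i
  have hrep := repro hA hβ hqd
  simp only [gg_eq hn hd]
  generalize hw0e : ∫ _, (1:ℝ) ∂wm n = w0 at *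
  generalize hIe : Ic ((n:ℝ) / 2) ((n:ℝ) / 2 - 1 + e) d = I at *
  generalize hqq : qq ((n:ℝ) / 2) ((n:ℝ) / 2 - 1 + e) d = q at *
  have main : ∃ ε : ℝ, (∫ u, (jn n e d).eval u * ((1 + u) ^ e * q.eval u + ε * ((1 + -u) ^ e * q.eval (-u))) ∂wm n = (1 + e) * (I * q.eval 1)) ∧
     ((1 + ε ^ 2) * ((1 + 1) ^ e * q.eval 1) + 2 * ε * ((1 + -1) ^ e * q.eval (-1)) = (1 + e) ^ 2 * q.eval 1) ∧
     PD (n + 1) (fun t => (1 + t) ^ e * q.eval t) := by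
    rcases he with rfl | rfl
    · refine ⟨0, ?_, by simp, by simpa using hPq⟩
      have := wm_L (n := n) (jn n 0 d * q)
      simp only [jn, Nat.cast_zero, add_zero, eval_mul] at this hrep ⊢
      rw [← hrep, ← this]
      simp
    · refine ⟨(-1) ^ d, ?_, ?_, by simpa using (PD_one_add _).mul hPq⟩
      · have hj : ∀ u, (jn n 1 d).eval (-u) = (-1) ^ d * (jn n 1 d).eval u := by
          intro u
          have := congrArg (eval u) (jp_parity ((n:ℝ) / 2) d)
          simpa [jn] using this
        have h1 := wm_L (n := n) (jn n 1 d * ((1 + X) * q))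
        have h1' := wm_L (n := n) ((jn n 1 d * ((1 + X) * q)).comp (-X))
        have h2 : L ((n:ℝ) / 2 - 1) ((n:ℝ) / 2 - 1) (jn n 1 d * ((1 + X) * q)) = I * q.eval 1 := by
          rw [← hrep]
          apply L_congr
          intro t ht
          have := wt_shift (a := (n:ℝ) / 2 - 1) (b := (n:ℝ) / 2 - 1) (by linarith) (by linarith) 0 1 ht
          simp only [Nat.cast_zero, add_zero, Nat.cast_one, pow_zero, pow_one, mul_one] at this
          simp only [Nat.cast_one, this, jn, eval_mul, eval_add, eval_one, eval_X]
          ring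
        have h3 : L ((n:ℝ) / 2 - 1) ((n:ℝ) / 2 - 1) ((jn n 1 d * ((1 + X) * q)).comp (-X)) = I * q.eval 1 := by
          rw [← h2]
          unfold L
          have h0 := intervalIntegral.integral_comp_neg (a := -1) (b := 1) (fun t => (jn n 1 d * ((1 + X) * q)).eval t * wt ((n:ℝ) / 2 - 1) ((n:ℝ) / 2 - 1) t)
          rw [neg_neg] at h0
          rw [← h0]
          congr 1; ext t
          have h2 : wt ((n:ℝ) / 2 - 1) ((n:ℝ) / 2 - 1) (-t) = wt ((n:ℝ) / 2 - 1) ((n:ℝ) / 2 - 1) t := by unfold wt; rw [mul_comm]; congr 2 <;> ring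
          rw [h2]; simp
        rw [h2] at h1
        rw [h3] at h1'
        have h4 := integral_add (wm_integrable hn (jn n 1 d * ((1 + X) * q)).continuous) (wm_integrable hn ((jn n 1 d * ((1 + X) * q)).comp (-X)).continuous)
        rw [h1, h1'] at h4
        trans (I * eval 1 q + I * eval 1 q)
        · rw [← h4]
          congr 1; ext u
          simp only [eval_comp, eval_mul, eval_add, eval_one, eval_X, eval_neg, hj, pow_one]
          ring
        · simp; ring
      · have : ((-1:ℝ) ^ d) ^ 2 = 1 := by rw [← pow_mul, mul_comm, pow_mul]; simp
        rw [this]; simp; ring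
  obtain ⟨ε, h1, h2, h3⟩ := main
  have fin := lower_abs hn (Q := fun t => (jn n e d).eval t) (g := fun t => (1 + t) ^ e * q.eval t) (by fun_prop) (by fun_prop) h3 (I := I)
    (by intro x y hx hy; rw [← hIe]; exact conv_jn hn he d hx y) h1 h2 hw0e ((∑ i, w i) * I / ((1 + e) * w0)) ι x hx w
  generalize ∑ i, ∑ j, w i * w j * (eval ⟪x i, x j⟫ (jn n e d) * ((1 + ⟪x i, x j⟫) ^ e * eval ⟪x i, x j⟫ q)) = S at *
  generalize ∑ i, w i = W at *
  have h5 : I * S - 2 * (W * I / ((1 + e) * w0)) * W * ((1 + e) * (I * q.eval 1)) + (W * I / ((1 + e) * w0)) ^ 2 * ((1 + e) ^ 2 * q.eval 1) * w0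
    = I / w0 * (w0 * S - I * q.eval 1 * W ^ 2) := by
    have : (1:ℝ) + e ≠ 0 := by positivity
    field_simp; ring
  rw [h5] at fin
  have := nonneg_of_mul_nonneg_right fin (div_pos hI hw0)
  linarith

end SCB
end

noncomputable section
namespace SCB
open Set Polynomial

lemma w0_eq {n : ℕ} (hn : 2 ≤ n) : ∫ _, (1:ℝ) ∂wm n = 2 ^ ((n:ℝ) - 1) * Gamma ((n:ℝ) / 2) ^ 2 / Gamma n := by
  have hn' : (2:ℝ) ≤ n := by exact_mod_cast hn
  have h := wm_L (n := n) 1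
  simp only [eval_one, L, one_mul] at h
  rw [h, wt_int (by linarith) (by linarith)]
  rw [show (n:ℝ) / 2 - 1 + ((n:ℝ) / 2 - 1) + 1 = n - 1 by ring, show (n:ℝ) / 2 - 1 + ((n:ℝ) / 2 - 1) + 2 = n by ring,
    show (n:ℝ) / 2 - 1 + 1 = n / 2 by ring]
  ring

lemma w0_pos {n : ℕ} (hn : 2 ≤ n) : 0 < ∫ _, (1:ℝ) ∂wm n := by
  have h1 := om_succ hn
  have h2 := om_pos (n := n) (by omega)
  have h3 := om_pos (n := n + 1) (by omega)
  rw [h1] at h3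
  exact pos_of_mul_pos_right h3 h2.le

lemma lev_val {n d : ℕ} (hn : 2 ≤ n) (hd : 1 ≤ d) :
    2 * (jn n 1 d).eval 1 * (∫ _, (1:ℝ) ∂wm n) = 2 * ((n + d).choose n : ℝ) * Ic ((n:ℝ) / 2) ((n:ℝ) / 2 - 1 + 1) d ∧
    (jn n 0 d).eval 1 * (∫ _, (1:ℝ) ∂wm n) = (((n + d).choose n : ℝ) + ((n + d - 1).choose n : ℝ)) * Ic ((n:ℝ) / 2) ((n:ℝ) / 2 - 1 + 0) d := by
  have hn' : (2:ℝ) ≤ n := by exact_mod_cast hn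
  have hd' : (0:ℝ) ≤ d := Nat.cast_nonneg d
  rw [w0_eq hn, jn, jn, jp_one, jp_one, genBinom_gamma (by rw [add_sub_cancel_left]; positivity), add_sub_cancel_left]
  obtain ⟨k, rfl⟩ : ∃ k, n = k + 2 := ⟨n - 2, by omega⟩
  obtain ⟨j, rfl⟩ : ∃ j, d = j + 1 := ⟨d - 1, by omega⟩
  have g1 : Gamma ((k + 2 : ℕ) : ℝ) = ((k + 1).factorial : ℝ) := by
    rw [← Gamma_nat_eq_factorial]; push_cast; ring_nf
  have hB := Gamma_add_one (s := (((k + 2 : ℕ):ℝ)) / 2) (by positivity)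
  have hBp := Gamma_pos_of_pos (s := (((k + 2 : ℕ):ℝ)) / 2) (by positivity)
  have hDp := Gamma_pos_of_pos (s := ((j + 1 : ℕ):ℝ) + (((k + 2 : ℕ):ℝ)) / 2) (by positivity)
  have hD := Gamma_add_one (s := ((j + 1 : ℕ):ℝ) + (((k + 2 : ℕ):ℝ)) / 2) (by positivity)
  have c1 : ((k + 2 + (j + 1)).choose (k + 2) : ℝ) = ((k + j + 3).factorial : ℝ) / ((k + 2).factorial * (j + 1).factorial) := by
    rw [Nat.cast_choose ℝ (by omega)]
    rw [show k + 2 + (j + 1) - (k + 2) = j + 1 by omega, show k + 2 + (j + 1) = k + j + 3 by omega]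
  have c2 : ((k + 2 + (j + 1) - 1).choose (k + 2) : ℝ) = ((k + j + 2).factorial : ℝ) / ((k + 2).factorial * j.factorial) := by
    rw [Nat.cast_choose ℝ (by omega)]
    rw [show k + 2 + (j + 1) - 1 - (k + 2) = j by omega, show k + 2 + (j + 1) - 1 = k + j + 2 by omega]
  have hkf : ((k + 2).factorial : ℝ) = (k + 2) * (k + 1).factorial := by
    rw [Nat.factorial_succ]; push_cast; ring
  have hjf : ((j + 1).factorial : ℝ) = (j + 1) * j.factorial := by
    rw [Nat.factorial_succ]; push_cast; ring
  have hkjf : ((k + j + 3).factorial : ℝ) = (k + j + 3) * (k + j + 2).factorial := by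
    rw [Nat.factorial_succ]; push_cast; ring
  have p1 : ((k + 1).factorial : ℝ) ≠ 0 := by positivity
  have p2 : ((k + j + 2).factorial : ℝ) ≠ 0 := by positivity
  have p3 : (j.factorial : ℝ) ≠ 0 := by positivity
  have t1 : (2:ℝ) ^ ((((k + 2 : ℕ):ℝ)) - 1 + 1) = 2 * 2 ^ ((((k + 2 : ℕ):ℝ)) - 1) := by
    rw [rpow_add (by norm_num)]; simp; ring
  have t0 : (0:ℝ) < 2 ^ ((((k + 2 : ℕ):ℝ)) - 1) := by positivity
  constructor
  · unfold Ic
    rw [show (((k + 2 : ℕ):ℝ)) / 2 + ((((k + 2 : ℕ):ℝ)) / 2 - 1 + 1) = ((k + 2 : ℕ):ℝ) - 1 + 1 by ring, t1]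
    rw [show ((j + 1 : ℕ):ℝ) + ((((k + 2 : ℕ):ℝ)) / 2 - 1 + 1) + 1 = ((j + 1 : ℕ):ℝ) + (((k + 2 : ℕ):ℝ)) / 2 + 1 by ring, hD, hB, g1]
    have g2 : Gamma (((k + 2 : ℕ) : ℝ) - 1 + 1 + ((j + 1 : ℕ):ℝ) + 1) = ((k + j + 3).factorial : ℝ) := by
      rw [← Gamma_nat_eq_factorial]; push_cast; ring_nf
    rw [g2, c1, hkf, hjf, hkjf]
    push_cast at *
    generalize Gamma (((k:ℝ) + 2) / 2) = G at *
    generalize Gamma ((j:ℝ) + 1 + ((k:ℝ) + 2) / 2) = H at *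
    generalize (2:ℝ) ^ ((k:ℝ) + 2 - 1) = T at *
    have : ((j:ℝ) + 1 + ((k:ℝ) + 2) / 2) ≠ 0 := by positivity
    field_simp
  · unfold Ic
    rw [show (((k + 2 : ℕ):ℝ)) / 2 + ((((k + 2 : ℕ):ℝ)) / 2 - 1 + 0) = ((k + 2 : ℕ):ℝ) - 1 by ring]
    rw [show ((j + 1 : ℕ):ℝ) + ((((k + 2 : ℕ):ℝ)) / 2 - 1 + 0) + 1 = ((j + 1 : ℕ):ℝ) + (((k + 2 : ℕ):ℝ)) / 2 by ring, hD, hB, g1]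
    have g2 : Gamma (((k + 2 : ℕ) : ℝ) - 1 + ((j + 1 : ℕ):ℝ) + 1) = ((k + j + 2).factorial : ℝ) := by
      rw [← Gamma_nat_eq_factorial]; push_cast; ring_nf
    rw [g2, c1, c2, hkf, hjf, hkjf]
    push_cast at *
    generalize Gamma (((k:ℝ) + 2) / 2) = G at *
    generalize Gamma ((j:ℝ) + 1 + ((k:ℝ) + 2) / 2) = H at *
    generalize (2:ℝ) ^ ((k:ℝ) + 2 - 1) = T at *
    field_simp
    ring

/-- Summary of the polynomial part -/
theorem lev_summary {n : ℕ} (hn : 2 ≤ n) {θ' : ℝ} (h0 : 0 ≤ Real.cos θ') (h1 : Real.cos θ' < 1) :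
    ∃ e d : ℕ, (e = 0 ∨ e = 1) ∧ 1 ≤ d ∧ Real.cos θ' ≤ maxRoot ((n:ℝ) / 2) ((n:ℝ) / 2 - 1 + e) d ∧
      0 < MLev (n + 1) θ' ∧ 0 < gg n e d 1 ∧
      ∀ (ι : Type) [Fintype ι] (x : ι → EE (n + 1)), (∀ i, ‖x i‖ = 1) → ∀ w : ι → ℝ,
        gg n e d 1 * (∑ i, w i) ^ 2 ≤ MLev (n + 1) θ' * ∑ i, ∑ j, w i * w j * gg n e d ⟪x i, x j⟫ := by
  have hn' : (2:ℝ) ≤ n := by exact_mod_cast hn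
  have hA : (1:ℝ) ≤ (n:ℝ) / 2 := by linarith
  have hset : {d : ℕ | 1 ≤ d ∧ Real.cos θ' ≤ maxRoot ((((n + 1 : ℕ) : ℝ) - 3) / 2 + 1) ((((n + 1 : ℕ) : ℝ) - 3) / 2 + 1) d}.Nonempty := by
    obtain ⟨d, hd⟩ := exists_large_root (A := (((n + 1 : ℕ) : ℝ) - 3) / 2 + 1) (by push_cast; linarith) h0 h1
    exact ⟨d, hd⟩
  have hmem := Nat.sInf_mem hset
  rw [← levD.eq_def] at hmem
  obtain ⟨hd, hle⟩ := hmem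
  have r1 : (((n + 1 : ℕ) : ℝ) - 3) / 2 + 1 = (n:ℝ) / 2 := by push_cast; ring
  have r2 : (((n + 1 : ℕ) : ℝ) - 3) / 2 = (n:ℝ) / 2 - 1 := by push_cast; ring
  have hM := MLev.eq_def (n + 1) θ'
  rw [r1, r2] at hM
  rw [r1] at hle
  generalize levD (n + 1) θ' = d at *
  have hv := lev_val hn hd
  rw [show d + (n + 1) - 1 = n + d by omega, show d + (n + 1) - 2 = n + d - 1 by omega, show n + 1 - 1 = n by omega] at hM
  have main : ∃ e : ℕ, (e = 0 ∨ e = 1) ∧ Real.cos θ' ≤ maxRoot ((n:ℝ) / 2) ((n:ℝ) / 2 - 1 + e) d ∧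
    2 ^ e * (jn n e d).eval 1 * (∫ _, (1:ℝ) ∂wm n) = MLev (n + 1) θ' * Ic ((n:ℝ) / 2) ((n:ℝ) / 2 - 1 + e) d := by
    split_ifs at hM with hc
    · refine ⟨1, Or.inr rfl, ?_, ?_⟩
      · simpa using hle
      · rw [hM, pow_one, hv.1]; simp
    · refine ⟨0, Or.inl rfl, ?_, ?_⟩
      · simpa using hc
      · rw [hM, pow_zero, one_mul, hv.2]; simp
  obtain ⟨e, he, hroot, hval⟩ := main
  have he0 : (0:ℝ) ≤ e := Nat.cast_nonneg e
  have hβ : (0:ℝ) ≤ (n:ℝ) / 2 - 1 + e := by linarith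
  have hI := Ic_pos hA hβ d
  have hq1 := qq_at_pos hA hβ hd (maxRoot_mem hA hβ hd).2.le
  have hQ1 : 0 < (jn n e d).eval 1 := jp_one_pos hA d
  have hw := w0_pos hn
  have hMpos : 0 < MLev (n + 1) θ' := by
    have : 0 < MLev (n + 1) θ' * Ic ((n:ℝ) / 2) ((n:ℝ) / 2 - 1 + e) d := by rw [← hval]; positivity
    exact pos_of_mul_pos_left this hI.le
  have hg1 : gg n e d 1 = 2 ^ e * (jn n e d).eval 1 * (qq ((n:ℝ) / 2) ((n:ℝ) / 2 - 1 + e) d).eval 1 := by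
    rw [gg_eq hn hd]; norm_num; ring
  refine ⟨e, d, he, hd, hroot, hMpos, by rw [hg1]; positivity, ?_⟩
  intro ι _ x hx w
  have key := key_lower hn he hd ι x hx w
  generalize ∑ i, ∑ j, w i * w j * gg n e d ⟪x i, x j⟫ = S at *
  rw [hg1]
  have : 0 < (∫ _, (1:ℝ) ∂wm n) := hw
  refine le_of_mul_le_mul_left ?_ this
  have k2 := mul_le_mul_of_nonneg_left key hMpos.le
  calc _ = (2 ^ e * (jn n e d).eval 1 * (∫ _, (1:ℝ) ∂wm n)) * (qq ((n:ℝ) / 2) ((n:ℝ) / 2 - 1 + e) d).eval 1 * (∑ i, w i) ^ 2 := by ring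
    _ = MLev (n + 1) θ' * (Ic ((n:ℝ) / 2) ((n:ℝ) / 2 - 1 + e) d * (qq ((n:ℝ) / 2) ((n:ℝ) / 2 - 1 + e) d).eval 1 * (∑ i, w i) ^ 2) := by rw [hval]; ring
    _ ≤ _ := k2
    _ = _ := by ring

end SCB
end

noncomputable section
namespace SCB
open Set

/-- clipping to `[-1,1]` -/
def clip (x : ℝ) : ℝ := max (-1) (min x 1)
/-- regularised `√(1-v²)` -/
def DD (c v : ℝ) : ℝ := max (√(1 - v ^ 2)) c
/-- relative inner product -/
def Tau (c t u u' : ℝ) : ℝ := clip ((t - u * u') / (DD c u * DD c u'))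

lemma clip_mem (x : ℝ) : clip x ∈ Icc (-1:ℝ) 1 := by
  unfold clip; exact ⟨le_max_left _ _, max_le (by norm_num) (min_le_right _ _)⟩

lemma clip_of_mem {x : ℝ} (h : x ∈ Icc (-1:ℝ) 1) : clip x = x := by
  unfold clip; rw [min_eq_left h.2, max_eq_right h.1]

lemma Tau_mem (c t u u' : ℝ) : Tau c t u u' ∈ Icc (-1:ℝ) 1 := clip_mem _

lemma DD_pos {c : ℝ} (hc : 0 < c) (v : ℝ) : 0 < DD c v := lt_max_of_lt_right hc

lemma Tau_cont {c : ℝ} (hc : 0 < c) : Continuous fun p : ℝ × ℝ × ℝ => Tau c p.1 p.2.1 p.2.2 := by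
  unfold Tau clip
  have h1 : Continuous fun v => DD c v := by unfold DD; fun_prop
  have : Continuous fun p : ℝ × ℝ × ℝ => (p.1 - p.2.1 * p.2.2) / (DD c p.2.1 * DD c p.2.2) := by
    apply Continuous.div (by fun_prop) (by fun_prop)
    intro p; exact (mul_pos (DD_pos hc _) (DD_pos hc _)).ne'
  fun_prop

lemma Tau_eq {c t u u' τ : ℝ} (hc : 0 < c) (hu : c ≤ √(1 - u ^ 2)) (hu' : c ≤ √(1 - u' ^ 2))
    (ht : t = u * u' + √(1 - u ^ 2) * √(1 - u' ^ 2) * τ) (hτ : τ ∈ Icc (-1:ℝ) 1) : Tau c t u u' = τ := by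
  unfold Tau DD
  rw [max_eq_left hu, max_eq_left hu']
  have : (t - u * u') / (√(1 - u ^ 2) * √(1 - u' ^ 2)) = τ := by
    have h1 := hc.trans_le hu
    have h2 := hc.trans_le hu'
    rw [div_eq_iff (by positivity), ht]; ring
  rw [this, clip_of_mem hτ]

lemma proj_family {k : ℕ} {ι : Type} (e : EE (k + 2)) (he : ‖e‖ = 1) (x : ι → EE (k + 2)) (hx : ∀ i, ‖x i‖ = 1) :
    ∃ a : ι → EE (k + 1), (∀ i, ‖a i‖ = 1) ∧ ∀ i j, ⟪x i, x j⟫ = ⟪e, x i⟫ * ⟪e, x j⟫ +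
      √(1 - ⟪e, x i⟫ ^ 2) * √(1 - ⟪e, x j⟫ ^ 2) * ⟪a i, a j⟫ := by
  obtain ⟨L, hL⟩ := trans_one he (e0_norm (k + 1))
  have h1 : ∀ i, ∃ a : EE (k + 1), ‖a‖ = 1 ∧ L (x i) = consE ⟪e, x i⟫ (√(1 - ⟪e, x i⟫ ^ 2) • a) := by
    intro i
    obtain ⟨t, η, h⟩ := exists_consE (L (x i))
    have ht : ⟪e, x i⟫ = t := by rw [← L.inner_map_map, hL, h, e0, consE_inner]; simp
    have hn : t ^ 2 + ‖η‖ ^ 2 = 1 := by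
      rw [← consE_norm_sq, ← h, L.norm_map, hx]; norm_num
    have hη : √(1 - t ^ 2) = ‖η‖ := by
      rw [show 1 - t ^ 2 = ‖η‖ ^ 2 by linarith, Real.sqrt_sq (norm_nonneg _)]
    rw [ht, hη, h]
    by_cases h0 : η = 0
    · exact ⟨e0 k, e0_norm k, by rw [h0]; simp⟩
    · refine ⟨‖η‖⁻¹ • η, ?_, ?_⟩
      · rw [norm_smul, norm_inv, norm_norm, inv_mul_cancel₀ (norm_ne_zero_iff.2 h0)]
      · rw [smul_smul, mul_inv_cancel₀ (norm_ne_zero_iff.2 h0), one_smul]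
  choose a ha hae using h1
  refine ⟨a, ha, fun i j => ?_⟩
  rw [← L.inner_map_map (x i) (x j), hae i, hae j, consE_inner, real_inner_smul_left, real_inner_smul_right]
  ring

lemma biax {k : ℕ} (hk : 2 ≤ k) {P : ℝ → ℝ → ℝ} (hP : Continuous fun p : ℝ × ℝ => P p.1 p.2)
    {a b : EE (k + 2)} (ha : ‖a‖ = 1) (hb : ‖b‖ = 1) :
    ∫ z, P ⟪a, z⟫ ⟪b, z⟫ ∂sig (k + 2) = om k * ∫ v, (∫ w, P v (⟪a, b⟫ * v + √(1 - ⟪a, b⟫ ^ 2) * √(1 - v ^ 2) * w) ∂wm k) ∂wm (k + 1) := by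
  set τ := ⟪a, b⟫ with hτ
  have hτ1 : |τ| ≤ 1 := by
    have := abs_real_inner_le_norm a b
    rwa [ha, hb, one_mul] at this
  have hτ2 : 0 ≤ 1 - τ ^ 2 := by
    have := sq_le_one_iff_abs_le_one τ |>.2 hτ1; linarith
  obtain ⟨L, h1, h2⟩ := trans_pair (x' := e0 (k + 1)) (y' := consE τ (√(1 - τ ^ 2) • e0 k)) ha hb (e0_norm _)
    (by
      rw [← sq_eq_sq₀ (norm_nonneg _) (by norm_num), consE_norm_sq, norm_smul, e0_norm, mul_one, Real.norm_eq_abs, sq_abs, Real.sq_sqrt hτ2]; ring)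
    (by rw [e0, consE_inner]; simp [hτ])
  have hc : Continuous fun z : EE (k + 2) => P ⟪e0 (k + 1), z⟫ ⟪consE τ (√(1 - τ ^ 2) • e0 k), z⟫ :=
    hP.comp (by fun_prop : Continuous fun z : EE (k + 2) => (⟪e0 (k + 1), z⟫, ⟪consE τ (√(1 - τ ^ 2) • e0 k), z⟫))
  calc _ = ∫ z, P ⟪e0 (k + 1), z⟫ ⟪consE τ (√(1 - τ ^ 2) • e0 k), z⟫ ∂sig (k + 2) := by
        rw [← sig_inv_int L (fun z => P ⟪e0 (k + 1), z⟫ ⟪consE τ (√(1 - τ ^ 2) • e0 k), z⟫)]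
        congr 1; ext z
        rw [← h1, ← h2, L.inner_map_map, L.inner_map_map]
    _ = _ := by
        rw [slice_int (by omega) hc, ← integral_const_mul]
        congr 1; ext v
        have : ∀ ζ : EE (k + 1), P ⟪e0 (k + 1), TT (k + 1) (v, ζ)⟫ ⟪consE τ (√(1 - τ ^ 2) • e0 k), TT (k + 1) (v, ζ)⟫ =
            P v (τ * v + √(1 - τ ^ 2) * √(1 - v ^ 2) * ⟪e0 k, ζ⟫) := by
          intro ζ
          rw [TT, e0, consE_inner, consE_inner, real_inner_smul_left]
          congr 1
          · simp
          · rw [real_inner_smul_right]; ring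
        simp only [this]
        refine zonal hk (g := fun w => P v (τ * v + √(1 - τ ^ 2) * √(1 - v ^ 2) * w)) ?_ (e0_norm k)
        exact hP.comp (by fun_prop : Continuous fun w => (v, τ * v + √(1 - τ ^ 2) * √(1 - v ^ 2) * w))

end SCB
end

noncomputable section
namespace SCB
open Set

variable {n : ℕ}

/-- pair kernel -/
def Psi (F : ℝ → ℝ → ℝ) (g : ℝ → ℝ) (c u u' τ v v' : ℝ) : ℝ := F u v * F u' v' * g (Tau c τ v v')

/-- inner average -/
def K2 (n : ℕ) (F : ℝ → ℝ → ℝ) (g : ℝ → ℝ) (c u u' τ : ℝ) : ℝ :=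
  ∫ v, (∫ w, Psi F g c u u' τ v (τ * v + √(1 - τ ^ 2) * √(1 - v ^ 2) * w) ∂wm n) ∂wm (n + 1)

/-- full average as a function of the inner product -/
def K4 (n : ℕ) (F : ℝ → ℝ → ℝ) (g : ℝ → ℝ) (c t : ℝ) : ℝ :=
  ∫ u, (∫ z, K2 n F g c u (t * u + √(1 - t ^ 2) * √(1 - u ^ 2) * z)
    (Tau c t u (t * u + √(1 - t ^ 2) * √(1 - u ^ 2) * z)) ∂wm (n + 1)) ∂wm (n + 2)

/-- standing assumptions on the cutoff -/
structure Cut (F : ℝ → ℝ → ℝ) (c : ℝ) : Prop where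
  cpos : 0 < c
  cont : Continuous fun p : ℝ × ℝ => F p.1 p.2
  nonneg : ∀ u v, 0 ≤ F u v
  le_one : ∀ u v, F u v ≤ 1
  supp : ∀ u v, F u v ≠ 0 → c ≤ √(1 - u ^ 2) ∧ c ≤ √(1 - v ^ 2)

lemma bdd_g {g : ℝ → ℝ} (hg : Continuous g) : ∃ B, 0 ≤ B ∧ ∀ c τ v v', |g (Tau c τ v v')| ≤ B := by
  obtain ⟨C, hC⟩ := (isCompact_Icc (a := (-1:ℝ)) (b := 1)).exists_bound_of_continuousOn hg.continuousOn
  refine ⟨C, (norm_nonneg _).trans (hC 0 (by norm_num)), fun c τ v v' => hC _ (Tau_mem _ _ _ _)⟩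

variable {F : ℝ → ℝ → ℝ} {g : ℝ → ℝ} {c : ℝ}

lemma Psi_bdd (hF : Cut F c) {B : ℝ} (hB : 0 ≤ B) (h : ∀ c τ v v', |g (Tau c τ v v')| ≤ B) (u u' τ v v' : ℝ) :
    ‖Psi F g c u u' τ v v'‖ ≤ B := by
  rw [Psi, Real.norm_eq_abs, abs_mul, abs_mul, abs_of_nonneg (hF.nonneg _ _), abs_of_nonneg (hF.nonneg _ _)]
  have := mul_le_one₀ (hF.le_one u v) (hF.nonneg u' v') (hF.le_one u' v')
  calc _ ≤ 1 * B := mul_le_mul this (h _ _ _ _) (abs_nonneg _) (by norm_num)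
    _ = B := one_mul B

lemma Psi_cont (hF : Cut F c) (hg : Continuous g) :
    Continuous fun p : ℝ × ℝ × ℝ × ℝ × ℝ => Psi F g c p.1 p.2.1 p.2.2.1 p.2.2.2.1 p.2.2.2.2 := by
  unfold Psi
  have h1 := hF.cont.comp (by fun_prop : Continuous fun p : ℝ × ℝ × ℝ × ℝ × ℝ => (p.1, p.2.2.2.1))
  have h2 := hF.cont.comp (by fun_prop : Continuous fun p : ℝ × ℝ × ℝ × ℝ × ℝ => (p.2.1, p.2.2.2.2))
  have h3 := hg.comp ((Tau_cont hF.cpos).comp (by fun_prop : Continuous fun p : ℝ × ℝ × ℝ × ℝ × ℝ => (p.2.2.1, p.2.2.2.1, p.2.2.2.2)))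
  exact (h1.mul h2).mul h3

lemma K2_cont (hn : 2 ≤ n) (hF : Cut F c) (hg : Continuous g) :
    Continuous fun p : ℝ × ℝ × ℝ => K2 n F g c p.1 p.2.1 p.2.2 := by
  obtain ⟨B, hB, hBg⟩ := bdd_g hg
  have := wm_fin hn
  have := wm_fin (n := n + 1) (by omega)
  have hc := Psi_cont hF hg
  have h1 : Continuous fun q : (ℝ × ℝ × ℝ) × ℝ => ∫ w, Psi F g c q.1.1 q.1.2.1 q.1.2.2 q.2
      (q.1.2.2 * q.2 + √(1 - q.1.2.2 ^ 2) * √(1 - q.2 ^ 2) * w) ∂wm n := by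
    refine continuous_of_dominated (bound := fun _ => B) ?_ ?_ (integrable_const _) ?_
    · intro q
      refine Continuous.aestronglyMeasurable ?_
      exact hc.comp (by fun_prop : Continuous fun w => (q.1.1, q.1.2.1, q.1.2.2, q.2, (q.1.2.2 * q.2 + √(1 - q.1.2.2 ^ 2) * √(1 - q.2 ^ 2) * w)))
    · intro q; exact Eventually.of_forall fun w => Psi_bdd hF hB hBg _ _ _ _ _
    · refine Eventually.of_forall fun w => ?_
      exact hc.comp (by fun_prop : Continuous fun q : (ℝ × ℝ × ℝ) × ℝ => (q.1.1, q.1.2.1, q.1.2.2, q.2, (q.1.2.2 * q.2 + √(1 - q.1.2.2 ^ 2) * √(1 - q.2 ^ 2) * w)))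
  unfold K2
  refine continuous_of_dominated (bound := fun _ => B * (wm n).real univ) ?_ ?_ (integrable_const _) ?_
  · intro p
    exact (h1.comp (by fun_prop : Continuous fun v : ℝ => (p, v))).aestronglyMeasurable
  · intro p
    refine Eventually.of_forall fun v => ?_
    exact norm_integral_le_of_norm_le_const (Eventually.of_forall fun w => Psi_bdd hF hB hBg _ _ _ _ _)
  · refine Eventually.of_forall fun v => ?_
    exact h1.comp (by fun_prop : Continuous fun p : ℝ × ℝ × ℝ => (p, v))

/-- first step: average over the second vector of the frame -/
lemma step_f (hn : 2 ≤ n) (hF : Cut F c) (hg : Continuous g) {a b : EE (n + 2)} (ha : ‖a‖ = 1) (hb : ‖b‖ = 1) {u u' τ : ℝ}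
    (h : c ≤ √(1 - u ^ 2) → c ≤ √(1 - u' ^ 2) → τ = ⟪a, b⟫) :
    ∫ z, Psi F g c u u' τ ⟪a, z⟫ ⟪b, z⟫ ∂sig (n + 2) = om n * K2 n F g c u u' τ := by
  by_cases h0 : c ≤ √(1 - u ^ 2) ∧ c ≤ √(1 - u' ^ 2)
  · have hτ := h h0.1 h0.2
    have := biax hn (P := fun v v' => Psi F g c u u' τ v v')
      ((Psi_cont hF hg).comp (by fun_prop : Continuous fun p : ℝ × ℝ => (u, u', τ, p.1, p.2))) ha hb
    rw [this, K2, hτ]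
  · have : ∀ τ v v', Psi F g c u u' τ v v' = 0 := by
      intro τ v v'
      unfold Psi
      by_contra hne
      have h1 : F u v ≠ 0 := fun h => hne (by rw [h]; simp)
      have h2 : F u' v' ≠ 0 := fun h => hne (by rw [h]; simp)
      exact h0 ⟨(hF.supp _ _ h1).1, (hF.supp _ _ h2).1⟩
    simp [K2, this]

/-- one-variable average -/
def F1 (n : ℕ) (F : ℝ → ℝ → ℝ) (u : ℝ) : ℝ := ∫ v, F u v ∂wm (n + 1)

lemma F1_cont (hn : 2 ≤ n) (hF : Cut F c) : Continuous (F1 n F) := by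
  have := wm_fin (n := n + 1) (by omega)
  unfold F1
  refine continuous_of_dominated (bound := fun _ => 1) ?_ ?_ (integrable_const _) ?_
  · intro u
    exact (hF.cont.comp (by fun_prop : Continuous fun v : ℝ => (u, v))).aestronglyMeasurable
  · intro u
    refine Eventually.of_forall fun v => ?_
    rw [Real.norm_eq_abs, abs_of_nonneg (hF.nonneg _ _)]; exact hF.le_one _ _
  · refine Eventually.of_forall fun v => ?_
    exact hF.cont.comp (by fun_prop : Continuous fun u : ℝ => (u, v))

lemma inner_abs_le {k : ℕ} {a b : EE k} (ha : ‖a‖ = 1) (hb : ‖b‖ = 1) : ⟪a, b⟫ ∈ Icc (-1:ℝ) 1 := by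
  have := abs_real_inner_le_norm a b
  rw [ha, hb, one_mul] at this
  exact abs_le.1 this

/-- pointwise inequality for a frame `e, f` -/
lemma point_ineq (hF : Cut F c) {M : ℝ} (hM : 0 ≤ M) (hg1 : 0 ≤ g 1)
    {ι : Type} [Fintype ι] [DecidableEq ι]
    (hlow : ∀ (x : ι → EE (n + 1)), (∀ i, ‖x i‖ = 1) → ∀ w : ι → ℝ,
      g 1 * (∑ i, w i) ^ 2 ≤ M * ∑ i, ∑ j, w i * w j * g ⟪x i, x j⟫)
    (μ : ℝ) (a : ι → EE (n + 2)) (ha : ∀ i, ‖a i‖ = 1) (u : ι → ℝ) (T : ι → ι → ℝ)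
    (hT : ∀ i j, c ≤ √(1 - u i ^ 2) → c ≤ √(1 - u j ^ 2) → T i j = ⟪a i, a j⟫) (f : EE (n + 2)) (hf : ‖f‖ = 1) :
    g 1 * (2 * μ * (∑ i, F (u i) ⟪a i, f⟫) - μ ^ 2) ≤
      M * (g 1 * (∑ i, F (u i) ⟪a i, f⟫) + ∑ i, ∑ j, if i = j then 0 else Psi F g c (u i) (u j) (T i j) ⟪a i, f⟫ ⟪a j, f⟫) := by
  obtain ⟨b, hb, hbi⟩ := proj_family f hf a ha
  have hc : ∀ i, ⟪f, a i⟫ = ⟪a i, f⟫ := fun i => real_inner_comm _ _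
  simp only [hc] at hbi
  have h1 := hlow b hb (fun i => F (u i) ⟪a i, f⟫)
  have h2 : 2 * μ * (∑ i, F (u i) ⟪a i, f⟫) - μ ^ 2 ≤ (∑ i, F (u i) ⟪a i, f⟫) ^ 2 := by
    nlinarith [sq_nonneg ((∑ i, F (u i) ⟪a i, f⟫) - μ)]
  refine (mul_le_mul_of_nonneg_left h2 hg1).trans (h1.trans (mul_le_mul_of_nonneg_left ?_ hM))
  rw [Finset.mul_sum, ← Finset.sum_add_distrib]
  refine Finset.sum_le_sum fun i _ => ?_
  have h3 : g 1 * F (u i) ⟪a i, f⟫ = ∑ j, if i = j then g 1 * F (u i) ⟪a i, f⟫ else 0 := by simp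
  rw [h3, ← Finset.sum_add_distrib]
  refine Finset.sum_le_sum fun j _ => ?_
  split_ifs with hij
  · subst hij
    rw [real_inner_self_eq_norm_sq, hb, add_zero, one_pow]
    have := hF.nonneg (u i) ⟪a i, f⟫
    have := hF.le_one (u i) ⟪a i, f⟫
    nlinarith [mul_nonneg hg1 (hF.nonneg (u i) ⟪a i, f⟫)]
  · rw [zero_add, Psi]
    by_cases hi : F (u i) ⟪a i, f⟫ = 0
    · rw [hi]; simp
    by_cases hj : F (u j) ⟪a j, f⟫ = 0
    · rw [hj]; simp
    have si := hF.supp _ _ hi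
    have sj := hF.supp _ _ hj
    rw [hT i j si.1 sj.1, Tau_eq hF.cpos si.2 sj.2 ?_ (inner_abs_le (hb i) (hb j))]
    exact hbi i j

/-- main inequality -/
lemma main_ineq (hn : 2 ≤ n) (hF : Cut F c) (hg : Continuous g) {M t0 : ℝ} (hM : 0 ≤ M) (hg1 : 0 < g 1)
    (hlow : ∀ (ι : Type) [Fintype ι] (x : ι → EE (n + 1)), (∀ i, ‖x i‖ = 1) → ∀ w : ι → ℝ,
      g 1 * (∑ i, w i) ^ 2 ≤ M * ∑ i, ∑ j, w i * w j * g ⟪x i, x j⟫)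
    (hK : ∀ t ∈ Icc (-1) t0, K4 n F g c t ≤ 0)
    {ι : Type} [Fintype ι] (x : ι → EE (n + 3)) (hx : ∀ i, ‖x i‖ = 1) (hxy : ∀ i j, i ≠ j → ⟪x i, x j⟫ ≤ t0) :
    (Fintype.card ι : ℝ) * (∫ u, F1 n F u ∂wm (n + 2)) ≤ M * ((∫ _, (1:ℝ) ∂wm (n + 1)) * (∫ _, (1:ℝ) ∂wm (n + 2))) := by
  classical
  have hF1 := F1_cont hn hF
  have hK2 := K2_cont hn hF hg
  have hPc := Psi_cont hF hg
  have key : ∀ μ : ℝ, ∀ e : EE (n + 3), ‖e‖ = 1 →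
      g 1 * (2 * μ * (∑ i, om (n + 1) * F1 n F ⟪x i, e⟫) - om (n + 2) * μ ^ 2) ≤
      M * (g 1 * (∑ i, om (n + 1) * F1 n F ⟪x i, e⟫) + ∑ i, ∑ j, if i = j then 0 else
        om n * K2 n F g c ⟪x i, e⟫ ⟪x j, e⟫ (Tau c ⟪x i, x j⟫ ⟪x i, e⟫ ⟪x j, e⟫)) := by
    intro μ e he
    obtain ⟨a, ha, hai⟩ := proj_family e he x hx
    have hc : ∀ i, ⟪e, x i⟫ = ⟪x i, e⟫ := fun i => real_inner_comm _ _
    simp only [hc] at hai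
    have hT : ∀ i j, c ≤ √(1 - ⟪x i, e⟫ ^ 2) → c ≤ √(1 - ⟪x j, e⟫ ^ 2) →
        Tau c ⟪x i, x j⟫ ⟪x i, e⟫ ⟪x j, e⟫ = ⟪a i, a j⟫ := by
      intro i j h1 h2
      exact Tau_eq hF.cpos h1 h2 (hai i j) (inner_abs_le (ha i) (ha j))
    generalize hu : (fun i => ⟪x i, e⟫) = u at *
    have hu' : ∀ i, ⟪x i, e⟫ = u i := fun i => congrFun hu i
    simp only [hu'] at hT ⊢
    generalize hTT : (fun i j => Tau c ⟪x i, x j⟫ (u i) (u j)) = T at *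
    have hTT' : ∀ i j, Tau c ⟪x i, x j⟫ (u i) (u j) = T i j := fun i j => congrFun (congrFun hTT i) j
    simp only [hTT'] at hT ⊢
    have hp := point_ineq hF hM hg1.le (hlow ι) μ a ha u T hT
    have cF : ∀ i, Continuous fun f : EE (n + 2) => F (u i) ⟪a i, f⟫ := fun i =>
      hF.cont.comp (by fun_prop : Continuous fun f : EE (n + 2) => (u i, ⟪a i, f⟫))
    have cP : ∀ i j, Continuous fun f : EE (n + 2) => if i = j then 0 else Psi F g c (u i) (u j) (T i j) ⟪a i, f⟫ ⟪a j, f⟫ := by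
      intro i j
      split_ifs
      · exact continuous_const
      · exact hPc.comp (by fun_prop : Continuous fun f : EE (n + 2) => (u i, u j, T i j, ⟪a i, f⟫, ⟪a j, f⟫))
    have cS : Continuous fun f : EE (n + 2) => ∑ i, F (u i) ⟪a i, f⟫ := continuous_finsetSum _ fun i _ => cF i
    have cSS : Continuous fun f : EE (n + 2) => ∑ i, ∑ j, if i = j then 0 else Psi F g c (u i) (u j) (T i j) ⟪a i, f⟫ ⟪a j, f⟫ :=
      continuous_finsetSum _ fun i _ => continuous_finsetSum _ fun j _ => cP i j
    have hI := integral_mono_ae (μ := sig (n + 2)) (f := fun f => g 1 * (2 * μ * (∑ i, F (u i) ⟪a i, f⟫) - μ ^ 2))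
      (g := fun f => M * (g 1 * (∑ i, F (u i) ⟪a i, f⟫) + ∑ i, ∑ j, if i = j then 0 else Psi F g c (u i) (u j) (T i j) ⟪a i, f⟫ ⟪a j, f⟫))
      (sig_integrable (by fun_prop)) (sig_integrable (by fun_prop)) (by
        filter_upwards [sig_ae (n + 2)] with f hf using hp f hf)
    rw [integral_const_mul, integral_const_mul, integral_sub (sig_integrable (by fun_prop)) (sig_integrable (by fun_prop)),
      integral_add (sig_integrable (by fun_prop)) (sig_integrable cSS), integral_const_mul, integral_const_mul, om_const] at hI
    have i1 : ∫ f, ∑ i, F (u i) ⟪a i, f⟫ ∂sig (n + 2) = ∑ i, om (n + 1) * F1 n F (u i) := by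
      rw [integral_finsetSum _ fun i _ => sig_integrable (cF i)]
      refine Finset.sum_congr rfl fun i _ => ?_
      exact zonal (n := n + 1) (by omega) (g := fun v => F (u i) v)
        (hF.cont.comp (by fun_prop : Continuous fun v : ℝ => (u i, v))) (ha i)
    have i2 : ∫ f, (∑ i, ∑ j, if i = j then 0 else Psi F g c (u i) (u j) (T i j) ⟪a i, f⟫ ⟪a j, f⟫) ∂sig (n + 2) =
        ∑ i, ∑ j, if i = j then 0 else om n * K2 n F g c (u i) (u j) (T i j) := by
      rw [integral_finsetSum _ fun i _ => sig_integrable (continuous_finsetSum _ fun j _ => cP i j)]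
      refine Finset.sum_congr rfl fun i _ => ?_
      rw [integral_finsetSum _ fun j _ => sig_integrable (cP i j)]
      refine Finset.sum_congr rfl fun j _ => ?_
      split_ifs
      · simp
      · exact step_f hn hF hg (ha i) (ha j) (hT i j)
    rw [i1, i2] at hI
    exact hI
  have fin : ∀ μ : ℝ, g 1 * (2 * μ * (Fintype.card ι * (om (n + 1) * om (n + 2) * ∫ u, F1 n F u ∂wm (n + 2))) - om (n + 3) * (om (n + 2) * μ ^ 2)) ≤
      M * (g 1 * (Fintype.card ι * (om (n + 1) * om (n + 2) * ∫ u, F1 n F u ∂wm (n + 2)))) := by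
    intro μ
    have cF : ∀ i, Continuous fun e : EE (n + 3) => om (n + 1) * F1 n F ⟪x i, e⟫ := fun i => by fun_prop
    have cP : ∀ i j, Continuous fun e : EE (n + 3) => if i = j then 0 else
        om n * K2 n F g c ⟪x i, e⟫ ⟪x j, e⟫ (Tau c ⟪x i, x j⟫ ⟪x i, e⟫ ⟪x j, e⟫) := by
      intro i j
      split_ifs
      · exact continuous_const
      · refine continuous_const.mul ?_
        have h1 : Continuous fun e : EE (n + 3) => Tau c ⟪x i, x j⟫ ⟪x i, e⟫ ⟪x j, e⟫ :=
          (Tau_cont hF.cpos).comp (by fun_prop : Continuous fun e : EE (n + 3) => (⟪x i, x j⟫, ⟪x i, e⟫, ⟪x j, e⟫))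
        exact hK2.comp (by fun_prop : Continuous fun e : EE (n + 3) => (⟪x i, e⟫, ⟪x j, e⟫, Tau c ⟪x i, x j⟫ ⟪x i, e⟫ ⟪x j, e⟫))
    have cS : Continuous fun e : EE (n + 3) => ∑ i, om (n + 1) * F1 n F ⟪x i, e⟫ := continuous_finsetSum _ fun i _ => cF i
    have cSS : Continuous fun e : EE (n + 3) => ∑ i, ∑ j, if i = j then 0 else
        om n * K2 n F g c ⟪x i, e⟫ ⟪x j, e⟫ (Tau c ⟪x i, x j⟫ ⟪x i, e⟫ ⟪x j, e⟫) :=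
      continuous_finsetSum _ fun i _ => continuous_finsetSum _ fun j _ => cP i j
    have hI := integral_mono_ae (μ := sig (n + 3)) (f := fun e => g 1 * (2 * μ * (∑ i, om (n + 1) * F1 n F ⟪x i, e⟫) - om (n + 2) * μ ^ 2))
      (g := fun e => M * (g 1 * (∑ i, om (n + 1) * F1 n F ⟪x i, e⟫) + ∑ i, ∑ j, if i = j then 0 else
        om n * K2 n F g c ⟪x i, e⟫ ⟪x j, e⟫ (Tau c ⟪x i, x j⟫ ⟪x i, e⟫ ⟪x j, e⟫)))
      (sig_integrable (by fun_prop)) (sig_integrable (by fun_prop)) (by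
        filter_upwards [sig_ae (n + 3)] with e he using key μ e he)
    rw [integral_const_mul, integral_const_mul, integral_sub (sig_integrable (by fun_prop)) (sig_integrable (by fun_prop)),
      integral_add (sig_integrable (by fun_prop)) (sig_integrable cSS), integral_const_mul, integral_const_mul, om_const] at hI
    have i1 : ∫ e, ∑ i, om (n + 1) * F1 n F ⟪x i, e⟫ ∂sig (n + 3) =
        Fintype.card ι * (om (n + 1) * om (n + 2) * ∫ u, F1 n F u ∂wm (n + 2)) := by
      rw [integral_finsetSum _ fun i _ => sig_integrable (cF i)]
      have : ∀ i, ∫ e, om (n + 1) * F1 n F ⟪x i, e⟫ ∂sig (n + 3) = om (n + 1) * om (n + 2) * ∫ u, F1 n F u ∂wm (n + 2) := by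
        intro i
        rw [integral_const_mul, zonal (n := n + 2) (by omega) hF1 (hx i)]; ring
      simp [this]
    have i2 : ∫ e, (∑ i, ∑ j, if i = j then 0 else
        om n * K2 n F g c ⟪x i, e⟫ ⟪x j, e⟫ (Tau c ⟪x i, x j⟫ ⟪x i, e⟫ ⟪x j, e⟫)) ∂sig (n + 3) ≤ 0 := by
      rw [integral_finsetSum _ fun i _ => sig_integrable (continuous_finsetSum _ fun j _ => cP i j)]
      refine Finset.sum_nonpos fun i _ => ?_
      rw [integral_finsetSum _ fun j _ => sig_integrable (cP i j)]
      refine Finset.sum_nonpos fun j _ => ?_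
      split_ifs with hij
      · simp
      · rw [integral_const_mul]
        refine mul_nonpos_of_nonneg_of_nonpos (om_pos (by omega)).le ?_
        have h1 : Continuous fun p : ℝ × ℝ => Tau c ⟪x i, x j⟫ p.1 p.2 :=
          (Tau_cont hF.cpos).comp (by fun_prop : Continuous fun p : ℝ × ℝ => (⟪x i, x j⟫, p.1, p.2))
        rw [biax (k := n + 1) (by omega) (P := fun u u' => K2 n F g c u u' (Tau c ⟪x i, x j⟫ u u'))
          (hK2.comp (by fun_prop : Continuous fun p : ℝ × ℝ => (p.1, p.2, Tau c ⟪x i, x j⟫ p.1 p.2))) (hx i) (hx j)]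
        refine mul_nonpos_of_nonneg_of_nonpos (om_pos (by omega)).le ?_
        exact hK _ ⟨(inner_abs_le (hx i) (hx j)).1, hxy i j hij⟩
    rw [mul_left_comm (om (n + 2)) (om (n + 3)) (μ ^ 2), integral_const_mul, i1] at hI
    refine hI.trans (mul_le_mul_of_nonneg_left ?_ hM)
    linarith
  have o1 := om_succ (n := n + 1) (by omega)
  have o2 := om_succ (n := n + 2) (by omega)
  have p1 := om_pos (n := n + 1) (by omega)
  have p2 := om_pos (n := n + 2) (by omega)
  have w1 := w0_pos (n := n + 1) (by omega)
  have w2 := w0_pos (n := n + 2) (by omega)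
  rw [show n + 1 + 1 = n + 2 by ring] at o1
  rw [show n + 2 + 1 = n + 3 by ring] at o2
  generalize (∫ _, (1:ℝ) ∂wm (n + 1)) = W1 at *
  generalize (∫ _, (1:ℝ) ∂wm (n + 2)) = W2 at *
  have hI0 : 0 ≤ ∫ u, F1 n F u ∂wm (n + 2) := integral_nonneg fun u => integral_nonneg fun v => hF.nonneg _ _
  generalize ∫ u, F1 n F u ∂wm (n + 2) = I at *
  generalize (Fintype.card ι : ℝ) = N at *
  have h := fin (N * I / (W1 * W2))
  rw [o2] at h
  have o1' : om (n + 2) * W2 * (om (n + 2) * (N * I / (W1 * W2)) ^ 2) = om (n + 1) * om (n + 2) * (W1 * W2) * (N * I / (W1 * W2)) ^ 2 := by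
    nth_rw 2 [o1]; ring
  rw [o1'] at h
  have h' : (g 1 * (om (n + 1) * om (n + 2))) * ((N * I) ^ 2 / (W1 * W2)) ≤ (g 1 * (om (n + 1) * om (n + 2))) * (M * (N * I)) := by
    calc _ = g 1 * (2 * (N * I / (W1 * W2)) * (N * (om (n + 1) * om (n + 2) * I)) - om (n + 1) * om (n + 2) * (W1 * W2) * (N * I / (W1 * W2)) ^ 2) := by
          field_simp; ring
      _ ≤ _ := h
      _ = _ := by ring
  have h2 := le_of_mul_le_mul_left h' (by positivity)
  rw [div_le_iff₀ (by positivity)] at h2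
  by_contra! hcon
  have h3 : 0 < N * I := lt_of_le_of_lt (by positivity) hcon
  nlinarith

end SCB
end

noncomputable section
namespace SCB
open Set

/-- Gram determinant -/
def Gr (t u u' : ℝ) : ℝ := (1 - u ^ 2) * (1 - u' ^ 2) - (t - u * u') ^ 2

lemma cov1 {n : ℕ} {t u : ℝ} (ht : t ∈ Ioo (-1:ℝ) 1) (hu : u ∈ Ioo (-1:ℝ) 1) (P : ℝ → ℝ)
    (hP : ∀ u', P u' ≠ 0 → 0 < Gr t u u') :
    ∫ z, P (t * u + √(1 - t ^ 2) * √(1 - u ^ 2) * z) ∂wm n =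
      ((1 - t ^ 2) * (1 - u ^ 2)) ^ (-(((n:ℝ) - 1) / 2)) * ∫ u', Gr t u u' ^ (((n:ℝ) - 2) / 2) * P u' := by
  have h1 : 0 < 1 - t ^ 2 := by nlinarith [ht.1, ht.2]
  have h2 : 0 < 1 - u ^ 2 := by nlinarith [hu.1, hu.2]
  set B := (1 - t ^ 2) * (1 - u ^ 2) with hB
  have hB0 : 0 < B := mul_pos h1 h2
  set b := √(1 - t ^ 2) * √(1 - u ^ 2) with hb
  have hb0 : 0 < b := by positivity
  have hbB : b ^ 2 = B := by rw [hb, mul_pow, Real.sq_sqrt h1.le, Real.sq_sqrt h2.le]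
  have hG : ∀ z, Gr t u (t * u + b * z) = B * (1 - z ^ 2) := by
    intro z
    have : Gr t u (t * u + b * z) = B - b ^ 2 * z ^ 2 := by unfold Gr; rw [hB]; ring
    rw [this, hbB]; ring
  rw [wm_integral]
  rw [setIntegral_eq_integral_of_forall_compl_eq_zero]
  · have e1 : ∀ z : ℝ, (1 - z ^ 2) ^ (((n:ℝ) - 2) / 2) * P (t * u + b * z) =
        B ^ (-(((n:ℝ) - 2) / 2)) * (fun x => Gr t u (t * u + x) ^ (((n:ℝ) - 2) / 2) * P (t * u + x)) (b * z) := by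
      intro z
      simp only
      by_cases h0 : P (t * u + b * z) = 0
      · rw [h0]; simp
      have hp := hP _ h0
      rw [hG] at hp ⊢
      have hz : 0 ≤ 1 - z ^ 2 := by
        by_contra! h; nlinarith
      rw [Real.mul_rpow hB0.le hz, ← mul_assoc, ← mul_assoc, ← Real.rpow_add hB0]
      simp
    rw [integral_congr_ae (Eventually.of_forall e1)]
    rw [integral_const_mul, Measure.integral_comp_mul_left (fun x => Gr t u (t * u + x) ^ (((n:ℝ) - 2) / 2) * P (t * u + x)) b]
    rw [integral_add_left_eq_self (μ := volume) (fun x => Gr t u x ^ (((n:ℝ) - 2) / 2) * P x) (t * u)]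
    rw [smul_eq_mul, ← mul_assoc]
    congr 1
    rw [abs_of_pos (inv_pos.2 hb0)]
    have : b⁻¹ = B ^ (-(1/2:ℝ)) := by
      rw [Real.rpow_neg hB0.le, ← Real.sqrt_eq_rpow, ← hbB, Real.sqrt_sq hb0.le]
    rw [this, ← Real.rpow_add hB0]
    congr 1; ring
  · intro z hz
    by_cases h0 : P (t * u + b * z) = 0
    · rw [h0]; simp
    exfalso
    have hp := hP _ h0
    rw [hG] at hp
    have hz2 : 0 < 1 - z ^ 2 := by
      by_contra! h; nlinarith
    apply hz
    constructor <;> nlinarith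

variable {n : ℕ} {F : ℝ → ℝ → ℝ} {g : ℝ → ℝ} {c t : ℝ}

/-- transformed integrand -/
def Theta (n : ℕ) (F : ℝ → ℝ → ℝ) (Q : ℝ → ℝ → ℝ → ℝ → ℝ) (c u u' v v' : ℝ) : ℝ :=
  F u v * F u' v' * ((DD c u * DD c u') ^ (n - 1) * (DD c v * DD c v') ^ (n - 2) * Q u u' v v')

/-- the test function against the transformed weight -/
def QT (n : ℕ) (g : ℝ → ℝ) (c t u u' v v' : ℝ) : ℝ :=
  (1 - Tau c (Tau c t u u') v v' ^ 2) ^ (((n:ℝ) - 2) / 2) * g (Tau c (Tau c t u u') v v')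

/-- nondegeneracy -/
def Nondeg (F : ℝ → ℝ → ℝ) (t : ℝ) : Prop :=
  ∀ u v u' v', F u v ≠ 0 → F u' v' ≠ 0 → ∃ τ1 ∈ Ioo (-1:ℝ) 1, ∃ τ2 ∈ Ioo (-1:ℝ) 1,
    t = u * u' + √(1 - u ^ 2) * √(1 - u' ^ 2) * τ1 ∧ τ1 = v * v' + √(1 - v ^ 2) * √(1 - v' ^ 2) * τ2

lemma sq_of_le_sqrt {c u : ℝ} (hc : 0 < c) (h : c ≤ √(1 - u ^ 2)) : 0 < 1 - u ^ 2 ∧ u ∈ Ioo (-1:ℝ) 1 := by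
  have : 0 < 1 - u ^ 2 := Real.sqrt_pos.1 (hc.trans_le h)
  exact ⟨this, by constructor <;> nlinarith⟩

lemma Gr_eq {c t u u' τ : ℝ} (hc : 0 < c) (h : c ≤ √(1 - u ^ 2)) (h' : c ≤ √(1 - u' ^ 2))
    (ht : t = u * u' + √(1 - u ^ 2) * √(1 - u' ^ 2) * τ) :
    Gr t u u' = (1 - u ^ 2) * (1 - u' ^ 2) * (1 - τ ^ 2) := by
  have h1 := (sq_of_le_sqrt hc h).1
  have h2 := (sq_of_le_sqrt hc h').1
  unfold Gr
  rw [ht, add_sub_cancel_left, mul_pow, mul_pow, Real.sq_sqrt h1.le, Real.sq_sqrt h2.le]; ring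

lemma DD_pow {c u u' : ℝ} (hc : 0 < c) (h : c ≤ √(1 - u ^ 2)) (h' : c ≤ √(1 - u' ^ 2)) (k : ℕ) :
    ((1 - u ^ 2) * (1 - u' ^ 2)) ^ ((k:ℝ) / 2) = (DD c u * DD c u') ^ k := by
  have h1 := (sq_of_le_sqrt hc h).1
  have h2 := (sq_of_le_sqrt hc h').1
  rw [DD, DD, max_eq_left h, max_eq_left h', ← Real.sqrt_mul h1.le, Real.sqrt_eq_rpow, ← Real.rpow_natCast _ k, ← Real.rpow_mul (by positivity)]
  congr 1; ring

lemma K2_formula (hn : 2 ≤ n) (hF : Cut F c) {u u' : ℝ} (hN : Nondeg F t)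
    (hex : ∃ v v', F u v ≠ 0 ∧ F u' v' ≠ 0) :
    K2 n F g c u u' (Tau c t u u') = (1 - Tau c t u u' ^ 2) ^ (-(((n:ℝ) - 1) / 2)) *
      ∫ v, ∫ v', F u v * F u' v' * ((DD c v * DD c v') ^ (n - 2) * QT n g c t u u' v v') := by
  obtain ⟨v0, v0', h0, h0'⟩ := hex
  obtain ⟨τ1, hτ1, -, -, ht, -⟩ := hN u v0 u' v0' h0 h0'
  have hT : Tau c t u u' = τ1 := Tau_eq hF.cpos (hF.supp _ _ h0).1 (hF.supp _ _ h0').1 ht (Ioo_subset_Icc_self hτ1)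
  unfold QT
  rw [hT]
  unfold K2
  rw [wm_integral, ← integral_const_mul]
  have h1 : 0 < 1 - τ1 ^ 2 := by nlinarith [hτ1.1, hτ1.2]
  have hz : ∀ v, F u v = 0 → ∀ v', Psi F g c u u' τ1 v v' = 0 := by
    intro v h v'; rw [Psi, h]; ring
  rw [← setIntegral_eq_integral_of_forall_compl_eq_zero (s := Ioo (-1:ℝ) 1) (f := fun v => (1 - τ1 ^ 2) ^ (-(((n:ℝ) - 1) / 2)) *
      ∫ v', F u v * F u' v' * ((DD c v * DD c v') ^ (n - 2) * ((1 - Tau c τ1 v v' ^ 2) ^ (((n:ℝ) - 2) / 2) * g (Tau c τ1 v v'))))]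
  · apply setIntegral_congr_fun measurableSet_Ioo
    intro v hv
    simp only
    by_cases hv0 : F u v = 0
    · simp [hz v hv0, hv0]
    have key : ∀ v', F u' v' ≠ 0 → ∃ τ2 ∈ Ioo (-1:ℝ) 1, τ1 = v * v' + √(1 - v ^ 2) * √(1 - v' ^ 2) * τ2 := by
      intro v' hv'
      obtain ⟨a, ha, b, hb, e1, e2⟩ := hN u v u' v' hv0 hv'
      have : a = τ1 := by rw [← hT]; exact (Tau_eq hF.cpos (hF.supp _ _ h0).1 (hF.supp _ _ h0').1 e1 (Ioo_subset_Icc_self ha)).symm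
      exact ⟨b, hb, this ▸ e2⟩
    have hsv := (hF.supp _ _ hv0).2
    have hv2 := (sq_of_le_sqrt hF.cpos hsv).1
    rw [cov1 (n := n) hτ1 hv (fun v' => Psi F g c u u' τ1 v v')]
    · rw [Real.mul_rpow h1.le hv2.le, ← mul_assoc, mul_comm ((1 - v ^ 2) ^ _), mul_assoc ((1 - τ1 ^ 2) ^ _), ← Real.rpow_add hv2]
      have ez : ((n + 1 : ℕ) - 2 : ℝ) / 2 + -(((n:ℝ) - 1) / 2) = 0 := by push_cast; ring
      rw [add_comm] at ez
      rw [ez, Real.rpow_zero, mul_one]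
      congr 1
      apply integral_congr_ae
      refine Eventually.of_forall fun v' => ?_
      simp only [Psi]
      by_cases hv' : F u' v' = 0
      · rw [hv']; ring
      obtain ⟨τ2, h2, e⟩ := key v' hv'
      have hsv' := (hF.supp _ _ hv').2
      have := (sq_of_le_sqrt hF.cpos hsv').1
      have : 0 < 1 - τ2 ^ 2 := by nlinarith [h2.1, h2.2]
      rw [Gr_eq hF.cpos hsv hsv' e, Tau_eq hF.cpos hsv hsv' e (Ioo_subset_Icc_self h2), Real.mul_rpow (by positivity) this.le,
        ← DD_pow hF.cpos hsv hsv']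
      push_cast [hn]
      ring
    · intro v' h
      have hv' : F u' v' ≠ 0 := by rintro h'; exact h (by rw [Psi, h']; ring)
      obtain ⟨τ2, h2, e⟩ := key v' hv'
      have hsv' := (hF.supp _ _ hv').2
      have := (sq_of_le_sqrt hF.cpos hsv').1
      have : 0 < 1 - τ2 ^ 2 := by nlinarith [h2.1, h2.2]
      rw [Gr_eq hF.cpos hsv hsv' e]; positivity
  · intro v hv
    have : F u v = 0 := by
      by_contra h; exact hv (sq_of_le_sqrt hF.cpos (hF.supp _ _ h).2).2
    simp [this]

lemma K4_formula (hn : 2 ≤ n) (hF : Cut F c) (hN : Nondeg F t) (ht : t ∈ Ioo (-1:ℝ) 1) :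
    K4 n F g c t = (1 - t ^ 2) ^ (-((n:ℝ) / 2)) * ∫ u, ∫ u', ∫ v, ∫ v', Theta n F (QT n g c t) c u u' v v' := by
  unfold K4
  have h1 : 0 < 1 - t ^ 2 := by nlinarith [ht.1, ht.2]
  rw [wm_integral, ← integral_const_mul]
  rw [← setIntegral_eq_integral_of_forall_compl_eq_zero (s := Ioo (-1:ℝ) 1) (f := fun u => (1 - t ^ 2) ^ (-((n:ℝ) / 2)) * ∫ u', ∫ v, ∫ v', Theta n F (QT n g c t) c u u' v v')]
  · apply setIntegral_congr_fun measurableSet_Ioo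
    intro u hu
    simp only
    have hz : ∀ u', (¬ ∃ v v', F u v ≠ 0 ∧ F u' v' ≠ 0) → K2 n F g c u u' (Tau c t u u') = 0 := by
      intro u' h
      unfold K2 Psi
      have : ∀ v v', F u v * F u' v' = 0 := by
        intro v v'; by_contra h'; exact h ⟨v, v', left_ne_zero_of_mul h', right_ne_zero_of_mul h'⟩
      simp [this]
    have hu2 : 0 < 1 - u ^ 2 := by nlinarith [hu.1, hu.2]
    rw [cov1 (n := n + 1) ht hu (fun u' => K2 n F g c u u' (Tau c t u u'))]
    · rw [Real.mul_rpow h1.le hu2.le, ← mul_assoc, mul_comm ((1 - u ^ 2) ^ _), mul_assoc ((1 - t ^ 2) ^ _), ← Real.rpow_add hu2]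
      have ez : -(((n + 1 : ℕ) - 1 : ℝ) / 2) + ((n + 2 : ℕ) - 2 : ℝ) / 2 = 0 := by push_cast; ring
      have ez2 : -(((n + 1 : ℕ) - 1 : ℝ) / 2) = -((n:ℝ) / 2) := by push_cast; ring
      rw [ez, Real.rpow_zero, mul_one, ez2]
      congr 1
      apply integral_congr_ae
      refine Eventually.of_forall fun u' => ?_
      simp only
      by_cases hex : ∃ v v', F u v ≠ 0 ∧ F u' v' ≠ 0
      · rw [K2_formula hn hF hN hex, ← mul_assoc]
        obtain ⟨v0, v0', h0, h0'⟩ := hex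
        obtain ⟨τ1, hτ1, -, -, ht, -⟩ := hN u v0 u' v0' h0 h0'
        have hs := (hF.supp _ _ h0).1
        have hs' := (hF.supp _ _ h0').1
        have p1 := (sq_of_le_sqrt hF.cpos hs).1
        have p2 := (sq_of_le_sqrt hF.cpos hs').1
        have p3 : 0 < 1 - τ1 ^ 2 := by nlinarith [hτ1.1, hτ1.2]
        have : Gr t u u' ^ (((n + 1 : ℕ) - 2 : ℝ) / 2) * (1 - Tau c t u u' ^ 2) ^ (-(((n:ℝ) - 1) / 2)) = (DD c u * DD c u') ^ (n - 1) := by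
          rw [Gr_eq hF.cpos hs hs' ht, Tau_eq hF.cpos hs hs' ht (Ioo_subset_Icc_self hτ1), Real.mul_rpow (by positivity) p3.le,
            mul_assoc, ← Real.rpow_add p3, ← DD_pow hF.cpos hs hs']
          have : ((n + 1 : ℕ) - 2 : ℝ) / 2 + -(((n:ℝ) - 1) / 2) = 0 := by push_cast; ring
          rw [this, Real.rpow_zero, mul_one]
          congr 1
          rw [Nat.cast_sub (by omega)]; push_cast; ring
        rw [this, ← integral_const_mul]
        apply integral_congr_ae
        refine Eventually.of_forall fun v => ?_
        simp only
        rw [← integral_const_mul]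
        apply integral_congr_ae
        refine Eventually.of_forall fun v' => ?_
        simp only [Theta]; ring
      · rw [hz u' hex]
        have : ∀ v v', F u v * F u' v' = 0 := by
          intro v v'; by_contra h'; exact hex ⟨v, v', left_ne_zero_of_mul h', right_ne_zero_of_mul h'⟩
        simp [Theta, this]
    · intro u' h
      have hex : ∃ v v', F u v ≠ 0 ∧ F u' v' ≠ 0 := by
        by_contra h'; exact h (hz u' h')
      obtain ⟨v0, v0', h0, h0'⟩ := hex
      obtain ⟨τ1, hτ1, -, -, ht, -⟩ := hN u v0 u' v0' h0 h0'
      have hs := (hF.supp _ _ h0).1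
      have hs' := (hF.supp _ _ h0').1
      have p1 := (sq_of_le_sqrt hF.cpos hs).1
      have p2 := (sq_of_le_sqrt hF.cpos hs').1
      have p3 : 0 < 1 - τ1 ^ 2 := by nlinarith [hτ1.1, hτ1.2]
      rw [Gr_eq hF.cpos hs hs' ht]; positivity
  · intro u hu
    have : ∀ v, F u v = 0 := by
      intro v
      by_contra h; exact hu (sq_of_le_sqrt hF.cpos (hF.supp _ _ h).1).2
    simp [this, Theta]

end SCB
end

noncomputable section
namespace SCB
open Set Topology

lemma subst1 (f : ℝ → ℝ) {a : ℝ} (ha : 0 < a) (r : ℝ) : ∫ u, f u = a * ∫ x, f (r + a * x) := by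
  rw [Measure.integral_comp_mul_left (fun x => f (r + x)) a, integral_add_left_eq_self (μ := volume) f r,
    abs_of_pos (inv_pos.2 ha), smul_eq_mul, ← mul_assoc, mul_inv_cancel₀ ha.ne', one_mul]

lemma subst4 (Θ : ℝ → ℝ → ℝ → ℝ → ℝ) {a b : ℝ} (ha : 0 < a) (hb : 0 < b) (r : ℝ) :
    ∫ u, ∫ u', ∫ v, ∫ v', Θ u u' v v' =
      (a * a * (b * b)) * ∫ x, ∫ x', ∫ z, ∫ z', Θ (r + a * x) (r + a * x') (b * z) (b * z') := by
  have h1 : ∀ f : ℝ → ℝ → ℝ, ∫ v, ∫ v', f v v' = (b * b) * ∫ z, ∫ z', f (b * z) (b * z') := by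
    intro f
    rw [subst1 _ hb 0, mul_assoc]
    congr 1
    rw [← integral_const_mul]
    apply integral_congr_ae
    refine Eventually.of_forall fun z => ?_
    simp only
    rw [subst1 _ hb 0]; simp
  rw [subst1 _ ha r]
  rw [show a * a * (b * b) = a * (a * (b * b)) by ring, mul_assoc a]
  congr 1
  rw [← integral_const_mul]
  apply integral_congr_ae
  refine Eventually.of_forall fun x => ?_
  simp only
  rw [subst1 _ ha r, mul_assoc]
  congr 1
  rw [← integral_const_mul]
  apply integral_congr_ae
  refine Eventually.of_forall fun x' => ?_
  simp only
  exact h1 _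

lemma integrable_of_box {E : Type*} [NormedAddCommGroup E] [NormedSpace ℝ E] [MeasurableSpace E] [BorelSpace E] [ProperSpace E]
    {μ : Measure E} [IsLocallyFiniteMeasure μ] {f : E → ℝ} (hf : Continuous f) {X : ℝ} (h : ∀ p, f p ≠ 0 → ‖p‖ ≤ X) : Integrable f μ := by
  apply hf.integrable_of_hasCompactSupport
  apply HasCompactSupport.intro (isCompact_closedBall (0:E) X)
  intro p hp
  by_contra h'
  exact hp (by simpa using h p h')

lemma iter4 {Θ : ℝ × ℝ × ℝ × ℝ → ℝ} (hc : Continuous Θ) {X : ℝ} (h : ∀ p, Θ p ≠ 0 → ‖p‖ ≤ X) :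
    ∫ x, ∫ x', ∫ z, ∫ z', Θ (x, x', z, z') = ∫ p, Θ p := by
  have e1 : ∫ p, Θ p = ∫ x, ∫ q, Θ (x, q) := by
    exact integral_prod Θ (integrable_of_box hc h)
  rw [e1]
  apply integral_congr_ae
  refine Eventually.of_forall fun x => ?_
  simp only
  have b1 : ∀ q : ℝ × ℝ × ℝ, Θ (x, q) ≠ 0 → ‖q‖ ≤ X := fun q hq => (le_max_right _ _).trans (h _ hq)
  have e2 : ∫ q, Θ (x, q) = ∫ x', ∫ q, Θ (x, x', q) := by
    exact integral_prod (fun q => Θ (x, q)) (integrable_of_box (by fun_prop) b1)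
  rw [e2]
  apply integral_congr_ae
  refine Eventually.of_forall fun x' => ?_
  simp only
  have e3 : ∫ q, Θ (x, x', q) = ∫ z, ∫ z', Θ (x, x', z, z') := by
    exact integral_prod (fun q => Θ (x, x', q)) (integrable_of_box (by fun_prop) fun q hq => (le_max_right _ _).trans (b1 _ hq))
  rw [e3]

lemma unif {E : Type*} [NormedAddCommGroup E] [NormedSpace ℝ E] {T : ℝ × E → ℝ} {K : Set E} (hK : IsCompact K)
    (h : ∀ p ∈ K, ContDiffAt ℝ 1 T (0, p)) :
    ∃ C : ℝ, 0 < C ∧ ∃ δ : ℝ, 0 < δ ∧ ∀ p ∈ K, ∀ ε : ℝ, |ε| ≤ δ → |T (ε, p) - T (0, p)| ≤ C * |ε| := by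
  refine hK.induction_on (p := fun s => ∃ C : ℝ, 0 < C ∧ ∃ δ : ℝ, 0 < δ ∧ ∀ p ∈ s, ∀ ε : ℝ, |ε| ≤ δ → |T (ε, p) - T (0, p)| ≤ C * |ε|)
    ⟨1, one_pos, 1, one_pos, by simp⟩ ?_ ?_ ?_
  · rintro s t hst ⟨C, hC, δ, hδ, H⟩
    exact ⟨C, hC, δ, hδ, fun p hp => H p (hst hp)⟩
  · rintro s t ⟨C, hC, δ, hδ, H⟩ ⟨C', hC', δ', hδ', H'⟩
    refine ⟨max C C', lt_max_of_lt_left hC, min δ δ', lt_min hδ hδ', ?_⟩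
    rintro p (hp | hp) ε hε
    · exact (H p hp ε (hε.trans (min_le_left _ _))).trans (mul_le_mul_of_nonneg_right (le_max_left _ _) (abs_nonneg _))
    · exact (H' p hp ε (hε.trans (min_le_right _ _))).trans (mul_le_mul_of_nonneg_right (le_max_right _ _) (abs_nonneg _))
  · intro p hp
    obtain ⟨L, t, ht, hL⟩ := (h p hp).exists_lipschitzOnWith
    obtain ⟨ρ, hρ, hb⟩ := Metric.mem_nhds_iff.1 ht
    refine ⟨Metric.ball p ρ, mem_nhdsWithin_of_mem_nhds (Metric.ball_mem_nhds p hρ), L + 1, by positivity, ρ / 2, by positivity, ?_⟩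
    intro q hq ε hε
    have m1 : ((ε, q) : ℝ × E) ∈ t := hb (by
      rw [← ball_prod_same]
      refine ⟨?_, hq⟩
      rw [Metric.mem_ball, dist_zero_right, Real.norm_eq_abs]; linarith)
    have m2 : ((0, q) : ℝ × E) ∈ t := hb (by
      rw [← ball_prod_same]
      refine ⟨?_, hq⟩
      simpa using hρ)
    have := hL.dist_le_mul _ m1 _ m2
    rw [Real.dist_eq, Prod.dist_eq] at this
    simp only [dist_self, dist_zero_right, Real.norm_eq_abs] at this
    rw [max_eq_left (abs_nonneg _)] at this
    nlinarith [abs_nonneg ε]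

lemma pow_lim {D : ℝ → ℝ} {D' : ℝ} (h0 : D 0 = 1) (h : HasDerivAt D D' 0) (j : ℕ) :
    Tendsto (fun n : ℕ => D (1 / ((n:ℝ) + 1)) ^ (n - j)) atTop (𝓝 (rexp D')) := by
  have h1 : Tendsto (fun n : ℕ => 1 / ((n:ℝ) + 1)) atTop (𝓝[≠] 0) := by
    rw [tendsto_nhdsWithin_iff]
    refine ⟨tendsto_one_div_add_atTop_nhds_zero_nat, Eventually.of_forall fun n => ?_⟩
    simp only [mem_compl_iff, mem_singleton_iff]; positivity
  have h2 : Tendsto (fun n : ℕ => ((n:ℝ) + 1) * (D (1 / ((n:ℝ) + 1)) - 1)) atTop (𝓝 D') := by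
    have := (hasDerivAt_iff_tendsto_slope.1 h).comp h1
    refine this.congr fun n => ?_
    simp only [Function.comp, slope, vsub_eq_sub, sub_zero, h0, smul_eq_mul, one_div, inv_inv]
  have h5 : Tendsto (fun n : ℕ => D (1 / ((n:ℝ) + 1))) atTop (𝓝 1) := by
    have := h.continuousAt.tendsto.comp (tendsto_one_div_add_atTop_nhds_zero_nat (𝕜 := ℝ))
    rwa [h0] at this
  have h2' : Tendsto (fun n : ℕ => (n:ℝ) * (D (1 / ((n:ℝ) + 1)) - 1)) atTop (𝓝 D') := by
    have h3 : Tendsto (fun n : ℕ => (D (1 / ((n:ℝ) + 1)) - 1)) atTop (𝓝 (1 - 1)) := h5.sub_const 1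
    have := h2.sub h3
    simp only [sub_self, sub_zero] at this
    exact this.congr fun n => by ring
  have h4 := Real.tendsto_one_add_pow_exp_of_tendsto h2'
  have h6 := h4.div (h5.pow j) (by simp)
  simp only [add_sub_cancel, one_pow, div_one] at h6
  refine h6.congr' ?_
  filter_upwards [eventually_ge_atTop j, h5.eventually_ne (one_ne_zero)] with n hn hne
  rw [pow_sub₀ _ hne hn]; rfl

end SCB
end

noncomputable section
namespace SCB
open Set Topology

/-- scaled first coordinate -/
def UU (r ε x : ℝ) : ℝ := r + (1 - r ^ 2) / r * ε * x
/-- its complementary sine -/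
def SS (r ε x : ℝ) : ℝ := √(1 - UU r ε x ^ 2)
/-- sine of the scaled second coordinate -/
def VV (ε z : ℝ) : ℝ := √(1 - ε * z ^ 2)
/-- relative inner product in scaled coordinates -/
def T2 (r c0 ε x x' z z' : ℝ) : ℝ :=
  ((r ^ 2 + c0 * (1 - r ^ 2)) - UU r ε x * UU r ε x' - SS r ε x * SS r ε x' * (ε * (z * z'))) /
    (SS r ε x * SS r ε x' * (VV ε z * VV ε z'))

variable {r c0 : ℝ}

lemma UU_zero (x : ℝ) : UU r 0 x = r := by simp [UU]
lemma SS_zero (x : ℝ) : SS r 0 x = √(1 - r ^ 2) := by simp [SS, UU_zero]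
lemma VV_zero (z : ℝ) : VV 0 z = 1 := by simp [VV]

lemma R_pos (h0 : 0 < r) (h1 : r < 1) : 0 < 1 - r ^ 2 := by nlinarith

lemma T2_zero (h0 : 0 < r) (h1 : r < 1) (x x' z z' : ℝ) : T2 r c0 0 x x' z z' = c0 := by
  have h := R_pos h0 h1
  simp only [T2, UU_zero, SS_zero, VV_zero]
  rw [Real.mul_self_sqrt h.le, div_eq_iff (by simpa using h.ne')]
  ring

lemma UU_deriv (x : ℝ) (ε : ℝ) : HasDerivAt (fun ε => UU r ε x) ((1 - r ^ 2) / r * x) ε := by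
  unfold UU
  have := (((hasDerivAt_id ε).const_mul ((1 - r ^ 2) / r)).mul_const x).const_add r
  simpa using this

lemma SS_deriv (h0 : 0 < r) (h1 : r < 1) (x : ℝ) : HasDerivAt (fun ε => SS r ε x) (-(√(1 - r ^ 2) * x)) 0 := by
  have h := R_pos h0 h1
  have h2 := (((UU_deriv (r := r) x 0).pow 2).const_sub 1).sqrt (by simp only [Pi.pow_apply, UU_zero]; exact h.ne')
  have h3 : HasDerivAt (fun ε => SS r ε x) _ 0 := h2
  convert h3 using 1
  simp only [Pi.pow_apply, UU_zero]
  have hs : 0 < √(1 - r ^ 2) := Real.sqrt_pos.2 h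
  have hs2 := Real.sq_sqrt h.le
  field_simp
  rw [hs2]; norm_num; ring

lemma VV_deriv (z : ℝ) : HasDerivAt (fun ε => VV ε z) (-(z ^ 2 / 2)) 0 := by
  have h2 := (((hasDerivAt_id (0:ℝ)).mul_const (z ^ 2)).const_sub 1).sqrt (by simp)
  have h3 : HasDerivAt (fun ε => VV ε z) _ 0 := h2
  convert h3 using 1
  simp; ring

lemma T2_deriv (h0 : 0 < r) (h1 : r < 1) (x x' z z' : ℝ) :
    HasDerivAt (fun ε => T2 r c0 ε x x' z z') (-((1 - c0) * (x + x') - c0 * (z ^ 2 + z' ^ 2) / 2 + z * z')) 0 := by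
  have h := R_pos h0 h1
  have hs : 0 < √(1 - r ^ 2) := Real.sqrt_pos.2 h
  have hs2 := Real.sq_sqrt h.le
  have dS := (SS_deriv h0 h1 x).mul (SS_deriv h0 h1 x')
  have dV := (VV_deriv z).mul (VV_deriv z')
  have dU := (UU_deriv (r := r) x 0).mul (UU_deriv (r := r) x' 0)
  have dE := (hasDerivAt_id (0:ℝ)).mul_const (z * z')
  have dN := (dU.const_sub (r ^ 2 + c0 * (1 - r ^ 2))).sub (dS.mul dE)
  have dT := dN.div (dS.mul dV) (by
    simp only [Pi.mul_apply, SS_zero, VV_zero]; positivity)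
  have dT' : HasDerivAt (fun ε => T2 r c0 ε x x' z z') _ 0 := dT
  convert dT' using 1
  simp only [Pi.mul_apply, Pi.sub_apply, SS_zero, VV_zero, UU_zero, id]
  generalize √(1 - r ^ 2) = q at *
  have : r ^ 2 = 1 - q ^ 2 := by linarith
  field_simp
  rw [this]
  ring

lemma UU_cd : ContDiff ℝ 1 (fun q : ℝ × ℝ => UU r q.1 q.2) := by unfold UU; fun_prop

lemma SS_cd (h0 : 0 < r) (h1 : r < 1) (x : ℝ) : ContDiffAt ℝ 1 (fun q : ℝ × ℝ => SS r q.1 q.2) (0, x) := by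
  have h := R_pos h0 h1
  unfold SS
  apply ContDiffAt.sqrt
  · exact (contDiff_const.sub (UU_cd.pow 2)).contDiffAt
  · simp only [UU_zero]; exact h.ne'

lemma VV_cd (z : ℝ) : ContDiffAt ℝ 1 (fun q : ℝ × ℝ => VV q.1 q.2) (0, z) := by
  unfold VV
  apply ContDiffAt.sqrt
  · fun_prop
  · simp

lemma T2_cd (h0 : 0 < r) (h1 : r < 1) (p : ℝ × ℝ × ℝ × ℝ) :
    ContDiffAt ℝ 1 (fun q : ℝ × (ℝ × ℝ × ℝ × ℝ) => T2 r c0 q.1 q.2.1 q.2.2.1 q.2.2.2.1 q.2.2.2.2) (0, p) := by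
  obtain ⟨x, x', z, z'⟩ := p
  have h := R_pos h0 h1
  have hs : 0 < √(1 - r ^ 2) := Real.sqrt_pos.2 h
  have a1 : ContDiffAt ℝ 1 (fun q : ℝ × (ℝ × ℝ × ℝ × ℝ) => SS r q.1 q.2.1) (0, (x, x', z, z')) :=
    ContDiffAt.comp (g := fun q : ℝ × ℝ => SS r q.1 q.2) (f := fun q : ℝ × (ℝ × ℝ × ℝ × ℝ) => (q.1, q.2.1)) _ (SS_cd h0 h1 x) (by fun_prop)
  have a2 : ContDiffAt ℝ 1 (fun q : ℝ × (ℝ × ℝ × ℝ × ℝ) => SS r q.1 q.2.2.1) (0, (x, x', z, z')) :=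
    ContDiffAt.comp (g := fun q : ℝ × ℝ => SS r q.1 q.2) (f := fun q : ℝ × (ℝ × ℝ × ℝ × ℝ) => (q.1, q.2.2.1)) _ (SS_cd h0 h1 x') (by fun_prop)
  have a3 : ContDiffAt ℝ 1 (fun q : ℝ × (ℝ × ℝ × ℝ × ℝ) => VV q.1 q.2.2.2.1) (0, (x, x', z, z')) :=
    ContDiffAt.comp (g := fun q : ℝ × ℝ => VV q.1 q.2) (f := fun q : ℝ × (ℝ × ℝ × ℝ × ℝ) => (q.1, q.2.2.2.1)) _ (VV_cd z) (by fun_prop)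
  have a4 : ContDiffAt ℝ 1 (fun q : ℝ × (ℝ × ℝ × ℝ × ℝ) => VV q.1 q.2.2.2.2) (0, (x, x', z, z')) :=
    ContDiffAt.comp (g := fun q : ℝ × ℝ => VV q.1 q.2) (f := fun q : ℝ × (ℝ × ℝ × ℝ × ℝ) => (q.1, q.2.2.2.2)) _ (VV_cd z') (by fun_prop)
  unfold T2
  apply ContDiffAt.div
  · apply ContDiffAt.sub
    · unfold UU; fun_prop
    · exact (a1.mul a2).mul (by fun_prop)
  · exact (a1.mul a2).mul (a3.mul a4)
  · simp only [SS_zero, VV_zero]; positivity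

/-- uniform control on a box -/
lemma unifT (h0 : 0 < r) (h1 : r < 1) (X : ℝ) : ∃ C1 : ℝ, 0 < C1 ∧ ∃ ε1 : ℝ, 0 < ε1 ∧ ∀ ε, 0 ≤ ε → ε ≤ ε1 →
    (∀ x, |x| ≤ X → √(1 - r ^ 2) / 2 ≤ SS r ε x) ∧ (∀ z, |z| ≤ X → √(1 - r ^ 2) / 2 ≤ VV ε z) ∧
    ∀ x x' z z', |x| ≤ X → |x'| ≤ X → |z| ≤ X → |z'| ≤ X → |T2 r c0 ε x x' z z' - c0| ≤ C1 * ε := by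
  have h := R_pos h0 h1
  have hs : 0 < √(1 - r ^ 2) := Real.sqrt_pos.2 h
  have hs1 : √(1 - r ^ 2) ≤ 1 := by rw [Real.sqrt_le_one]; nlinarith
  obtain ⟨A, hA, δ, hδ, H⟩ := unif (isCompact_Icc (a := -X) (b := X)) fun p _ => SS_cd h0 h1 p
  obtain ⟨A', hA', δ', hδ', H'⟩ := unif (isCompact_Icc (a := -X) (b := X)) fun p _ => VV_cd p
  obtain ⟨B, hB, ρ, hρ, G⟩ := unif (T := fun q : ℝ × (ℝ × ℝ × ℝ × ℝ) => T2 r c0 q.1 q.2.1 q.2.2.1 q.2.2.2.1 q.2.2.2.2)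
    (isCompact_Icc (a := -X) (b := X) |>.prod <| isCompact_Icc (a := -X) (b := X) |>.prod <|
    isCompact_Icc (a := -X) (b := X) |>.prod <| isCompact_Icc (a := -X) (b := X)) fun p _ => T2_cd h0 h1 p
  refine ⟨B, hB, min (min δ (√(1 - r ^ 2) / (2 * A))) (min (min δ' (1 / (2 * A'))) ρ), by positivity, ?_⟩
  intro ε hε hle
  simp only [le_min_iff] at hle
  obtain ⟨⟨l1, l2⟩, ⟨l3, l4⟩, l5⟩ := hle
  rw [le_div_iff₀ (by positivity)] at l2 l4
  have hab := abs_of_nonneg hε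
  refine ⟨?_, ?_, ?_⟩
  · intro x hx
    have := H x (abs_le.1 hx) ε (by rw [hab]; exact l1)
    simp only [SS_zero] at this
    rw [hab] at this
    have := (abs_le.1 this).1
    nlinarith
  · intro x hx
    have := H' x (abs_le.1 hx) ε (by rw [hab]; exact l3)
    simp only [VV_zero] at this
    rw [hab] at this
    have := (abs_le.1 this).1
    nlinarith
  · intro x x' z z' hx hx' hz hz'
    have := G (x, x', z, z') ⟨abs_le.1 hx, abs_le.1 hx', abs_le.1 hz, abs_le.1 hz'⟩ ε (by rw [hab]; exact l5)
    simp only [T2_zero h0 h1] at this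
    rwa [hab] at this

end SCB
end

noncomputable section
namespace SCB
open Set Topology

/-- bump function data -/
structure Bump (Φ : ℝ → ℝ → ℝ) (X : ℝ) : Prop where
  Xpos : 0 < X
  cont : Continuous fun p : ℝ × ℝ => Φ p.1 p.2
  nonneg : ∀ x z, 0 ≤ Φ x z
  le_one : ∀ x z, Φ x z ≤ 1
  supp : ∀ x z, Φ x z ≠ 0 → |x| ≤ X ∧ |z| ≤ X

/-- cut level -/
def cc (r : ℝ) : ℝ := √(1 - r ^ 2) / 2
/-- small parameter -/
def ep (n : ℕ) : ℝ := 1 / ((n:ℝ) + 1)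
/-- rescaled cutoff -/
def Fn (r : ℝ) (Φ : ℝ → ℝ → ℝ) (n : ℕ) (u v : ℝ) : ℝ :=
  Φ ((u - r) * (r * ((n:ℝ) + 1) / (1 - r ^ 2))) (√((n:ℝ) + 1) * v)
/-- rescaled weight -/
def Wn (r : ℝ) (j n : ℕ) (x z : ℝ) : ℝ :=
  (DD (cc r) (UU r (ep n) x) / √(1 - r ^ 2)) ^ (n - j) * DD (cc r) (√(ep n) * z) ^ (n - (j + 1))

variable {r c0 X : ℝ} {Φ : ℝ → ℝ → ℝ}

lemma ep_pos (n : ℕ) : 0 < ep n := by unfold ep; positivity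
lemma ep_lim : Tendsto ep atTop (𝓝 0) := tendsto_one_div_add_atTop_nhds_zero_nat
lemma ep_mul (n : ℕ) : ((n:ℝ) + 1) * ep n = 1 := by unfold ep; field_simp
lemma sq_ep (n : ℕ) (z : ℝ) : (√(ep n) * z) ^ 2 = ep n * z ^ 2 := by
  rw [mul_pow, Real.sq_sqrt (ep_pos n).le]
lemma sqrt_ep (n : ℕ) : √((n:ℝ) + 1) * √(ep n) = 1 := by
  rw [← Real.sqrt_mul (by positivity), ep_mul, Real.sqrt_one]
lemma VV_sqrt (n : ℕ) (z : ℝ) : √(1 - (√(ep n) * z) ^ 2) = VV (ep n) z := by rw [sq_ep, VV]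
lemma mul_ep (n : ℕ) (z z' : ℝ) : (√(ep n) * z) * (√(ep n) * z') = ep n * (z * z') := by
  have := Real.mul_self_sqrt (ep_pos n).le
  calc _ = (√(ep n) * √(ep n)) * (z * z') := by ring
    _ = _ := by rw [this]

lemma Fn_eq (h0 : 0 < r) (h1 : r < 1) (n : ℕ) (x z : ℝ) : Fn r Φ n (UU r (ep n) x) (√(ep n) * z) = Φ x z := by
  have h := R_pos h0 h1
  unfold Fn
  rw [← mul_assoc, sqrt_ep, one_mul]
  congr 1
  have := ep_mul n
  unfold UU
  calc _ = x * (((n:ℝ) + 1) * ep n) := by field_simp; ring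
    _ = x := by rw [this, mul_one]

lemma Fn_rep (h0 : 0 < r) (h1 : r < 1) (hΦ : Bump Φ X) (n : ℕ) {u v : ℝ} (h : Fn r Φ n u v ≠ 0) :
    ∃ x z, |x| ≤ X ∧ |z| ≤ X ∧ u = UU r (ep n) x ∧ v = √(ep n) * z := by
  have hR := R_pos h0 h1
  refine ⟨_, _, (hΦ.supp _ _ h).1, (hΦ.supp _ _ h).2, ?_, ?_⟩
  · unfold UU ep; field_simp; ring
  · rw [← mul_assoc, mul_comm (√(ep n)), sqrt_ep, one_mul]

lemma cc_pos (h0 : 0 < r) (h1 : r < 1) : 0 < cc r := by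
  have := R_pos h0 h1
  unfold cc; positivity

lemma cc_le_one (r : ℝ) : cc r ≤ 1 := by
  have : √(1 - r ^ 2) ≤ 1 := by rw [Real.sqrt_le_one]; nlinarith
  unfold cc; linarith

/-- hypotheses for parameters small enough -/
def Small (r c0 X C1 ε : ℝ) : Prop :=
    (∀ x, |x| ≤ X → cc r ≤ SS r ε x) ∧ (∀ z, |z| ≤ X → cc r ≤ VV ε z) ∧
    ∀ x x' z z', |x| ≤ X → |x'| ≤ X → |z| ≤ X → |z'| ≤ X → |T2 r c0 ε x x' z z' - c0| ≤ C1 * ε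

lemma Fn_cut (h0 : 0 < r) (h1 : r < 1) (hΦ : Bump Φ X) {n : ℕ} {C1 : ℝ} (hs : Small r c0 X C1 (ep n)) :
    Cut (Fn r Φ n) (cc r) where
  cpos := cc_pos h0 h1
  cont := hΦ.cont.comp (by fun_prop : Continuous fun p : ℝ × ℝ => ((p.1 - r) * (r * ((n:ℝ) + 1) / (1 - r ^ 2)), √((n:ℝ) + 1) * p.2))
  nonneg _ _ := hΦ.nonneg _ _
  le_one _ _ := hΦ.le_one _ _
  supp := by
    intro u v h
    obtain ⟨x, z, hx, hz, rfl, rfl⟩ := Fn_rep h0 h1 hΦ n h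
    rw [VV_sqrt]
    exact ⟨hs.1 x hx, hs.2.1 z hz⟩

lemma DD_U {ε x : ℝ} (h : cc r ≤ SS r ε x) : DD (cc r) (UU r ε x) = SS r ε x := max_eq_left h
lemma DD_V {n : ℕ} {z : ℝ} (h : cc r ≤ VV (ep n) z) : DD (cc r) (√(ep n) * z) = VV (ep n) z := by
  unfold DD; rw [VV_sqrt]; exact max_eq_left h

lemma DD_le_one (r v : ℝ) : DD (cc r) v ≤ 1 := by
  unfold DD
  exact max_le (by rw [Real.sqrt_le_one]; nlinarith) (cc_le_one r)

lemma Wn_lim (h0 : 0 < r) (h1 : r < 1) (j : ℕ) (x z : ℝ) :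
    Tendsto (fun n => Wn r j n x z) atTop (𝓝 (rexp (-x) * rexp (-(z ^ 2 / 2)))) := by
  have h := R_pos h0 h1
  have hs : 0 < √(1 - r ^ 2) := Real.sqrt_pos.2 h
  obtain ⟨C1, -, ε1, hε1, H⟩ := unifT (c0 := 0) h0 h1 (max |x| |z|)
  have a1 := pow_lim (D := fun ε => SS r ε x / √(1 - r ^ 2)) (by simp only [SS_zero]; exact div_self hs.ne')
    ((SS_deriv h0 h1 x).div_const _) j
  have a2 := pow_lim (D := fun ε => VV ε z) (VV_zero z) (VV_deriv z) (j + 1)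
  have e : -(√(1 - r ^ 2) * x) / √(1 - r ^ 2) = -x := by field_simp
  rw [e] at a1
  refine (a1.mul a2).congr' ?_
  filter_upwards [ep_lim.eventually_le_const hε1] with n hn
  have hh := H (ep n) (ep_pos n).le hn
  unfold Wn
  rw [DD_U (hh.1 x (le_max_left _ _)), DD_V (hh.2.1 z (le_max_right _ _))]
  rfl

lemma Wn_nonneg (h0 : 0 < r) (h1 : r < 1) (j n : ℕ) (x z : ℝ) : 0 ≤ Wn r j n x z := by
  have a := DD_pos (cc_pos h0 h1)
  unfold Wn
  exact mul_nonneg (pow_nonneg (div_nonneg (a _).le (Real.sqrt_nonneg _)) _) (pow_nonneg (a _).le _)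

lemma Wn_le (h0 : 0 < r) (h1 : r < 1) (hX : 0 < X) (j n : ℕ) {x : ℝ} (z : ℝ) (hx : |x| ≤ X) : Wn r j n x z ≤ rexp X := by
  have h := R_pos h0 h1
  have hs : 0 < √(1 - r ^ 2) := Real.sqrt_pos.2 h
  have a := DD_pos (cc_pos h0 h1)
  have hε := ep_pos n
  have b1 : DD (cc r) (UU r (ep n) x) / √(1 - r ^ 2) ≤ 1 + X * ep n := by
    rw [div_le_iff₀ hs]
    apply max_le
    · have : 0 ≤ (1 + X * ep n) * √(1 - r ^ 2) := by positivity
      rw [← Real.sqrt_sq this]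
      apply Real.sqrt_le_sqrt
      rw [mul_pow, Real.sq_sqrt h.le]
      have e1 : UU r (ep n) x ^ 2 = r ^ 2 + 2 * (1 - r ^ 2) * ep n * x + ((1 - r ^ 2) / r * ep n * x) ^ 2 := by
        unfold UU; field_simp; ring
      rw [e1]
      have := sq_nonneg ((1 - r ^ 2) / r * ep n * x)
      have h3 := (abs_le.1 hx).1
      have : 0 ≤ (1 - r ^ 2) * ep n * (x + X) := by
        apply mul_nonneg (by positivity); linarith
      have : 0 ≤ (1 - r ^ 2) * (X * ep n) ^ 2 := by positivity
      nlinarith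
    · unfold cc; nlinarith [mul_pos hX hε]
  unfold Wn
  calc _ ≤ (1 + X * ep n) ^ (n - j) * 1 := by
        apply mul_le_mul _ (pow_le_one₀ (a _).le (DD_le_one _ _)) (pow_nonneg (a _).le _) (by positivity)
        exact pow_le_pow_left₀ (div_nonneg (a _).le hs.le) b1 _
    _ ≤ rexp (X * ep n) ^ (n - j) := by
        rw [mul_one]
        exact pow_le_pow_left₀ (by positivity) (by linarith [Real.add_one_le_exp (X * ep n)]) _
    _ = rexp ((n - j : ℕ) * (X * ep n)) := by rw [← Real.exp_nat_mul]
    _ ≤ rexp X := by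
        apply Real.exp_le_exp.2
        have h1 : ((n - j : ℕ) : ℝ) ≤ n + 1 := by
          have : n - j ≤ n + 1 := by omega
          exact_mod_cast this
        have := ep_mul n
        calc _ ≤ ((n:ℝ) + 1) * (X * ep n) := mul_le_mul_of_nonneg_right h1 (by positivity)
          _ = X * (((n:ℝ) + 1) * ep n) := by ring
          _ = X := by rw [this, mul_one]

lemma Wn_cont (h0 : 0 < r) (h1 : r < 1) (j n : ℕ) : Continuous fun p : ℝ × ℝ => Wn r j n p.1 p.2 := by
  unfold Wn DD UU
  have h := R_pos h0 h1
  have hs : 0 < √(1 - r ^ 2) := Real.sqrt_pos.2 h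
  fun_prop

/-- solution of the two Gram relations -/
lemma tau_pair (h0 : 0 < r) (h1 : r < 1) {n : ℕ} {C1 : ℝ} (hs : Small r c0 X C1 (ep n)) {x x' z z' t : ℝ}
    (hx : |x| ≤ X) (hx' : |x'| ≤ X) (hz : |z| ≤ X) (hz' : |z'| ≤ X) :
    ∃ τ1 τ2, t = UU r (ep n) x * UU r (ep n) x' + SS r (ep n) x * SS r (ep n) x' * τ1 ∧
      τ1 = (√(ep n) * z) * (√(ep n) * z') + VV (ep n) z * VV (ep n) z' * τ2 ∧
      τ1 = T2 r c0 (ep n) x x' 0 0 - (r ^ 2 + c0 * (1 - r ^ 2) - t) / (SS r (ep n) x * SS r (ep n) x') ∧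
      τ2 = T2 r c0 (ep n) x x' z z' - (r ^ 2 + c0 * (1 - r ^ 2) - t) / (SS r (ep n) x * SS r (ep n) x' * (VV (ep n) z * VV (ep n) z')) := by
  have c0 := cc_pos h0 h1
  have s1 := c0.trans_le (hs.1 x hx)
  have s2 := c0.trans_le (hs.1 x' hx')
  have s3 := c0.trans_le (hs.2.1 z hz)
  have s4 := c0.trans_le (hs.2.1 z' hz')
  refine ⟨_, _, ?_, ?_, rfl, rfl⟩
  · unfold T2
    simp only [VV, mul_zero, sub_zero, Real.sqrt_one, mul_one]
    norm_num
    field_simp; ring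
  · rw [mul_ep]
    unfold T2
    have : ∀ ε, VV ε 0 = 1 := fun ε => by simp [VV]
    simp only [this]
    field_simp; ring

end SCB
end

noncomputable section
namespace SCB
open Set Topology

variable {r c0 X : ℝ} {Φ : ℝ → ℝ → ℝ}

lemma SS_le_one (r ε x : ℝ) : SS r ε x ≤ 1 := by
  unfold SS; rw [Real.sqrt_le_one]; nlinarith
lemma VV_le_one {ε : ℝ} (h : 0 ≤ ε) (z : ℝ) : VV ε z ≤ 1 := by
  unfold VV; rw [Real.sqrt_le_one]; nlinarith [mul_nonneg h (sq_nonneg z)]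

lemma clip_le {τ s : ℝ} (hs : -1 ≤ s) (h : τ ≤ s) : clip τ ≤ s :=
  max_le hs ((min_le_left _ _).trans h)

lemma clip_low {τ : ℝ} (h : τ ≤ -1) : clip τ = -1 := by
  unfold clip; rw [min_eq_left (by linarith), max_eq_left h]

lemma Tau_gen {c t u u' τ : ℝ} (hc : 0 < c) (hu : c ≤ √(1 - u ^ 2)) (hu' : c ≤ √(1 - u' ^ 2))
    (ht : t = u * u' + √(1 - u ^ 2) * √(1 - u' ^ 2) * τ) : Tau c t u u' = clip τ := by
  unfold Tau DD
  rw [max_eq_left hu, max_eq_left hu']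
  congr 1
  have h1 := hc.trans_le hu
  have h2 := hc.trans_le hu'
  rw [div_eq_iff (by positivity), ht]; ring

lemma tau_le (h0 : 0 < r) (h1 : r < 1) (hΦ : Bump Φ X) {n : ℕ} {C1 s t : ℝ} (hC1 : 0 < C1) (hs : Small r c0 X C1 (ep n))
    (hc0 : 0 ≤ c0) (hsm : c0 + C1 * ep n < 1) (hcs : c0 ≤ s) (ht : t ≤ r ^ 2 + c0 * (1 - r ^ 2))
    (hor : C1 * ep n ≤ r ^ 2 + c0 * (1 - r ^ 2) - t ∨ c0 + C1 * ep n ≤ s) {u v u' v' : ℝ}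
    (hF : Fn r Φ n u v ≠ 0) (hF' : Fn r Φ n u' v' ≠ 0) : Tau (cc r) (Tau (cc r) t u u') v v' ≤ s := by
  have hX := hΦ.Xpos
  have c0' := cc_pos h0 h1
  have hsu := ((Fn_cut h0 h1 hΦ hs).supp _ _ hF)
  have hsu' := ((Fn_cut h0 h1 hΦ hs).supp _ _ hF')
  obtain ⟨x, z, hx, hz, rfl, rfl⟩ := Fn_rep h0 h1 hΦ n hF
  obtain ⟨x', z', hx', hz', rfl, rfl⟩ := Fn_rep h0 h1 hΦ n hF'
  obtain ⟨τ1, τ2, e1, e2, f1, f2⟩ := tau_pair (t := t) h0 h1 hs hx hx' hz hz'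
  have s1 := c0'.trans_le (hs.1 x hx)
  have s2 := c0'.trans_le (hs.1 x' hx')
  have s3 := c0'.trans_le (hs.2.1 z hz)
  have s4 := c0'.trans_le (hs.2.1 z' hz')
  have T0 := (abs_le.1 (hs.2.2 x x' 0 0 hx hx' (by simpa using hX.le) (by simpa using hX.le))).2
  have T1 := (abs_le.1 (hs.2.2 x x' z z' hx hx' hz hz')).2
  have g1 : Tau (cc r) t (UU r (ep n) x) (UU r (ep n) x') = clip τ1 := Tau_gen c0' hsu.1 hsu'.1 e1
  rw [g1]
  rcases lt_or_ge τ1 (-1) with hlt | hge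
  · rw [clip_low hlt.le]
    unfold Tau
    rw [clip_low]
    · linarith
    rw [DD_V (hs.2.1 z hz), DD_V (hs.2.1 z' hz'), div_le_iff₀ (by positivity), mul_ep]
    have q1 : VV (ep n) z ^ 2 = 1 - ep n * z ^ 2 := by
      unfold VV; rw [Real.sq_sqrt]; exact (Real.sqrt_pos.1 s3).le
    have q2 : VV (ep n) z' ^ 2 = 1 - ep n * z' ^ 2 := by
      unfold VV; rw [Real.sq_sqrt]; exact (Real.sqrt_pos.1 s4).le
    have := mul_nonneg (ep_pos n).le (sq_nonneg (z + z'))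
    nlinarith [sq_nonneg (VV (ep n) z - VV (ep n) z')]
  · have hd : 0 ≤ r ^ 2 + c0 * (1 - r ^ 2) - t := by linarith
    have hτ1 : τ1 ≤ 1 := by
      have : 0 ≤ (r ^ 2 + c0 * (1 - r ^ 2) - t) / (SS r (ep n) x * SS r (ep n) x') := by positivity
      linarith
    rw [clip_of_mem ⟨hge, hτ1⟩]
    have g2 : Tau (cc r) τ1 (√(ep n) * z) (√(ep n) * z') = clip τ2 :=
      Tau_gen c0' hsu.2 hsu'.2 (by rw [VV_sqrt, VV_sqrt]; exact e2)
    rw [g2]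
    apply clip_le (by linarith)
    have hD : SS r (ep n) x * SS r (ep n) x' * (VV (ep n) z * VV (ep n) z') ≤ 1 :=
      mul_le_one₀ (mul_le_one₀ (SS_le_one _ _ _) s2.le (SS_le_one _ _ _)) (by positivity)
        (mul_le_one₀ (VV_le_one (ep_pos n).le _) s4.le (VV_le_one (ep_pos n).le _))
    have hdd : r ^ 2 + c0 * (1 - r ^ 2) - t ≤ (r ^ 2 + c0 * (1 - r ^ 2) - t) / (SS r (ep n) x * SS r (ep n) x' * (VV (ep n) z * VV (ep n) z')) := by
      rw [le_div_iff₀ (by positivity)]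
      exact mul_le_of_le_one_right hd hD
    rcases hor with h | h <;> linarith

lemma regime1 (h0 : 0 < r) (h1 : r < 1) (hΦ : Bump Φ X) {n : ℕ} {C1 s t : ℝ} (hC1 : 0 < C1) (hs : Small r c0 X C1 (ep n))
    (hc0 : 0 ≤ c0) (hsm : c0 + C1 * ep n < 1) (hcs : c0 ≤ s) (ht : t ≤ r ^ 2 + c0 * (1 - r ^ 2))
    (hor : C1 * ep n ≤ r ^ 2 + c0 * (1 - r ^ 2) - t ∨ c0 + C1 * ep n ≤ s) {g : ℝ → ℝ} (hg : ∀ τ ∈ Icc (-1) s, g τ ≤ 0) :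
    K4 n (Fn r Φ n) g (cc r) t ≤ 0 := by
  unfold K4 K2
  refine integral_nonpos fun u => integral_nonpos fun w => integral_nonpos fun v => integral_nonpos fun w' => ?_
  unfold Psi
  by_cases hF : Fn r Φ n u v = 0
  · rw [hF]; simp
  by_cases hF' : Fn r Φ n (t * u + √(1 - t ^ 2) * √(1 - u ^ 2) * w) ((Tau (cc r) t u (t * u + √(1 - t ^ 2) * √(1 - u ^ 2) * w)) * v +
      √(1 - (Tau (cc r) t u (t * u + √(1 - t ^ 2) * √(1 - u ^ 2) * w)) ^ 2) * √(1 - v ^ 2) * w') = 0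
  · rw [hF']; simp
  refine mul_nonpos_of_nonneg_of_nonpos (mul_nonneg (hΦ.nonneg _ _) (hΦ.nonneg _ _)) ?_
  exact hg _ ⟨(Tau_mem _ _ _ _).1, tau_le h0 h1 hΦ hC1 hs hc0 hsm hcs ht hor hF hF'⟩

lemma tau_box (h0 : 0 < r) (h1 : r < 1) (hX : 0 < X) {n : ℕ} {C1 t : ℝ} (hC1 : 0 < C1) (hs : Small r c0 X C1 (ep n))
    (hc0 : 0 ≤ c0) (hsm : C1 * ep n * (1 + 1 / cc r ^ 4) < 1 - c0) (ht : t ≤ r ^ 2 + c0 * (1 - r ^ 2))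
    (ht2 : r ^ 2 + c0 * (1 - r ^ 2) - t ≤ C1 * ep n) {x x' z z' : ℝ}
    (hx : |x| ≤ X) (hx' : |x'| ≤ X) (hz : |z| ≤ X) (hz' : |z'| ≤ X) :
    ∃ τ1 ∈ Ioo (-1:ℝ) 1, ∃ τ2 ∈ Ioo (-1:ℝ) 1, t = UU r (ep n) x * UU r (ep n) x' + SS r (ep n) x * SS r (ep n) x' * τ1 ∧
      τ1 = (√(ep n) * z) * (√(ep n) * z') + VV (ep n) z * VV (ep n) z' * τ2 ∧
      τ2 ≤ T2 r c0 (ep n) x x' z z' ∧ |τ2 - c0| ≤ C1 * ep n * (1 + 1 / cc r ^ 4) := by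
  obtain ⟨τ1, τ2, e1, e2, f1, f2⟩ := tau_pair (t := t) h0 h1 hs hx hx' hz hz'
  have c0' := cc_pos h0 h1
  have c1' := cc_le_one r
  have l1 := hs.1 x hx
  have l2 := hs.1 x' hx'
  have l3 := hs.2.1 z hz
  have l4 := hs.2.1 z' hz'
  have s1 := c0'.trans_le l1
  have s2 := c0'.trans_le l2
  have s3 := c0'.trans_le l3
  have s4 := c0'.trans_le l4
  have T0 := abs_le.1 (hs.2.2 x x' 0 0 hx hx' (by simpa using hX.le) (by simpa using hX.le))
  have T1 := abs_le.1 (hs.2.2 x x' z z' hx hx' hz hz')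
  have hε := ep_pos n
  have d1 : cc r ^ 2 ≤ SS r (ep n) x * SS r (ep n) x' := by rw [sq]; exact mul_le_mul l1 l2 c0'.le s1.le
  have d2 : cc r ^ 2 ≤ VV (ep n) z * VV (ep n) z' := by rw [sq]; exact mul_le_mul l3 l4 c0'.le s3.le
  have d3 : cc r ^ 4 ≤ SS r (ep n) x * SS r (ep n) x' * (VV (ep n) z * VV (ep n) z') := by
    rw [show cc r ^ 4 = cc r ^ 2 * cc r ^ 2 by ring]
    exact mul_le_mul d1 d2 (by positivity) (by positivity)
  have d4 : cc r ^ 4 ≤ SS r (ep n) x * SS r (ep n) x' :=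
    (pow_le_pow_of_le_one c0'.le c1' (by norm_num)).trans d1
  have hd : 0 ≤ r ^ 2 + c0 * (1 - r ^ 2) - t := by linarith
  have k : ∀ D, cc r ^ 4 ≤ D → 0 ≤ (r ^ 2 + c0 * (1 - r ^ 2) - t) / D ∧ (r ^ 2 + c0 * (1 - r ^ 2) - t) / D ≤ C1 * ep n * (1 / cc r ^ 4) := by
    intro D hD
    have hD0 : 0 < D := lt_of_lt_of_le (by positivity) hD
    refine ⟨by positivity, ?_⟩
    rw [mul_one_div]
    exact div_le_div₀ (by positivity) ht2 (by positivity) hD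
  have k1 := k _ d4
  have k2 := k _ d3
  have : 0 < C1 * ep n * (1 / cc r ^ 4) := by positivity
  have : 0 < C1 * ep n := by positivity
  rw [mul_add, mul_one] at hsm ⊢
  refine ⟨τ1, ⟨by linarith, by linarith⟩, τ2, ⟨by linarith, by linarith⟩, e1, e2, by linarith, ?_⟩
  rw [abs_le]; constructor <;> linarith

lemma nondeg (h0 : 0 < r) (h1 : r < 1) (hΦ : Bump Φ X) {n : ℕ} {C1 t : ℝ} (hC1 : 0 < C1) (hs : Small r c0 X C1 (ep n))
    (hc0 : 0 ≤ c0) (hsm : C1 * ep n * (1 + 1 / cc r ^ 4) < 1 - c0) (ht : t ≤ r ^ 2 + c0 * (1 - r ^ 2))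
    (ht2 : r ^ 2 + c0 * (1 - r ^ 2) - t ≤ C1 * ep n) : Nondeg (Fn r Φ n) t := by
  intro u v u' v' hF hF'
  obtain ⟨x, z, hx, hz, rfl, rfl⟩ := Fn_rep h0 h1 hΦ n hF
  obtain ⟨x', z', hx', hz', rfl, rfl⟩ := Fn_rep h0 h1 hΦ n hF'
  obtain ⟨τ1, m1, τ2, m2, e1, e2, -, -⟩ := tau_box h0 h1 hΦ.Xpos hC1 hs hc0 hsm ht ht2 hx hx' hz hz'
  refine ⟨τ1, m1, τ2, m2, e1, ?_⟩
  rw [VV_sqrt, VV_sqrt]; exact e2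

lemma gg_WW {n e d : ℕ} {τ : ℝ} (h : τ ∈ Ioo (-1:ℝ) 1) :
    (1 - τ ^ 2) ^ (((n:ℝ) - 2) / 2) * gg n e d τ =
      (τ - maxRoot ((n:ℝ) / 2) ((n:ℝ) / 2 - 1 + e) d) * WW ((n:ℝ) / 2) e d τ := by
  have h1 : 0 < 1 - τ := by linarith [h.2]
  have h2 : 0 < 1 + τ := by linarith [h.1]
  unfold gg WW wt
  rw [show 1 - τ ^ 2 = (1 - τ) * (1 + τ) by ring, Real.mul_rpow h1.le h2.le, Real.rpow_add h2, Real.rpow_natCast,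
    show ((n:ℝ) - 2) / 2 = (n:ℝ) / 2 - 1 by ring]
  ring

end SCB
end

noncomputable section
namespace SCB
open Set Topology

variable {r c0 X : ℝ} {Φ : ℝ → ℝ → ℝ}

/-- quadruples `(x, x', z, z')` -/
abbrev R4 := ℝ × ℝ × ℝ × ℝ
/-- product of cutoffs -/
def PH (Φ : ℝ → ℝ → ℝ) (p : R4) : ℝ := Φ p.1 p.2.2.1 * Φ p.2.1 p.2.2.2
/-- product of weights -/
def WP (r : ℝ) (n : ℕ) (p : R4) : ℝ := Wn r 1 n p.1 p.2.2.1 * Wn r 1 n p.2.1 p.2.2.2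
/-- limit weight -/
def EP (p : R4) : ℝ := (rexp (-p.1) * rexp (-(p.2.2.1 ^ 2 / 2))) * (rexp (-p.2.1) * rexp (-(p.2.2.2 ^ 2 / 2)))
/-- limit linear form -/
def ell (c0 : ℝ) (p : R4) : ℝ :=
  (1 - c0) * (p.1 + p.2.1) - c0 * (p.2.2.1 ^ 2 + p.2.2.2 ^ 2) / 2 + p.2.2.1 * p.2.2.2
/-- regularised relative inner product -/
def Tc (r c0 : ℝ) (n : ℕ) (p : R4) : ℝ :=
  ((r ^ 2 + c0 * (1 - r ^ 2)) - UU r (ep n) p.1 * UU r (ep n) p.2.1 -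
    DD (cc r) (UU r (ep n) p.1) * DD (cc r) (UU r (ep n) p.2.1) * (ep n * (p.2.2.1 * p.2.2.2))) /
    (DD (cc r) (UU r (ep n) p.1) * DD (cc r) (UU r (ep n) p.2.1) *
      (DD (cc r) (√(ep n) * p.2.2.1) * DD (cc r) (√(ep n) * p.2.2.2)))
/-- perturbed identity -/
def ps (ε0 y : ℝ) : ℝ := y + ε0 * |y|
/-- membership in the box -/
def Bx (X : ℝ) (p : R4) : Prop := |p.1| ≤ X ∧ |p.2.1| ≤ X ∧ |p.2.2.1| ≤ X ∧ |p.2.2.2| ≤ X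

lemma ps_cont (ε0 : ℝ) : Continuous (ps ε0) := by unfold ps; fun_prop

lemma ps_mono {ε0 : ℝ} (h0 : 0 ≤ ε0) (h1 : ε0 ≤ 1) {y y' : ℝ} (h : y ≤ y') : ps ε0 y ≤ ps ε0 y' := by
  unfold ps
  have h2 := abs_sub_abs_le_abs_sub y y'
  rw [abs_of_nonpos (by linarith : y - y' ≤ 0)] at h2
  nlinarith

lemma PH_nonneg (hΦ : Bump Φ X) (p : R4) : 0 ≤ PH Φ p := mul_nonneg (hΦ.nonneg _ _) (hΦ.nonneg _ _)
lemma PH_box (hΦ : Bump Φ X) {p : R4} (h : PH Φ p ≠ 0) : Bx X p := by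
  have h1 := hΦ.supp _ _ (left_ne_zero_of_mul h)
  have h2 := hΦ.supp _ _ (right_ne_zero_of_mul h)
  exact ⟨h1.1, h2.1, h1.2, h2.2⟩
lemma Bx_norm {p : R4} (h : Bx X p) : ‖p‖ ≤ X := by
  obtain ⟨a, b, c, d⟩ := h
  simp only [Prod.norm_def, Real.norm_eq_abs]
  exact max_le a (max_le b (max_le c d))
lemma PH_cont (hΦ : Bump Φ X) : Continuous (PH Φ) := by
  unfold PH
  exact (hΦ.cont.comp (by fun_prop : Continuous fun p : R4 => (p.1, p.2.2.1))).mul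
    (hΦ.cont.comp (by fun_prop : Continuous fun p : R4 => (p.2.1, p.2.2.2)))
lemma PH_int (hΦ : Bump Φ X) {f : R4 → ℝ} (hf : Continuous f) : Integrable fun p => PH Φ p * f p :=
  integrable_of_box ((PH_cont hΦ).mul hf) fun p hp => Bx_norm (PH_box hΦ (left_ne_zero_of_mul hp))
lemma WP_cont (h0 : 0 < r) (h1 : r < 1) (n : ℕ) : Continuous (WP r n) := by
  have hs : 0 < √(1 - r ^ 2) := Real.sqrt_pos.2 (R_pos h0 h1)
  unfold WP Wn DD UU
  fun_prop
lemma WP_nonneg (h0 : 0 < r) (h1 : r < 1) (n : ℕ) (p : R4) : 0 ≤ WP r n p :=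
  mul_nonneg (Wn_nonneg h0 h1 _ _ _ _) (Wn_nonneg h0 h1 _ _ _ _)
lemma EP_cont : Continuous EP := by unfold EP; fun_prop
lemma ell_cont : Continuous (ell c0) := by unfold ell; fun_prop
lemma Tc_cont (h0 : 0 < r) (h1 : r < 1) (n : ℕ) : Continuous (Tc r c0 n) := by
  have a := DD_pos (cc_pos h0 h1)
  unfold Tc
  apply Continuous.div
  · unfold DD UU; fun_prop
  · unfold DD UU; fun_prop
  · intro p
    exact (mul_pos (mul_pos (a _) (a _)) (mul_pos (a _) (a _))).ne'
lemma Tc_eq {C1 : ℝ} {n : ℕ} (hs : Small r c0 X C1 (ep n)) {p : R4} (hp : Bx X p) :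
    Tc r c0 n p = T2 r c0 (ep n) p.1 p.2.1 p.2.2.1 p.2.2.2 := by
  unfold Tc T2
  rw [DD_U (hs.1 _ hp.1), DD_U (hs.1 _ hp.2.1), DD_V (hs.2.1 _ hp.2.2.1), DD_V (hs.2.1 _ hp.2.2.2)]

lemma J_lim (h0 : 0 < r) (h1 : r < 1) (hΦ : Bump Φ X) {C1 ε0 : ℝ} (hC1 : 0 < C1) (he0 : 0 ≤ ε0) (he1 : ε0 ≤ 1)
    (hS : ∀ᶠ n in atTop, Small r c0 X C1 (ep n)) :
    Tendsto (fun n : ℕ => ∫ p, PH Φ p * (WP r n p * ps ε0 (((n:ℝ) + 1) * (Tc r c0 n p - c0)))) atTop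
      (𝓝 (∫ p, PH Φ p * (EP p * ps ε0 (-ell c0 p)))) := by
  apply tendsto_integral_filter_of_dominated_convergence (fun p => PH Φ p * (rexp X * rexp X * (2 * C1)))
  · refine Eventually.of_forall fun n => Continuous.aestronglyMeasurable ?_
    exact (PH_cont hΦ).mul ((WP_cont h0 h1 n).mul ((ps_cont ε0).comp (continuous_const.mul ((Tc_cont h0 h1 n).sub continuous_const))))
  · filter_upwards [hS] with n hs
    refine Eventually.of_forall fun p => ?_
    rw [norm_mul, Real.norm_of_nonneg (PH_nonneg hΦ p)]
    by_cases hp : PH Φ p = 0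
    · simp [hp]
    have hb := PH_box hΦ hp
    apply mul_le_mul_of_nonneg_left _ (PH_nonneg hΦ p)
    rw [norm_mul, Real.norm_of_nonneg (WP_nonneg h0 h1 n p), Real.norm_eq_abs]
    apply mul_le_mul
    · exact mul_le_mul (Wn_le h0 h1 hΦ.Xpos _ _ _ hb.1) (Wn_le h0 h1 hΦ.Xpos _ _ _ hb.2.1) (Wn_nonneg h0 h1 _ _ _ _) (exp_pos _).le
    · rw [Tc_eq hs hb]
      have := hs.2.2 _ _ _ _ hb.1 hb.2.1 hb.2.2.1 hb.2.2.2
      have h2 : |((n:ℝ) + 1) * (T2 r c0 (ep n) p.1 p.2.1 p.2.2.1 p.2.2.2 - c0)| ≤ C1 := by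
        rw [abs_mul, abs_of_pos (by positivity)]
        calc _ ≤ ((n:ℝ) + 1) * (C1 * ep n) := mul_le_mul_of_nonneg_left this (by positivity)
          _ = C1 * (((n:ℝ) + 1) * ep n) := by ring
          _ = C1 := by rw [ep_mul, mul_one]
      generalize ((n:ℝ) + 1) * (T2 r c0 (ep n) p.1 p.2.1 p.2.2.1 p.2.2.2 - c0) = y at h2
      unfold ps
      refine (abs_add_le _ _).trans ?_
      rw [abs_mul, abs_of_nonneg he0, abs_abs]
      nlinarith [abs_nonneg y]
    · positivity
    · positivity
  · exact PH_int hΦ continuous_const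
  · refine Eventually.of_forall fun p => ?_
    by_cases hp : PH Φ p = 0
    · simp [hp]
    have hb := PH_box hΦ hp
    apply Tendsto.const_mul
    apply Tendsto.mul
    · exact (Wn_lim h0 h1 1 _ _).mul (Wn_lim h0 h1 1 _ _)
    · apply ((ps_cont ε0).tendsto _).comp
      have hε : Tendsto ep atTop (𝓝[≠] 0) := by
        rw [tendsto_nhdsWithin_iff]
        exact ⟨ep_lim, Eventually.of_forall fun n => (ep_pos n).ne'⟩
      have h := (hasDerivAt_iff_tendsto_slope.1 (T2_deriv (c0 := c0) h0 h1 p.1 p.2.1 p.2.2.1 p.2.2.2)).comp hε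
      refine h.congr' ?_
      filter_upwards [hS] with n hs
      rw [Tc_eq hs hb]
      simp only [Function.comp, slope, vsub_eq_sub, sub_zero, T2_zero h0 h1, smul_eq_mul]
      simp [ep]

lemma QT_cont {n : ℕ} (hn : 2 ≤ n) {g : ℝ → ℝ} (hg : Continuous g) {c t : ℝ} (hc : 0 < c) {f1 f2 f3 f4 : R4 → ℝ}
    (k1 : Continuous f1) (k2 : Continuous f2) (k3 : Continuous f3) (k4 : Continuous f4) :
    Continuous fun p : R4 => QT n g c t (f1 p) (f2 p) (f3 p) (f4 p) := by
  have h1 : Continuous fun p : R4 => Tau c t (f1 p) (f2 p) :=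
    (Tau_cont hc).comp (continuous_const.prodMk (k1.prodMk k2) : Continuous fun p : R4 => (t, f1 p, f2 p))
  have h2 : Continuous fun p : R4 => Tau c (Tau c t (f1 p) (f2 p)) (f3 p) (f4 p) :=
    (Tau_cont hc).comp (h1.prodMk (k3.prodMk k4) : Continuous fun p : R4 => (Tau c t (f1 p) (f2 p), f3 p, f4 p))
  unfold QT
  have hn' : (2:ℝ) ≤ n := by exact_mod_cast hn
  exact ((continuous_const.sub (h2.pow 2)).rpow_const fun p => Or.inr (by linarith)).mul (hg.comp h2)

set_option maxHeartbeats 800000 in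
lemma scaled_K4 {n : ℕ} (hn : 2 ≤ n) (h0 : 0 < r) (h1 : r < 1) (hΦ : Bump Φ X) {t : ℝ} {g : ℝ → ℝ} (hg : Continuous g)
    (hF : Cut (Fn r Φ n) (cc r)) (hN : Nondeg (Fn r Φ n) t) (ht : t ∈ Ioo (-1:ℝ) 1) :
    ∃ κ : ℝ, 0 < κ ∧ K4 n (Fn r Φ n) g (cc r) t = κ * ∫ p : R4, PH Φ p * (WP r n p *
      QT n g (cc r) t (UU r (ep n) p.1) (UU r (ep n) p.2.1) (√(ep n) * p.2.2.1) (√(ep n) * p.2.2.2)) := by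
  have hR := R_pos h0 h1
  have hs : 0 < √(1 - r ^ 2) := Real.sqrt_pos.2 hR
  have hε := ep_pos n
  have ht2 : 0 < 1 - t ^ 2 := by nlinarith [ht.1, ht.2]
  have ha : 0 < (1 - r ^ 2) / r * ep n := by positivity
  have hb : 0 < √(ep n) := Real.sqrt_pos.2 hε
  refine ⟨(1 - t ^ 2) ^ (-((n:ℝ) / 2)) * (((1 - r ^ 2) / r * ep n) * ((1 - r ^ 2) / r * ep n) * (√(ep n) * √(ep n)) *
    (√(1 - r ^ 2) ^ (n - 1) * √(1 - r ^ 2) ^ (n - 1))), by positivity, ?_⟩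
  have key : (∫ x, ∫ x', ∫ z, ∫ z', Theta n (Fn r Φ n) (QT n g (cc r) t) (cc r) (r + (1 - r ^ 2) / r * ep n * x)
      (r + (1 - r ^ 2) / r * ep n * x') (√(ep n) * z) (√(ep n) * z')) = (√(1 - r ^ 2) ^ (n - 1) * √(1 - r ^ 2) ^ (n - 1)) *
      ∫ p : R4, PH Φ p * (WP r n p *
      QT n g (cc r) t (UU r (ep n) p.1) (UU r (ep n) p.2.1) (√(ep n) * p.2.2.1) (√(ep n) * p.2.2.2)) := by
    have hc : Continuous fun p : R4 => PH Φ p * (WP r n p *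
        QT n g (cc r) t (UU r (ep n) p.1) (UU r (ep n) p.2.1) (√(ep n) * p.2.2.1) (√(ep n) * p.2.2.2)) := by
      refine (PH_cont hΦ).mul ((WP_cont h0 h1 n).mul ?_)
      exact QT_cont hn hg (cc_pos h0 h1) (by unfold UU; fun_prop) (by unfold UU; fun_prop) (by fun_prop) (by fun_prop)
    rw [← iter4 hc (X := X) fun p hp => Bx_norm (PH_box hΦ (left_ne_zero_of_mul hp))]
    rw [← integral_const_mul]
    apply integral_congr_ae
    refine Eventually.of_forall fun x => ?_
    simp only
    rw [← integral_const_mul]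
    apply integral_congr_ae
    refine Eventually.of_forall fun x' => ?_
    simp only
    rw [← integral_const_mul]
    apply integral_congr_ae
    refine Eventually.of_forall fun z => ?_
    simp only
    rw [← integral_const_mul]
    apply integral_congr_ae
    refine Eventually.of_forall fun z' => ?_
    simp only
    have e1 : ∀ x, r + (1 - r ^ 2) / r * ep n * x = UU r (ep n) x := fun x => rfl
    rw [e1, e1]
    unfold Theta
    rw [Fn_eq h0 h1, Fn_eq h0 h1]
    unfold PH WP Wn
    simp only
    rw [mul_pow, mul_pow, div_pow, div_pow]
    have : √(1 - r ^ 2) ^ (n - 1) ≠ 0 := by positivity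
    field_simp
  rw [K4_formula hn hF hN ht, subst4 _ ha hb r, key]; ring

end SCB
end

noncomputable section
namespace SCB
open Set Topology

variable {r c0 X : ℝ} {Φ : ℝ → ℝ → ℝ}

lemma ps_scale {ε0 a : ℝ} (ha : 0 ≤ a) (y : ℝ) : ps ε0 (a * y) = a * ps ε0 y := by
  unfold ps; rw [abs_mul, abs_of_nonneg ha]; ring

lemma QT_le (h0 : 0 < r) (h1 : r < 1) (hX : 0 < X) {n : ℕ} {C1 t ε0 : ℝ} (hC1 : 0 < C1) (hs : Small r c0 X C1 (ep n))
    (hc0 : 0 ≤ c0) (hsm : C1 * ep n * (1 + 1 / cc r ^ 4) < 1 - c0) (ht : t ≤ r ^ 2 + c0 * (1 - r ^ 2))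
    (ht2 : r ^ 2 + c0 * (1 - r ^ 2) - t ≤ C1 * ep n) (he0 : 0 ≤ ε0) (he1 : ε0 ≤ 1) {e d : ℕ} {s K : ℝ}
    (hsdef : s = maxRoot ((n:ℝ) / 2) ((n:ℝ) / 2 - 1 + e) d) (hcs : c0 ≤ s) (hcs2 : s ≤ c0 + C1 * ep n)
    (hK : C1 * ep n * (2 + 1 / cc r ^ 4) ≤ K) (hW0 : 0 < WW ((n:ℝ) / 2) e d s)
    (hW : ∀ τ, |τ - s| ≤ K → |WW ((n:ℝ) / 2) e d τ - WW ((n:ℝ) / 2) e d s| ≤ ε0 * WW ((n:ℝ) / 2) e d s)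
    {p : R4} (hp : Bx X p) :
    QT n (gg n e d) (cc r) t (UU r (ep n) p.1) (UU r (ep n) p.2.1) (√(ep n) * p.2.2.1) (√(ep n) * p.2.2.2) ≤
      WW ((n:ℝ) / 2) e d s * ps ε0 (Tc r c0 n p - c0) := by
  obtain ⟨τ1, m1, τ2, m2, e1, e2, hle, habs⟩ := tau_box h0 h1 hX hC1 hs hc0 hsm ht ht2 hp.1 hp.2.1 hp.2.2.1 hp.2.2.2
  have c0' := cc_pos h0 h1
  have t1 : Tau (cc r) t (UU r (ep n) p.1) (UU r (ep n) p.2.1) = τ1 :=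
    Tau_eq c0' (hs.1 _ hp.1) (hs.1 _ hp.2.1) e1 ⟨m1.1.le, m1.2.le⟩
  have t2 : Tau (cc r) τ1 (√(ep n) * p.2.2.1) (√(ep n) * p.2.2.2) = τ2 := by
    refine Tau_eq c0' ?_ ?_ ?_ ⟨m2.1.le, m2.2.le⟩
    · rw [VV_sqrt]; exact hs.2.1 _ hp.2.2.1
    · rw [VV_sqrt]; exact hs.2.1 _ hp.2.2.2
    · rw [VV_sqrt, VV_sqrt]; exact e2
  unfold QT
  rw [t1, t2, gg_WW m2, ← hsdef, Tc_eq hs hp]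
  have hK2 : |τ2 - s| ≤ K := by
    refine le_trans ?_ hK
    have h3 : |τ2 - s| ≤ |τ2 - c0| + |c0 - s| := abs_sub_le _ _ _
    rw [abs_of_nonpos (by linarith : c0 - s ≤ 0)] at h3
    nlinarith
  have h4 := hW τ2 hK2
  generalize WW ((n:ℝ) / 2) e d s = w at *
  generalize WW ((n:ℝ) / 2) e d τ2 = w2 at *
  have h5 : (τ2 - s) * (w2 - w) ≤ |τ2 - s| * (ε0 * w) := by
    refine (le_abs_self _).trans ?_
    rw [abs_mul]
    exact mul_le_mul_of_nonneg_left h4 (abs_nonneg _)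
  calc (τ2 - s) * w2 ≤ w * ps ε0 (τ2 - s) := by unfold ps; nlinarith
    _ ≤ _ := mul_le_mul_of_nonneg_left (ps_mono he0 he1 (by linarith)) hW0.le

lemma K4_nonpos (h0 : 0 < r) (h1 : r < 1) (hc0 : 0 ≤ c0) (hc1 : c0 < 1) (hΦ : Bump Φ X)
    (hL : 0 < ∫ p, PH Φ p * (EP p * ell c0 p)) :
    ∃ N0 : ℕ, 2 ≤ N0 ∧ ∀ n : ℕ, N0 ≤ n → Cut (Fn r Φ n) (cc r) ∧ ∀ e d : ℕ, e ≤ 1 → 1 ≤ d →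
      c0 ≤ maxRoot ((n:ℝ) / 2) ((n:ℝ) / 2 - 1 + e) d → ∀ t ∈ Icc (-1) (r ^ 2 + c0 * (1 - r ^ 2)),
      K4 n (Fn r Φ n) (gg n e d) (cc r) t ≤ 0 := by
  have hX := hΦ.Xpos
  have hR := R_pos h0 h1
  have c0' := cc_pos h0 h1
  obtain ⟨C1, hC1, ε1, hε1, hU⟩ := unifT (c0 := c0) h0 h1 X
  have hS : ∀ᶠ n in atTop, Small r c0 X C1 (ep n) := by
    filter_upwards [ep_lim.eventually_le_const hε1] with n hn
    exact hU (ep n) (ep_pos n).le hn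
  -- the limit is negative
  obtain ⟨L1, hL1⟩ : ∃ L1, L1 = ∫ p, PH Φ p * (EP p * |ell c0 p|) := ⟨_, rfl⟩
  obtain ⟨L0, hL0⟩ : ∃ L0, L0 = ∫ p, PH Φ p * (EP p * ell c0 p) := ⟨_, rfl⟩
  rw [← hL0] at hL
  have hEPn : ∀ p, 0 ≤ EP p := fun p => by unfold EP; positivity
  have hL1n : 0 ≤ L1 := by
    rw [hL1]
    exact integral_nonneg fun p => mul_nonneg (PH_nonneg hΦ p) (mul_nonneg (hEPn p) (abs_nonneg _))
  obtain ⟨ε0, hε00, hε01, hε02⟩ : ∃ ε0 : ℝ, 0 < ε0 ∧ ε0 ≤ 1 ∧ ε0 * L1 < L0 := by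
    refine ⟨min 1 (L0 / (2 * (L1 + 1))), by positivity, min_le_left _ _, ?_⟩
    calc _ ≤ L0 / (2 * (L1 + 1)) * L1 := mul_le_mul_of_nonneg_right (min_le_right _ _) hL1n
      _ < L0 := by
        rw [div_mul_eq_mul_div, div_lt_iff₀ (by positivity)]; nlinarith
  have hJ := J_lim (c0 := c0) h0 h1 hΦ hC1 hε00.le hε01 hS
  have hneg : (∫ p, PH Φ p * (EP p * ps ε0 (-ell c0 p))) < 0 := by
    have i1 : Integrable fun p => PH Φ p * (EP p * |ell c0 p|) := PH_int hΦ (EP_cont.mul ell_cont.abs)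
    have i2 : Integrable fun p => PH Φ p * (EP p * ell c0 p) := PH_int hΦ (EP_cont.mul ell_cont)
    have : (∫ p, PH Φ p * (EP p * ps ε0 (-ell c0 p))) = ε0 * L1 - L0 := by
      rw [hL1, hL0, ← integral_const_mul, ← integral_sub (i1.const_mul _) i2]
      apply integral_congr_ae
      refine Eventually.of_forall fun p => ?_
      simp only [ps, abs_neg]
      ring
    rw [this]; linarith
  obtain ⟨M, hM1, hM⟩ := lemmaW (c1 := (1 + c0) / 2) (K := C1 * (2 + 1 / cc r ^ 4)) (ε0 := ε0) (by linarith) (by linarith)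
    (by positivity) hε00
  have t0pos : 0 < r ^ 2 + c0 * (1 - r ^ 2) := by positivity
  have t0lt : r ^ 2 + c0 * (1 - r ^ 2) < 1 := by nlinarith
  have lim1 : Tendsto (fun n => C1 * ep n * (1 + 1 / cc r ^ 4)) atTop (𝓝 0) := by
    have := (ep_lim.const_mul C1).mul_const (1 + 1 / cc r ^ 4)
    rw [mul_zero, zero_mul] at this; exact this
  have lim2 : Tendsto (fun n => C1 * ep n) atTop (𝓝 0) := by simpa using ep_lim.const_mul C1
  have lim3 : ∀ᶠ n : ℕ in atTop, M ≤ (n:ℝ) / 2 := by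
    filter_upwards [tendsto_natCast_atTop_atTop.eventually_ge_atTop (2 * M)] with n hn
    linarith
  have ev := hS.and ((hJ.eventually_lt_const hneg).and ((lim1.eventually_lt_const (by linarith : 0 < 1 - c0)).and
    ((lim2.eventually_lt_const (by linarith : 0 < (1 - c0) / 2)).and ((lim2.eventually_lt_const one_pos).and lim3))))
  obtain ⟨N1, hN1⟩ := eventually_atTop.1 ev
  refine ⟨max N1 2, le_max_right _ _, fun n hn => ?_⟩
  obtain ⟨hs, hJn, hsm, hsm2, hsm3, hMn⟩ := hN1 n ((le_max_left _ _).trans hn)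
  have hn2 : 2 ≤ n := (le_max_right _ _).trans hn
  have hcut := Fn_cut h0 h1 hΦ hs
  refine ⟨hcut, fun e d he hd hcs t ht => ?_⟩
  obtain ⟨s, hsdef⟩ : ∃ s, s = maxRoot ((n:ℝ) / 2) ((n:ℝ) / 2 - 1 + e) d := ⟨_, rfl⟩
  rw [← hsdef] at hcs
  by_cases hor : C1 * ep n ≤ r ^ 2 + c0 * (1 - r ^ 2) - t ∨ c0 + C1 * ep n ≤ s
  · refine regime1 h0 h1 hΦ hC1 hs hc0 (by linarith) hcs ht.2 hor fun τ hτ => ?_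
    unfold gg
    rw [← hsdef]
    have a1 : 0 ≤ (1 + τ) ^ e := pow_nonneg (by linarith [hτ.1]) _
    exact mul_nonpos_of_nonpos_of_nonneg (mul_nonpos_of_nonneg_of_nonpos a1 (by linarith [hτ.2])) (sq_nonneg _)
  · push Not at hor
    obtain ⟨hor1, hor2⟩ := hor
    have htI : t ∈ Ioo (-1:ℝ) 1 := ⟨by linarith, by linarith [ht.2]⟩
    have hnd := nondeg h0 h1 hΦ hC1 hs hc0 hsm ht.2 hor1.le
    obtain ⟨κ, hκ, hK4⟩ := scaled_K4 hn2 h0 h1 hΦ (gg_cont n e d) hcut hnd htI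
    rw [hK4]
    apply mul_nonpos_of_nonneg_of_nonpos hκ.le
    have he' : (e:ℝ) ≤ 1 := by exact_mod_cast he
    obtain ⟨hW0, hW⟩ := hM _ hMn e (Nat.cast_nonneg e) he' d hd (by rw [← hsdef]; linarith) (by rw [← hsdef]; linarith)
    rw [← hsdef] at hW0 hW
    have hn0 : (0:ℝ) < n := by exact_mod_cast (by omega : 0 < n)
    have hKK : C1 * ep n * (2 + 1 / cc r ^ 4) ≤ C1 * (2 + 1 / cc r ^ 4) / ((n:ℝ) / 2) := by
      have : ep n ≤ 1 / ((n:ℝ) / 2) := by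
        unfold ep
        apply one_div_le_one_div_of_le (by positivity); linarith
      calc _ = C1 * (2 + 1 / cc r ^ 4) * ep n := by ring
        _ ≤ C1 * (2 + 1 / cc r ^ 4) * (1 / ((n:ℝ) / 2)) := mul_le_mul_of_nonneg_left this (by positivity)
        _ = _ := by ring
    have hb : (∫ p : R4, PH Φ p * (WP r n p *
        QT n (gg n e d) (cc r) t (UU r (ep n) p.1) (UU r (ep n) p.2.1) (√(ep n) * p.2.2.1) (√(ep n) * p.2.2.2))) ≤
        ∫ p : R4, WW ((n:ℝ) / 2) e d s * ep n * (PH Φ p * (WP r n p * ps ε0 (((n:ℝ) + 1) * (Tc r c0 n p - c0)))) := by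
      apply integral_mono
      · refine PH_int hΦ ((WP_cont h0 h1 n).mul ?_)
        exact QT_cont hn2 (gg_cont n e d) c0' (by unfold UU; fun_prop) (by unfold UU; fun_prop) (by fun_prop) (by fun_prop)
      · apply Integrable.const_mul
        exact PH_int hΦ ((WP_cont h0 h1 n).mul ((ps_cont ε0).comp (continuous_const.mul ((Tc_cont h0 h1 n).sub continuous_const))))
      · intro p
        simp only
        by_cases hp : PH Φ p = 0
        · simp [hp]
        have := QT_le h0 h1 hX hC1 hs hc0 hsm ht.2 hor1.le hε00.le hε01 hsdef hcs hor2.le hKK hW0 hW (PH_box hΦ hp)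
        rw [ps_scale (by positivity)]
        calc _ ≤ PH Φ p * (WP r n p * (WW ((n:ℝ) / 2) e d s * ps ε0 (Tc r c0 n p - c0))) :=
              mul_le_mul_of_nonneg_left (mul_le_mul_of_nonneg_left this (WP_nonneg h0 h1 n p)) (PH_nonneg hΦ p)
          _ = (PH Φ p * (WP r n p * (WW ((n:ℝ) / 2) e d s * ps ε0 (Tc r c0 n p - c0)))) * (((n:ℝ) + 1) * ep n) := by
              rw [ep_mul, mul_one]
          _ = _ := by ring
    refine hb.trans ?_
    rw [integral_const_mul]
    exact mul_nonpos_of_nonneg_of_nonpos (mul_nonneg hW0.le (ep_pos n).le) hJn.le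

end SCB
end

noncomputable section
namespace SCB
open Set Topology

variable {r c0 X : ℝ} {Φ : ℝ → ℝ → ℝ}

/-- trapezoid function -/
def trap (a b δ y : ℝ) : ℝ := max 0 (min 1 (min ((y - a) / δ) ((b - y) / δ)))

lemma trap_cont (a b δ : ℝ) : Continuous (trap a b δ) := by unfold trap; fun_prop
lemma trap_nonneg (a b δ y : ℝ) : 0 ≤ trap a b δ y := le_max_left _ _
lemma trap_le_one (a b δ y : ℝ) : trap a b δ y ≤ 1 := max_le zero_le_one (min_le_left _ _)
lemma trap_supp {a b δ y : ℝ} (hδ : 0 < δ) (h : trap a b δ y ≠ 0) : a ≤ y ∧ y ≤ b := by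
  constructor
  · by_contra! h'
    apply h
    apply max_eq_left
    refine (min_le_right _ _).trans ((min_le_left _ _).trans ?_)
    exact div_nonpos_of_nonpos_of_nonneg (by linarith) hδ.le
  · by_contra! h'
    apply h
    apply max_eq_left
    refine (min_le_right _ _).trans ((min_le_right _ _).trans ?_)
    exact div_nonpos_of_nonpos_of_nonneg (by linarith) hδ.le
lemma trap_one {a b δ y : ℝ} (hδ : 0 < δ) (h1 : a + δ ≤ y) (h2 : y ≤ b - δ) : trap a b δ y = 1 := by
  unfold trap
  rw [min_eq_left, max_eq_right zero_le_one]
  apply le_min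
  · rw [le_div_iff₀ hδ]; linarith
  · rw [le_div_iff₀ hδ]; linarith

/-- double integral against a cutoff -/
def I2 (Φ a : ℝ → ℝ → ℝ) : ℝ := ∫ x, ∫ z, Φ x z * a x z

lemma prod4 (hΦ : Bump Φ X) {a b : ℝ → ℝ → ℝ} (ha : Continuous fun p : ℝ × ℝ => a p.1 p.2)
    (hb : Continuous fun p : ℝ × ℝ => b p.1 p.2) :
    (Integrable fun p : R4 => PH Φ p * (a p.1 p.2.2.1 * b p.2.1 p.2.2.2)) ∧
    ∫ p : R4, PH Φ p * (a p.1 p.2.2.1 * b p.2.1 p.2.2.2) = I2 Φ a * I2 Φ b := by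
  have hc : Continuous fun p : R4 => a p.1 p.2.2.1 * b p.2.1 p.2.2.2 :=
    (ha.comp (by fun_prop : Continuous fun p : R4 => (p.1, p.2.2.1))).mul
      (hb.comp (by fun_prop : Continuous fun p : R4 => (p.2.1, p.2.2.2)))
  refine ⟨PH_int hΦ hc, ?_⟩
  have hc2 : Continuous fun p : R4 => PH Φ p * (a p.1 p.2.2.1 * b p.2.1 p.2.2.2) := (PH_cont hΦ).mul hc
  rw [← iter4 hc2 (X := X) fun p hp => Bx_norm (PH_box hΦ (left_ne_zero_of_mul hp))]
  unfold I2 PH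
  rw [← integral_mul_const]
  congr 1; ext x
  rw [← integral_const_mul]
  congr 1; ext x'
  rw [← integral_mul_const]
  congr 1; ext z
  rw [← integral_const_mul]
  congr 1; ext z'
  ring

lemma box2 (hΦ : Bump Φ X) {a : ℝ → ℝ → ℝ} (ha : Continuous fun p : ℝ × ℝ => a p.1 p.2) :
    Integrable fun q : ℝ × ℝ => Φ q.1 q.2 * a q.1 q.2 := by
  refine integrable_of_box (hΦ.cont.mul ha) (X := X) fun p hp => ?_
  have := hΦ.supp _ _ (left_ne_zero_of_mul hp)
  simp only [Prod.norm_def, Real.norm_eq_abs]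
  exact max_le this.1 this.2

lemma I2_prod (hΦ : Bump Φ X) {a : ℝ → ℝ → ℝ} (ha : Continuous fun p : ℝ × ℝ => a p.1 p.2) :
    ∫ q : ℝ × ℝ, Φ q.1 q.2 * a q.1 q.2 = I2 Φ a :=
  integral_prod (fun q : ℝ × ℝ => Φ q.1 q.2 * a q.1 q.2) (box2 hΦ ha)

lemma I2_swap (hΦ : Bump Φ X) {a : ℝ → ℝ → ℝ} (ha : Continuous fun p : ℝ × ℝ => a p.1 p.2) :
    I2 Φ a = ∫ z, ∫ x, Φ x z * a x z :=
  integral_integral_swap (f := fun x z => Φ x z * a x z) (box2 hΦ ha)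

/-- sheared product cutoff -/
def shear (k : ℝ) (f h : ℝ → ℝ) (x z : ℝ) : ℝ := f (x - k * z ^ 2 / 2) * h z

lemma shear_I2 {k : ℝ} {f h : ℝ → ℝ} (hΦ : Bump (shear k f h) X) {b : ℝ → ℝ} (hb : Continuous b) :
    I2 (shear k f h) (fun x z => rexp (-x) * rexp (-(z ^ 2 / 2)) * b (x - k * z ^ 2 / 2)) =
      (∫ z, h z * rexp (-((k + 1) / 2) * z ^ 2)) * ∫ y, f y * (rexp (-y) * b y) := by
  rw [I2_swap hΦ (by fun_prop), ← integral_mul_const]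
  congr 1; ext z
  rw [← integral_sub_right_eq_self (fun y => f y * (rexp (-y) * b y)) (k * z ^ 2 / 2), ← integral_const_mul]
  congr 1; ext x
  unfold shear
  have : rexp (-x) * rexp (-(z ^ 2 / 2)) = rexp (-((k + 1) / 2) * z ^ 2) * rexp (-(x - k * z ^ 2 / 2)) := by
    rw [← Real.exp_add, ← Real.exp_add]; congr 1; ring
  rw [this]; ring

lemma lin3 {F1 F2 F3 : R4 → ℝ} (c : ℝ) (h1 : Integrable F1) (h2 : Integrable F2) (h3 : Integrable F3) :
    ∫ p, (c * F1 p + c * F2 p + F3 p) = c * (∫ p, F1 p) + c * (∫ p, F2 p) + ∫ p, F3 p := by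
  rw [← integral_const_mul, ← integral_const_mul, ← integral_add (h1.const_mul c) (h2.const_mul c)]
  exact integral_add ((h1.const_mul c).add (h2.const_mul c)) h3

lemma ell_int (hc1 : c0 < 1) {f h : ℝ → ℝ} (hΦ : Bump (shear (c0 / (1 - c0)) f h) X)
    (hh : 0 < ∫ z, h z * rexp (-((c0 / (1 - c0) + 1) / 2) * z ^ 2))
    (hf : 0 < ∫ y, f y * (rexp (-y) * 1)) (hfy : 0 < ∫ y, f y * (rexp (-y) * y)) :
    0 < ∫ p, PH (shear (c0 / (1 - c0)) f h) p * (EP p * ell c0 p) := by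
  have h1 : 0 < 1 - c0 := by linarith
  obtain ⟨k, hk⟩ : ∃ k, k = c0 / (1 - c0) := ⟨_, rfl⟩
  have hk2 : (1 - c0) * k = c0 := by rw [hk]; field_simp
  rw [← hk] at hΦ hh ⊢
  have A := shear_I2 hΦ (b := fun y => y) continuous_id
  have B := shear_I2 hΦ (b := fun _ => 1) continuous_const
  obtain ⟨i1, e1⟩ := prod4 hΦ (a := fun x z => rexp (-x) * rexp (-(z ^ 2 / 2)) * (x - k * z ^ 2 / 2))
    (b := fun x z => rexp (-x) * rexp (-(z ^ 2 / 2)) * 1) (by fun_prop) (by fun_prop)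
  obtain ⟨i2, e2⟩ := prod4 hΦ (b := fun x z => rexp (-x) * rexp (-(z ^ 2 / 2)) * (x - k * z ^ 2 / 2))
    (a := fun x z => rexp (-x) * rexp (-(z ^ 2 / 2)) * 1) (by fun_prop) (by fun_prop)
  obtain ⟨i3, e3⟩ := prod4 hΦ (b := fun x z => rexp (-x) * rexp (-(z ^ 2 / 2)) * z)
    (a := fun x z => rexp (-x) * rexp (-(z ^ 2 / 2)) * z) (by fun_prop) (by fun_prop)
  have key : ∀ p : R4, PH (shear k f h) p * (EP p * ell c0 p) =
      (1 - c0) * (PH (shear k f h) p * ((rexp (-p.1) * rexp (-(p.2.2.1 ^ 2 / 2)) * (p.1 - k * p.2.2.1 ^ 2 / 2)) *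
        (rexp (-p.2.1) * rexp (-(p.2.2.2 ^ 2 / 2)) * 1))) +
      (1 - c0) * (PH (shear k f h) p * ((rexp (-p.1) * rexp (-(p.2.2.1 ^ 2 / 2)) * 1) *
        (rexp (-p.2.1) * rexp (-(p.2.2.2 ^ 2 / 2)) * (p.2.1 - k * p.2.2.2 ^ 2 / 2)))) +
      PH (shear k f h) p * ((rexp (-p.1) * rexp (-(p.2.2.1 ^ 2 / 2)) * p.2.2.1) *
        (rexp (-p.2.1) * rexp (-(p.2.2.2 ^ 2 / 2)) * p.2.2.2)) := by
    intro p
    unfold EP ell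
    generalize PH (shear k f h) p = P
    generalize rexp (-p.1) = a1
    generalize rexp (-p.2.1) = a2
    generalize rexp (-(p.2.2.1 ^ 2 / 2)) = a3
    generalize rexp (-(p.2.2.2 ^ 2 / 2)) = a4
    linear_combination (P * a1 * a2 * a3 * a4 * (p.2.2.1 ^ 2 + p.2.2.2 ^ 2) / 2) * hk2
  rw [integral_congr_ae (Eventually.of_forall key), lin3 (1 - c0) i1 i2 i3, e1, e2, e3, A, B]
  have : 0 < (∫ z, h z * rexp (-((k + 1) / 2) * z ^ 2)) * ∫ y, f y * (rexp (-y) * y) := mul_pos hh hfy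
  have : 0 < (∫ z, h z * rexp (-((k + 1) / 2) * z ^ 2)) * ∫ y, f y * (rexp (-y) * 1) := mul_pos hh hf
  have := mul_self_nonneg (I2 (shear k f h) fun x z => rexp (-x) * rexp (-(z ^ 2 / 2)) * z)
  positivity

/-- the profile in the first variable -/
def f0 : ℝ → ℝ := trap (-(91 / 100)) 6 (1 / 100)

lemma f0_int {b : ℝ → ℝ} (hb : Continuous b) :
    ∫ y, f0 y * (rexp (-y) * b y) = (∫ y in (-(91/100:ℝ))..(-(9/10)), f0 y * (rexp (-y) * b y)) +
      (∫ y in (-(9/10:ℝ))..5, rexp (-y) * b y) + ∫ y in (5:ℝ)..6, f0 y * (rexp (-y) * b y) := by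
  have hc : Continuous fun y => f0 y * (rexp (-y) * b y) := (trap_cont _ _ _).mul (by fun_prop)
  have e1 : (∫ y, f0 y * (rexp (-y) * b y)) = ∫ y in (-(91/100:ℝ))..6, f0 y * (rexp (-y) * b y) := by
    rw [intervalIntegral.integral_of_le (by norm_num), ← integral_Icc_eq_integral_Ioc]
    symm
    apply setIntegral_eq_integral_of_forall_compl_eq_zero
    intro y hy
    by_contra h
    exact hy (trap_supp (by norm_num) (left_ne_zero_of_mul h))
  have ii : ∀ a b' : ℝ, IntervalIntegrable (fun y => f0 y * (rexp (-y) * b y)) volume a b' := fun a b' => hc.intervalIntegrable _ _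
  rw [e1, ← intervalIntegral.integral_add_adjacent_intervals (ii _ 5) (ii _ _),
    ← intervalIntegral.integral_add_adjacent_intervals (ii _ (-(9/10))) (ii _ 5)]
  congr 2
  apply intervalIntegral.integral_congr
  intro y hy
  rw [uIcc_of_le (by norm_num)] at hy
  have : f0 y = 1 := trap_one (by norm_num) (by linarith [hy.1]) (by linarith [hy.2])
  simp only [this, one_mul]

lemma exp_lo : (2.4:ℝ) ≤ rexp (9/10) := by
  have := Real.sum_le_exp_of_nonneg (x := (9/10:ℝ)) (by norm_num) 6
  refine le_trans ?_ this
  simp [Finset.sum_range_succ, Nat.factorial]; norm_num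

lemma exp_hi : rexp (-5) ≤ 1 / 100 := by
  have h : (100:ℝ) ≤ rexp 5 := by
    have e : rexp 5 = rexp 1 ^ 5 := by rw [← Real.exp_nat_mul]; norm_num
    rw [e]
    calc (100:ℝ) ≤ 2.7 ^ 5 := by norm_num
      _ ≤ _ := pow_le_pow_left₀ (by norm_num) (by linarith [Real.exp_one_gt_d9]) _
  rw [Real.exp_neg, ← one_div]
  exact one_div_le_one_div_of_le (by norm_num) h

lemma f0_I : (2.35:ℝ) ≤ ∫ y, f0 y * (rexp (-y) * 1) := by
  rw [f0_int continuous_const]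
  have a1 : 0 ≤ ∫ y in (-(91/100:ℝ))..(-(9/10)), f0 y * (rexp (-y) * 1) :=
    intervalIntegral.integral_nonneg (by norm_num) fun y _ => mul_nonneg (trap_nonneg _ _ _ _) (by positivity)
  have a2 : 0 ≤ ∫ y in (5:ℝ)..6, f0 y * (rexp (-y) * 1) :=
    intervalIntegral.integral_nonneg (by norm_num) fun y _ => mul_nonneg (trap_nonneg _ _ _ _) (by positivity)
  have a3 : (∫ y in (-(9/10:ℝ))..5, rexp (-y) * 1) = rexp (9/10) - rexp (-5) := by
    rw [intervalIntegral.integral_eq_sub_of_hasDerivAt (f := fun y => -rexp (-y))]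
    · simp; ring
    · intro y _
      have h : HasDerivAt (fun y => rexp (-y)) (rexp (-y) * (-1)) y := (hasDerivAt_neg y).exp
      have h2 : HasDerivAt (fun y => -rexp (-y)) (-(rexp (-y) * (-1))) y := h.neg
      exact h2.congr_deriv (by ring)
    · exact Continuous.intervalIntegrable (by fun_prop) _ _
  rw [a3]
  linarith [exp_lo, exp_hi]

lemma f0_Iy : 0 < ∫ y, f0 y * (rexp (-y) * y) := by
  rw [f0_int (b := fun y => y) continuous_id]
  have a1 : -(273/10000 : ℝ) ≤ ∫ y in (-(91/100:ℝ))..(-(9/10)), f0 y * (rexp (-y) * y) := by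
    have hc : Continuous fun y => f0 y * (rexp (-y) * y) := (trap_cont _ _ _).mul (by fun_prop)
    have : (∫ y in (-(91/100:ℝ))..(-(9/10)), (-(273/100):ℝ)) ≤ ∫ y in (-(91/100:ℝ))..(-(9/10)), f0 y * (rexp (-y) * y) := by
      apply intervalIntegral.integral_mono_on (by norm_num) (by simp) (hc.intervalIntegrable _ _)
      intro y hy
      have b1 : rexp (-y) ≤ 3 := by
        have : rexp (-y) ≤ rexp 1 := Real.exp_le_exp.2 (by linarith [hy.1])
        linarith [Real.exp_one_lt_d9]
      have b2 := trap_le_one (-(91 / 100)) 6 (1 / 100) y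
      have b3 := trap_nonneg (-(91 / 100)) 6 (1 / 100) y
      have b4 : f0 y * rexp (-y) ≤ 3 := by
        unfold f0
        calc _ ≤ 1 * rexp (-y) := mul_le_mul_of_nonneg_right b2 (exp_pos _).le
          _ ≤ 3 := by linarith
      have b5 : 0 ≤ f0 y * rexp (-y) := mul_nonneg b3 (exp_pos _).le
      rw [← mul_assoc]
      nlinarith [hy.1, hy.2]
    rw [intervalIntegral.integral_const] at this
    refine le_trans ?_ this
    norm_num
  have a2 : 0 ≤ ∫ y in (5:ℝ)..6, f0 y * (rexp (-y) * y) :=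
    intervalIntegral.integral_nonneg (by norm_num) fun y hy => mul_nonneg (trap_nonneg _ _ _ _)
      (mul_nonneg (exp_pos _).le (by linarith [hy.1]))
  have a3 : (∫ y in (-(9/10:ℝ))..5, rexp (-y) * y) = (1/10) * rexp (9/10) - 6 * rexp (-5) := by
    rw [intervalIntegral.integral_eq_sub_of_hasDerivAt (f := fun y => -((y + 1) * rexp (-y)))]
    · simp; ring
    · intro y _
      have h : HasDerivAt (fun y => rexp (-y)) (rexp (-y) * (-1)) y := (hasDerivAt_neg y).exp
      have h1 : HasDerivAt (fun y : ℝ => y + 1) 1 y := (hasDerivAt_id y).add_const 1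
      have h2 : HasDerivAt (fun y => -((y + 1) * rexp (-y))) (-(1 * rexp (-y) + (y + 1) * (rexp (-y) * (-1)))) y := (h1.mul h).neg
      exact h2.congr_deriv (by ring)
    · exact Continuous.intervalIntegrable (by fun_prop) _ _
  rw [a3]
  linarith [exp_lo, exp_hi]

end SCB
end

noncomputable section
namespace SCB
open Set Topology

variable {r c0 X : ℝ} {Φ : ℝ → ℝ → ℝ}

lemma exists_Z (hc1 : c0 < 1) : ∃ Z : ℝ, 0 < Z ∧
    2.45 * √(1 - c0) < ∫ z in (-Z)..Z, rexp (-((c0 / (1 - c0) + 1) / 2) * z ^ 2) := by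
  have h1 : 0 < 1 - c0 := by linarith
  have hb : (c0 / (1 - c0) + 1) / 2 = 1 / (2 * (1 - c0)) := by field_simp; ring
  have hb0 : 0 < (c0 / (1 - c0) + 1) / 2 := by rw [hb]; positivity
  have hi := integrable_exp_neg_mul_sq hb0
  have hl := intervalIntegral_tendsto_integral hi tendsto_neg_atTop_atBot tendsto_id
  rw [integral_gaussian] at hl
  have hlt : 2.45 * √(1 - c0) < √(π / ((c0 / (1 - c0) + 1) / 2)) := by
    rw [hb, show π / (1 / (2 * (1 - c0))) = (2 * π) * (1 - c0) by field_simp, Real.sqrt_mul (by positivity)]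
    apply mul_lt_mul_of_pos_right _ (Real.sqrt_pos.2 h1)
    apply Real.lt_sqrt_of_sq_lt
    nlinarith [Real.pi_gt_d2]
  obtain ⟨Z, hZ⟩ := ((hl.eventually_const_lt hlt).and (eventually_gt_atTop 0)).exists
  exact ⟨Z, hZ.2, hZ.1⟩

lemma exists_bump (hc0 : 0 ≤ c0) (hc1 : c0 < 1) : ∃ Φ X, Bump Φ X ∧ 0 < (∫ p, PH Φ p * (EP p * ell c0 p)) ∧
    √(12 * rexp 1) * √(1 - c0) < ∫ q : ℝ × ℝ, Φ q.1 q.2 * (rexp (-q.1) * rexp (-(q.2 ^ 2 / 2))) := by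
  have h1 : 0 < 1 - c0 := by linarith
  obtain ⟨Z, hZ0, hZ⟩ := exists_Z hc1
  obtain ⟨k, hk⟩ : ∃ k, k = c0 / (1 - c0) := ⟨_, rfl⟩
  have hk0 : 0 ≤ k := by rw [hk]; positivity
  obtain ⟨h, hh⟩ : ∃ h, h = trap (-(Z + 1)) (Z + 1) 1 := ⟨_, rfl⟩
  have hcont : Continuous h := by rw [hh]; exact trap_cont _ _ _
  have hΦ : Bump (shear k f0 h) (6 + k * (Z + 1) ^ 2 / 2 + (Z + 1)) := by
    refine ⟨by positivity, ?_, ?_, ?_, ?_⟩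
    · unfold shear
      have : Continuous f0 := trap_cont _ _ _
      fun_prop
    · intro x z; rw [shear, hh]; exact mul_nonneg (trap_nonneg _ _ _ _) (trap_nonneg _ _ _ _)
    · intro x z; rw [shear, hh]; exact mul_le_one₀ (trap_le_one _ _ _ _) (trap_nonneg _ _ _ _) (trap_le_one _ _ _ _)
    · intro x z hne
      rw [shear, hh] at hne
      have s1 := trap_supp (by norm_num) (left_ne_zero_of_mul hne)
      have s2 := trap_supp (by norm_num) (right_ne_zero_of_mul hne)
      have hz : z ^ 2 ≤ (Z + 1) ^ 2 := sq_le_sq' s2.1 s2.2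
      have hz2 : k * z ^ 2 ≤ k * (Z + 1) ^ 2 := mul_le_mul_of_nonneg_left hz hk0
      have hz3 : 0 ≤ k * z ^ 2 := by positivity
      constructor
      · rw [abs_le]; constructor <;> linarith [s1.1, s1.2]
      · rw [abs_le]; constructor <;> linarith [s2.1, s2.2]
  have hH : 2.45 * √(1 - c0) < ∫ z, h z * rexp (-((k + 1) / 2) * z ^ 2) := by
    rw [hk]
    refine hZ.trans_le ?_
    rw [intervalIntegral.integral_of_le (by linarith)]
    rw [← hk]
    have hi : Integrable fun z => h z * rexp (-((k + 1) / 2) * z ^ 2) := by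
      refine integrable_of_box (X := Z + 1) (by fun_prop) fun z hz => ?_
      have hz' := left_ne_zero_of_mul hz
      rw [hh] at hz'
      have := trap_supp (by norm_num) hz'
      rw [Real.norm_eq_abs, abs_le]; exact this
    have e : (∫ z in Ioc (-Z) Z, rexp (-((k + 1) / 2) * z ^ 2)) = ∫ z in Ioc (-Z) Z, h z * rexp (-((k + 1) / 2) * z ^ 2) := by
      apply setIntegral_congr_fun measurableSet_Ioc
      intro z hz
      have : h z = 1 := by rw [hh]; exact trap_one one_pos (by linarith [hz.1]) (by linarith [hz.2])
      simp only [this, one_mul]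
    rw [e]
    apply setIntegral_le_integral hi
    refine Eventually.of_forall fun z => ?_
    simp only [Pi.zero_apply, hh]
    exact mul_nonneg (trap_nonneg _ _ _ _) (exp_pos _).le
  have hs : 0 < √(1 - c0) := Real.sqrt_pos.2 h1
  have hHp : 0 < ∫ z, h z * rexp (-((k + 1) / 2) * z ^ 2) := by linarith [mul_pos (by norm_num : (0:ℝ) < 2.45) hs]
  have hf := f0_I
  refine ⟨shear k f0 h, _, hΦ, ?_, ?_⟩
  · rw [hk] at hΦ hHp ⊢
    exact ell_int hc1 hΦ hHp (by linarith) f0_Iy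
  · rw [I2_prod hΦ (a := fun x z => rexp (-x) * rexp (-(z ^ 2 / 2))) (by fun_prop)]
    have := shear_I2 hΦ (b := fun _ => 1) continuous_const
    simp only [mul_one] at this hf
    rw [this]
    have hq : √(12 * rexp 1) ≤ 2.45 * 2.35 := by
      apply Real.sqrt_le_iff.2 ⟨by norm_num, ?_⟩
      linarith [Real.exp_one_lt_d9]
    calc _ ≤ 2.45 * 2.35 * √(1 - c0) := mul_le_mul_of_nonneg_right hq hs.le
      _ = 2.45 * √(1 - c0) * 2.35 := by ring
      _ < (∫ z, h z * rexp (-((k + 1) / 2) * z ^ 2)) * 2.35 := by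
        apply mul_lt_mul_of_pos_right hH (by norm_num)
      _ ≤ _ := mul_le_mul_of_nonneg_left hf hHp.le

end SCB
end

noncomputable section
namespace SCB
open Set Topology

variable {r c0 X : ℝ} {Φ : ℝ → ℝ → ℝ}

lemma wm_cut {c : ℝ} (hc : 0 < c) (m : ℕ) {G : ℝ → ℝ} (hG : ∀ u, G u ≠ 0 → c ≤ √(1 - u ^ 2)) :
    ∫ u, G u ∂wm (m + 2) = ∫ u, DD c u ^ m * G u := by
  rw [wm_integral]
  have e : (∫ u in Ioo (-1:ℝ) 1, (1 - u ^ 2) ^ ((((m + 2 : ℕ) : ℝ) - 2) / 2) * G u) =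
      ∫ u in Ioo (-1:ℝ) 1, DD c u ^ m * G u := by
    apply setIntegral_congr_fun measurableSet_Ioo
    intro u hu
    simp only
    by_cases h : G u = 0
    · rw [h]; simp
    have h1 := hG u h
    have h2 := (sq_of_le_sqrt hc h1).1
    congr 1
    unfold DD
    rw [max_eq_left h1, Real.sqrt_eq_rpow, ← Real.rpow_mul_natCast h2.le]
    congr 1; push_cast; ring
  rw [e]
  apply setIntegral_eq_integral_of_forall_compl_eq_zero
  intro u hu
  by_cases h : G u = 0
  · rw [h]; simp
  exact absurd (sq_of_le_sqrt hc (hG u h)).2 hu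

lemma mass (h0 : 0 < r) (h1 : r < 1) (hΦ : Bump Φ X) {n : ℕ} (hn : 2 ≤ n) (hF : Cut (Fn r Φ n) (cc r)) :
    ∫ u, F1 n (Fn r Φ n) u ∂wm (n + 2) = ((1 - r ^ 2) / r * ep n) * √(ep n) * √(1 - r ^ 2) ^ n *
      ∫ q : ℝ × ℝ, Φ q.1 q.2 * Wn r 0 n q.1 q.2 := by
  have hR := R_pos h0 h1
  have hs : 0 < √(1 - r ^ 2) := Real.sqrt_pos.2 hR
  have hε := ep_pos n
  have ha : 0 < (1 - r ^ 2) / r * ep n := by positivity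
  have hb : 0 < √(ep n) := Real.sqrt_pos.2 hε
  have c0' := cc_pos h0 h1
  have e1 : ∀ u, F1 n (Fn r Φ n) u = ∫ v, DD (cc r) v ^ (n - 1) * Fn r Φ n u v := by
    intro u
    unfold F1
    have := wm_cut c0' (n - 1) (G := fun v => Fn r Φ n u v) fun v hv => (hF.supp _ _ hv).2
    rw [show n + 1 = n - 1 + 2 by omega]
    exact this
  have e2 : ∀ u, F1 n (Fn r Φ n) u ≠ 0 → cc r ≤ √(1 - u ^ 2) := by
    intro u hu
    by_contra hlt
    apply hu
    have : ∀ v, Fn r Φ n u v = 0 := fun v => by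
      by_contra hv; exact hlt (hF.supp _ _ hv).1
    rw [e1]; simp [this]
  rw [wm_cut c0' n e2, subst1 _ ha r, I2_prod hΦ (a := fun x z => Wn r 0 n x z) (Wn_cont h0 h1 0 n),
    show (1 - r ^ 2) / r * ep n * √(ep n) * √(1 - r ^ 2) ^ n * I2 Φ (fun x z => Wn r 0 n x z) =
      (1 - r ^ 2) / r * ep n * ((√(ep n) * √(1 - r ^ 2) ^ n) * I2 Φ (fun x z => Wn r 0 n x z)) by ring]
  congr 1
  unfold I2
  rw [← integral_const_mul]
  congr 1; ext x
  rw [e1, subst1 _ hb 0, ← integral_const_mul, ← integral_const_mul, ← integral_const_mul]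
  congr 1; ext z
  rw [show r + (1 - r ^ 2) / r * ep n * x = UU r (ep n) x from rfl, zero_add, Fn_eq h0 h1]
  simp only [Wn]
  rw [div_pow, Nat.sub_zero, Nat.zero_add]
  field_simp

lemma mass_lim (h0 : 0 < r) (h1 : r < 1) (hΦ : Bump Φ X) :
    Tendsto (fun n : ℕ => ∫ q : ℝ × ℝ, Φ q.1 q.2 * Wn r 0 n q.1 q.2) atTop
      (𝓝 (∫ q : ℝ × ℝ, Φ q.1 q.2 * (rexp (-q.1) * rexp (-(q.2 ^ 2 / 2))))) := by
  apply tendsto_integral_filter_of_dominated_convergence (fun q => Φ q.1 q.2 * rexp X)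
  · refine Eventually.of_forall fun n => Continuous.aestronglyMeasurable ?_
    exact hΦ.cont.mul (Wn_cont h0 h1 0 n)
  · refine Eventually.of_forall fun n => Eventually.of_forall fun q => ?_
    rw [norm_mul, Real.norm_of_nonneg (hΦ.nonneg _ _), Real.norm_of_nonneg (Wn_nonneg h0 h1 _ _ _ _)]
    by_cases hq : Φ q.1 q.2 = 0
    · simp [hq]
    exact mul_le_mul_of_nonneg_left (Wn_le h0 h1 hΦ.Xpos _ _ _ (hΦ.supp _ _ hq).1) (hΦ.nonneg _ _)
  · exact box2 hΦ (a := fun _ _ => rexp X) continuous_const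
  · exact Eventually.of_forall fun q => (Wn_lim h0 h1 0 _ _).const_mul _

lemma w0w0 {n : ℕ} (hn : 2 ≤ n) : (∫ _, (1:ℝ) ∂wm (n + 1)) * (∫ _, (1:ℝ) ∂wm (n + 2)) = 2 * π * ep n := by
  have a1 := om_succ (n := n + 1) (by omega)
  have a2 := om_succ (n := n + 2) (by omega)
  have a3 := om_add_two (m := n + 1) (by omega)
  have a4 := om_pos (n := n + 1) (by omega)
  have e : om (n + 1) * ((∫ _, (1:ℝ) ∂wm (n + 1)) * (∫ _, (1:ℝ) ∂wm (n + 2))) = om (n + 1) * (2 * π * ep n) := by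
    rw [← mul_assoc, ← a1, ← a2]
    rw [show n + 2 + 1 = n + 1 + 2 by ring, a3]
    unfold ep; push_cast; ring
  exact mul_left_cancel₀ a4.ne' e

lemma Mcode_le {N : ℕ} {θ a b : ℝ} (ha : 0 < a)
    (H : ∀ A : Finset (EuclideanSpace ℝ (Fin N)), (∀ x ∈ A, ‖x‖ = 1) → (∀ x ∈ A, ∀ y ∈ A, x ≠ y → ⟪x, y⟫ ≤ Real.cos θ) →
      (A.card : ℝ) * a ≤ b) : (Mcode N θ : ℝ) * a ≤ b := by
  have hne : {N' : ℕ | ∃ A : Finset (EuclideanSpace ℝ (Fin N)), A.card = N' ∧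
    (∀ x ∈ A, ‖x‖ = 1) ∧ ∀ x ∈ A, ∀ y ∈ A, x ≠ y → ⟪x, y⟫ ≤ Real.cos θ}.Nonempty := ⟨0, ∅, by simp⟩
  have hbd : BddAbove {N' : ℕ | ∃ A : Finset (EuclideanSpace ℝ (Fin N)), A.card = N' ∧
    (∀ x ∈ A, ‖x‖ = 1) ∧ ∀ x ∈ A, ∀ y ∈ A, x ≠ y → ⟪x, y⟫ ≤ Real.cos θ} := by
    refine ⟨⌈b / a⌉₊, ?_⟩
    rintro k ⟨A, rfl, h1, h2⟩
    have := H A h1 h2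
    rw [← le_div_iff₀ ha] at this
    exact_mod_cast this.trans (Nat.le_ceil _)
  obtain ⟨A, hA, h1, h2⟩ := Nat.sSup_mem hne hbd
  have := H A h1 h2
  rw [hA] at this
  exact this

lemma bound_eventually (h0 : 0 < r) (h1 : r < 1) {θ θ' : ℝ} (hc0 : 0 ≤ Real.cos θ') (hc1 : Real.cos θ' < 1)
    (ht : Real.cos θ = r ^ 2 + Real.cos θ' * (1 - r ^ 2)) :
    ∀ᶠ n : ℕ in atTop, 0 < MLev (n + 1) θ' ∧ (Mcode (n + 3) θ : ℝ) * (1 - r ^ 2) ^ ((((n + 3 : ℕ) : ℝ) - 1) / 2) /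
      (√(2 * π * ((n + 3 : ℕ) : ℝ)) * r * MLev (n + 1) θ') ≤ √(π / (6 * rexp 1 * (1 - Real.cos θ'))) := by
  have hR := R_pos h0 h1
  have hs : 0 < √(1 - r ^ 2) := Real.sqrt_pos.2 hR
  have hc : 0 < 1 - Real.cos θ' := by linarith
  obtain ⟨Φ, X, hΦ, hL, hB⟩ := exists_bump hc0 hc1
  obtain ⟨N0, hN0, HN⟩ := K4_nonpos h0 h1 hc0 hc1 hΦ hL
  have hlim := (mass_lim h0 h1 hΦ).eventually_const_lt hB
  filter_upwards [hlim, eventually_ge_atTop N0] with n hBn hn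
  have hn2 : 2 ≤ n := hN0.trans hn
  obtain ⟨hcut, HK⟩ := HN n hn
  obtain ⟨e, d, he, hd, hroot, hM, hg1, hlow⟩ := lev_summary hn2 hc0 hc1
  have he1 : e ≤ 1 := by omega
  refine ⟨hM, ?_⟩
  have hK := HK e d he1 hd hroot
  obtain ⟨Bn, hBdef⟩ : ∃ Bn, Bn = ∫ q : ℝ × ℝ, Φ q.1 q.2 * Wn r 0 n q.1 q.2 := ⟨_, rfl⟩
  rw [← hBdef] at hBn
  have hε := ep_pos n
  have hse : 0 < √(ep n) := Real.sqrt_pos.2 hε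
  have hQ : 0 < √(12 * rexp 1) * √(1 - Real.cos θ') := by positivity
  have hBp : 0 < Bn := hQ.trans hBn
  have main := Mcode_le (N := n + 3) (θ := θ) (a := ((1 - r ^ 2) / r * ep n) * √(ep n) * √(1 - r ^ 2) ^ n * Bn)
    (b := MLev (n + 1) θ' * (2 * π * ep n)) (by positivity) (by
      intro A hA1 hA2
      have := main_ineq hn2 hcut (gg_cont n e d) hM.le hg1 hlow hK (ι := Fin A.card) (fun i => (A.equivFin.symm i : EE (n + 3)))
        (fun i => hA1 _ (A.equivFin.symm i).2) (fun i j hij => by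
          rw [← ht]
          refine hA2 _ (A.equivFin.symm i).2 _ (A.equivFin.symm j).2 fun h => hij ?_
          exact A.equivFin.symm.injective (Subtype.ext h))
      rw [mass h0 h1 hΦ hn2 hcut, w0w0 hn2, ← hBdef, Fintype.card_fin] at this
      exact this)
  have hpow : (1 - r ^ 2) ^ ((((n + 3 : ℕ) : ℝ) - 1) / 2) = (1 - r ^ 2) * √(1 - r ^ 2) ^ n := by
    rw [show (((n + 3 : ℕ) : ℝ) - 1) / 2 = 1 + (1 / 2) * n by push_cast; ring, Real.rpow_add hR, Real.rpow_one,
      Real.rpow_mul hR.le, ← Real.sqrt_eq_rpow, Real.rpow_natCast]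
  rw [hpow]
  have hN : √(2 * π * (((n:ℝ)) + 1)) ≤ √(2 * π * ((n + 3 : ℕ) : ℝ)) := by
    apply Real.sqrt_le_sqrt
    push_cast
    apply mul_le_mul_of_nonneg_left _ (by positivity); linarith
  have hN2 : √(2 * π * (((n:ℝ)) + 1)) = √(2 * π) * √((n:ℝ) + 1) := Real.sqrt_mul (by positivity) _
  have hgoal : √(π / (6 * rexp 1 * (1 - Real.cos θ'))) * (√(12 * rexp 1) * √(1 - Real.cos θ')) = √(2 * π) := by
    rw [← Real.sqrt_mul (by positivity), ← Real.sqrt_mul (by positivity)]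
    congr 1
    field_simp; norm_num
  obtain ⟨G, hG⟩ : ∃ G, G = √(π / (6 * rexp 1 * (1 - Real.cos θ'))) := ⟨_, rfl⟩
  rw [← hG] at hgoal ⊢
  have hGp : 0 < G := by rw [hG]; positivity
  have hGB : √(2 * π) ≤ G * Bn := by rw [← hgoal]; exact mul_le_mul_of_nonneg_left hBn.le hGp.le
  rw [div_le_iff₀ (by positivity)]
  -- clear the factors
  have m2 : (Mcode (n + 3) θ : ℝ) * ((1 - r ^ 2) * √(1 - r ^ 2) ^ n) * Bn ≤ MLev (n + 1) θ' * (2 * π) * r * √((n:ℝ) + 1) := by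
    have h3 := mul_le_mul_of_nonneg_right main (by positivity : 0 ≤ r * ((n:ℝ) + 1) * √((n:ℝ) + 1))
    have q1 := ep_mul n
    have q2 := sqrt_ep n
    calc _ = (Mcode (n + 3) θ : ℝ) * ((1 - r ^ 2) * √(1 - r ^ 2) ^ n) * Bn * (((n:ℝ) + 1) * ep n) * (√((n:ℝ) + 1) * √(ep n)) := by
          rw [q1, q2]; ring
      _ = (Mcode (n + 3) θ : ℝ) * ((1 - r ^ 2) / r * ep n * √(ep n) * √(1 - r ^ 2) ^ n * Bn) * (r * ((n:ℝ) + 1) * √((n:ℝ) + 1)) := by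
          field_simp
      _ ≤ _ := h3
      _ = MLev (n + 1) θ' * (2 * π) * r * √((n:ℝ) + 1) * (((n:ℝ) + 1) * ep n) := by ring
      _ = _ := by rw [q1, mul_one]
  have m3 : (Mcode (n + 3) θ : ℝ) * ((1 - r ^ 2) * √(1 - r ^ 2) ^ n) * Bn ≤
      (G * (√(2 * π * ((n + 3 : ℕ) : ℝ)) * r * MLev (n + 1) θ')) * Bn := by
    refine m2.trans ?_
    have q3 : √(2 * π) * √(2 * π) = 2 * π := Real.mul_self_sqrt (by positivity)
    calc _ = √(2 * π) * (√(2 * π * ((n:ℝ) + 1)) * r * MLev (n + 1) θ') := by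
          rw [hN2]; linear_combination (-(MLev (n + 1) θ' * r * √((n:ℝ) + 1))) * q3
      _ ≤ (G * Bn) * (√(2 * π * ((n + 3 : ℕ) : ℝ)) * r * MLev (n + 1) θ') := by
          apply mul_le_mul hGB _ (by positivity) (by positivity)
          exact mul_le_mul_of_nonneg_right (mul_le_mul_of_nonneg_right hN h0.le) hM.le
      _ = _ := by ring
  exact le_of_mul_le_mul_right m3 hBp

end SCB

end

/-- The improvement factor obtained from averaging Levenshtein's optimal
polynomial for `M(n-2, θ')` over the Stiefel manifold `V₂(ℝ^n)`:
`M(n,θ) ≤ (1+o(1))·sqrt(π/(6e(1-cos θ')))·sqrt(2πn)·r·M_Lev(n-2,θ')/(1-r²)^{(n-1)/2}`. -/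
theorem spherical_code_bound_stiefel_two
    (θ θ' : ℝ) (hθ0 : 0 < θ) (hθθ' : θ < θ') (hθ' : θ' ≤ π / 2) :
    limsup (fun n : ℕ =>
        (Mcode n θ : ℝ) *
            (1 - Real.sqrt ((Real.cos θ - Real.cos θ') / (1 - Real.cos θ')) ^ 2) ^
              (((n : ℝ) - 1) / 2) /
          (Real.sqrt (2 * π * n) *
            Real.sqrt ((Real.cos θ - Real.cos θ') / (1 - Real.cos θ')) * MLev (n - 2) θ'))
      atTop ≤ Real.sqrt (π / (6 * Real.exp 1 * (1 - Real.cos θ'))) := by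
  have hpi := Real.pi_pos
  have hc0 : 0 ≤ Real.cos θ' := Real.cos_nonneg_of_neg_pi_div_two_le_of_le (by linarith) hθ'
  have hcc : Real.cos θ' < Real.cos θ := Real.cos_lt_cos_of_nonneg_of_le_pi hθ0.le (by linarith) hθθ'
  have hct : Real.cos θ < 1 := by
    have := Real.cos_lt_cos_of_nonneg_of_le_pi (le_refl 0) (by linarith) hθ0
    rwa [Real.cos_zero] at this
  have hc1 : Real.cos θ' < 1 := hcc.trans hct
  have h1c : 0 < 1 - Real.cos θ' := by linarith
  obtain ⟨r, hr⟩ : ∃ r, r = Real.sqrt ((Real.cos θ - Real.cos θ') / (1 - Real.cos θ')) := ⟨_, rfl⟩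
  rw [← hr]
  have hr0 : 0 < r := by rw [hr]; apply Real.sqrt_pos.2; apply div_pos <;> linarith
  have hr2 : r ^ 2 = (Real.cos θ - Real.cos θ') / (1 - Real.cos θ') := by
    rw [hr, Real.sq_sqrt]; apply div_nonneg <;> linarith
  have hr1 : r < 1 := by
    have : r ^ 2 < 1 := by rw [hr2, div_lt_one h1c]; linarith
    nlinarith
  have ht : Real.cos θ = r ^ 2 + Real.cos θ' * (1 - r ^ 2) := by
    rw [hr2]; field_simp; ring
  have hb := SCB.bound_eventually hr0 hr1 hc0 hc1 ht
  have hb2 : ∀ᶠ n : ℕ in atTop, 0 < MLev (n - 2) θ' ∧ (Mcode n θ : ℝ) * (1 - r ^ 2) ^ (((n : ℝ) - 1) / 2) /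
      (Real.sqrt (2 * π * n) * r * MLev (n - 2) θ') ≤ Real.sqrt (π / (6 * Real.exp 1 * (1 - Real.cos θ'))) := by
    obtain ⟨N, hN⟩ := eventually_atTop.1 hb
    refine eventually_atTop.2 ⟨N + 3, fun n hn => ?_⟩
    obtain ⟨m, rfl⟩ : ∃ m, n = m + 3 := ⟨n - 3, by omega⟩
    exact hN m (by omega)
  have hR : 0 < 1 - r ^ 2 := by nlinarith
  apply Filter.limsup_le_of_le
  · apply IsBoundedUnder.isCoboundedUnder_le
    refine ⟨0, ?_⟩
    rw [eventually_map]
    filter_upwards [hb2] with n hn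
    have := hn.1
    apply div_nonneg
    · exact mul_nonneg (Nat.cast_nonneg _) (Real.rpow_nonneg hR.le _)
    · positivity
  · filter_upwards [hb2] with n hn using hn.2
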